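/- Suppose (v_n) is a sequence of finite palindromic words over a finite alphabet with lengths tending to infinity, each v_n an initial segment of a fixed infinite word σ. If the real number x whose continued fraction partial quotient sequence is σ is algebraic, then x is a quadratic irrational. Consequently, if additionally σ is not eventually periodic, x is transcendental. -/

import Mathlib

/-- Value of the finite continued fraction `[a₀; a₁, …, a_k]` given as a list. -/
noncomputable def cfValR : List ℕ → ℝ
  | [] => 0
  | [a] => a
  | a :: b :: l => a + 1 / cfValR (b :: l)

/-- The `n`-th convergent `[0; a 0, …, a (n-1)]`. -/
noncomputable def cfConv (a : ℕ → ℕ) (n : ℕ) : ℝ :=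
  cfValR (0 :: List.ofFn fun i : Fin n => a i)

/-- `x` has infinite continued fraction expansion `[0; a 0, a 1, …]`. -/
def HasCF (x : ℝ) (a : ℕ → ℕ) : Prop :=
  Filter.Tendsto (cfConv a) Filter.atTop (nhds x)

/-- The length-`m` initial segment of `a` is a palindrome. -/
def PalindromicPrefix (a : ℕ → ℕ) (m : ℕ) : Prop :=
  ∀ i, i < m → a i = a (m - 1 - i)

namespace AB
open MvPolynomial

section L1
variable {σ : Type*} {R : Type*} [NormedCommRing R]

/-- The sum of the norms of the coefficients. -/
noncomputable def l1 (p : MvPolynomial σ R) : ℝ := ∑ s ∈ p.support, ‖p.coeff s‖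

lemma l1_eq_sum (p : MvPolynomial σ R) (T : Finset (σ →₀ ℕ)) (h : p.support ⊆ T) :
    l1 p = ∑ s ∈ T, ‖p.coeff s‖ := by
  unfold l1
  apply Finset.sum_subset h
  intro s _ hs
  simp [MvPolynomial.notMem_support_iff.mp hs]

lemma l1_nonneg (p : MvPolynomial σ R) : 0 ≤ l1 p :=
  Finset.sum_nonneg fun _ _ => norm_nonneg _

lemma l1_zero : l1 (0 : MvPolynomial σ R) = 0 := by simp [l1]

lemma norm_coeff_le_l1 (p : MvPolynomial σ R) (s : σ →₀ ℕ) : ‖p.coeff s‖ ≤ l1 p := by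
  classical
  rw [l1_eq_sum p (insert s p.support) (Finset.subset_insert _ _)]
  exact Finset.single_le_sum (f := fun s => ‖p.coeff s‖) (fun _ _ => norm_nonneg _)
    (Finset.mem_insert_self _ _)

lemma l1_add (p q : MvPolynomial σ R) : l1 (p + q) ≤ l1 p + l1 q := by
  classical
  rw [l1_eq_sum (p + q) (p.support ∪ q.support) MvPolynomial.support_add,
    l1_eq_sum p (p.support ∪ q.support) Finset.subset_union_left,
    l1_eq_sum q (p.support ∪ q.support) Finset.subset_union_right, ← Finset.sum_add_distrib]
  exact Finset.sum_le_sum fun s _ => by rw [coeff_add]; exact norm_add_le _ _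

lemma l1_neg (p : MvPolynomial σ R) : l1 (-p) = l1 p := by
  simp [l1, MvPolynomial.support_neg]

lemma l1_sum {ι : Type*} (S : Finset ι) (f : ι → MvPolynomial σ R) :
    l1 (∑ i ∈ S, f i) ≤ ∑ i ∈ S, l1 (f i) := by
  classical
  induction S using Finset.induction_on with
  | empty => simp [l1_zero]
  | insert a S ha ih =>
    rw [Finset.sum_insert ha, Finset.sum_insert ha]
    exact (l1_add _ _).trans (by linarith)

lemma l1_monomial (s : σ →₀ ℕ) (c : R) : l1 (monomial s c) = ‖c‖ := by
  classical
  rw [l1_eq_sum _ {s} (support_monomial_subset)]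
  simp

lemma l1_C (c : R) : l1 (C c : MvPolynomial σ R) = ‖c‖ := l1_monomial _ _

lemma l1_mul (p q : MvPolynomial σ R) : l1 (p * q) ≤ l1 p * l1 q := by
  have h : p * q = ∑ s ∈ p.support, ∑ t ∈ q.support,
      monomial (s + t) (p.coeff s * q.coeff t) := by
    conv_lhs => rw [p.as_sum, q.as_sum]
    rw [Finset.sum_mul_sum]
    simp [monomial_mul]
  rw [h]
  refine (l1_sum _ _).trans ?_
  unfold l1
  rw [Finset.sum_mul_sum]
  refine Finset.sum_le_sum fun s _ => ?_
  refine (l1_sum _ _).trans ?_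
  refine Finset.sum_le_sum fun t _ => ?_
  rw [l1_monomial]
  exact norm_mul_le _ _

variable [NormOneClass R]

lemma l1_one : l1 (1 : MvPolynomial σ R) = 1 := by
  have := l1_C (σ := σ) (1 : R)
  simpa using this

lemma l1_X (i : σ) : l1 (X i : MvPolynomial σ R) = 1 := by
  have := l1_monomial (R := R) (Finsupp.single i 1) 1
  simpa [X] using this

lemma l1_pow (p : MvPolynomial σ R) (n : ℕ) : l1 (p ^ n) ≤ l1 p ^ n := by
  induction n with
  | zero => simp [l1_one]
  | succ n ih =>
    rw [pow_succ, pow_succ]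
    exact (l1_mul _ _).trans (mul_le_mul_of_nonneg_right ih (l1_nonneg _))

lemma l1_prod {ι : Type*} (S : Finset ι) (f : ι → MvPolynomial σ R) :
    l1 (∏ i ∈ S, f i) ≤ ∏ i ∈ S, l1 (f i) := by
  classical
  induction S using Finset.induction_on with
  | empty => simp [l1_one]
  | insert a S ha ih =>
    rw [Finset.prod_insert ha, Finset.prod_insert ha]
    exact (l1_mul _ _).trans (mul_le_mul_of_nonneg_left ih (l1_nonneg _))
end L1

end AB

namespace AB
open Polynomial

/-- The Euler operator `X d/dX`. -/
noncomputable def eul : ℚ[X] →ₗ[ℚ] ℚ[X] := (LinearMap.mulLeft ℚ (X : ℚ[X])) ∘ₗ Polynomial.derivative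

lemma eul_apply (p : ℚ[X]) : eul p = X * derivative p := rfl

lemma coeff_eul (p : ℚ[X]) (n : ℕ) : (eul p).coeff n = n * p.coeff n := by
  rw [eul_apply]
  cases n with
  | zero => simp
  | succ n => rw [coeff_X_mul, coeff_derivative]; push_cast; ring

lemma coeff_eul_pow (i : ℕ) (p : ℚ[X]) (n : ℕ) : ((eul ^ i) p).coeff n = (n : ℚ) ^ i * p.coeff n := by
  induction i with
  | zero => simp
  | succ i ih => rw [pow_succ', Module.End.mul_apply, coeff_eul, ih]; ring

lemma natDegree_eul_pow (i : ℕ) (p : ℚ[X]) : ((eul ^ i) p).natDegree ≤ p.natDegree := by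
  rw [natDegree_le_iff_coeff_eq_zero]
  intro n hn
  rw [coeff_eul_pow, coeff_eq_zero_of_natDegree_lt hn, mul_zero]

lemma coeff_prod_top {ι : Type*} (S : Finset ι) (f : ι → ℚ[X]) (d : ι → ℕ)
    (h : ∀ i ∈ S, (f i).natDegree ≤ d i) :
    (∏ i ∈ S, f i).natDegree ≤ ∑ i ∈ S, d i ∧
    (∏ i ∈ S, f i).coeff (∑ i ∈ S, d i) = ∏ i ∈ S, (f i).coeff (d i) := by
  classical
  induction S using Finset.induction_on with
  | empty => simp
  | insert a S ha ih =>
    have ih := ih (fun i hi => h i (Finset.mem_insert_of_mem hi))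
    have h1 := h a (Finset.mem_insert_self _ _)
    rw [Finset.prod_insert ha, Finset.sum_insert ha, Finset.prod_insert ha]
    refine ⟨natDegree_mul_le.trans (add_le_add h1 ih.1), ?_⟩
    rw [coeff_mul_add_eq_of_natDegree_le h1 ih.1, ih.2]

/-- Euler-Wronskian matrix. -/
noncomputable def eulMat {K : ℕ} (g : Fin K → ℚ[X]) : Matrix (Fin K) (Fin K) ℚ[X] :=
  Matrix.of fun i j => (eul ^ (i : ℕ)) (g j)

lemma det_eulMat_ne_zero_of_injective {K : ℕ} (g : Fin K → ℚ[X]) (h0 : ∀ j, g j ≠ 0)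
    (hinj : Function.Injective fun j => (g j).natDegree) : (eulMat g).det ≠ 0 := by
  intro hdet
  have h1 : (eulMat g).det.coeff (∑ j, (g j).natDegree) =
      (Matrix.of fun i j : Fin K => ((g j).natDegree : ℚ) ^ (i : ℕ) * (g j).leadingCoeff).det := by
    rw [Matrix.det_apply', Matrix.det_apply', finsetSum_coeff]
    refine Finset.sum_congr rfl fun s _ => ?_
    rw [← Polynomial.C_eq_intCast, coeff_C_mul]
    congr 1
    rw [(coeff_prod_top Finset.univ (fun j => eulMat g (s j) j) (fun j => (g j).natDegree) ?_).2]
    · refine Finset.prod_congr rfl fun j _ => ?_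
      simp [eulMat, coeff_eul_pow]
    · intro j _
      exact natDegree_eul_pow _ _
  have h2 : (Matrix.of fun i j : Fin K => ((g j).natDegree : ℚ) ^ (i : ℕ) * (g j).leadingCoeff).det =
      (∏ j, (g j).leadingCoeff) * (Matrix.vandermonde fun j => ((g j).natDegree : ℚ)).det := by
    rw [← Matrix.det_transpose (Matrix.vandermonde _), ← Matrix.det_mul_row]
    congr 1
    ext i j
    simp [Matrix.vandermonde, mul_comm]
  rw [hdet, h2] at h1
  simp only [coeff_zero] at h1
  have h3 := mul_eq_zero.mp h1.symm
  rcases h3 with h3 | h3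
  · rw [Finset.prod_eq_zero_iff] at h3
    obtain ⟨j, _, hj⟩ := h3
    exact h0 j (leadingCoeff_eq_zero.mp hj)
  · refine Matrix.det_vandermonde_ne_zero_iff.mpr ?_ h3
    intro a b hab
    have h4 : ((g a).natDegree : ℚ) = (g b).natDegree := hab
    exact hinj (by exact_mod_cast h4)

lemma exists_dep_of_det_eulMat {K : ℕ} : ∀ (N : ℕ) (g : Fin K → ℚ[X]), ∑ j, (g j).natDegree = N →
    (eulMat g).det = 0 → ∃ c : Fin K → ℚ, c ≠ 0 ∧ ∑ j, c j • g j = 0 := by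
  intro N
  induction N using Nat.strong_induction_on with
  | _ N ih =>
  intro g hN hdet
  by_cases h0 : ∀ j, g j ≠ 0
  swap
  · push Not at h0
    obtain ⟨j, hj⟩ := h0
    refine ⟨Pi.single j 1, by simp, ?_⟩
    rw [Finset.sum_eq_single j]
    · simp [hj]
    · intro b _ hb; simp [hb]
    · simp
  by_cases hinj : Function.Injective fun j => (g j).natDegree
  · exact absurd hdet (det_eulMat_ne_zero_of_injective g h0 hinj)
  rw [Function.Injective] at hinj
  push Not at hinj
  obtain ⟨i, j, hd, hij⟩ := hinj
  set c : ℚ := (g j).leadingCoeff / (g i).leadingCoeff with hc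
  have hli : (g i).leadingCoeff ≠ 0 := by simpa using h0 i
  set u : ℚ[X] := g j - c • g i with hu
  have hlc : (c • g i).leadingCoeff = (g j).leadingCoeff := by
    rw [smul_eq_C_mul, leadingCoeff_mul, leadingCoeff_C, hc]; field_simp
  have hc0 : c ≠ 0 := by
    rw [hc]; exact div_ne_zero (by simpa using h0 j) hli
  have hdeg : degree u < degree (g j) := by
    apply degree_sub_lt_left _ (h0 j) hlc.symm
    rw [degree_smul_of_smul_regular _ (IsSMulRegular.of_ne_zero hc0), degree_eq_natDegree (h0 i), degree_eq_natDegree (h0 j)]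
    have hd2 : (g i).natDegree = (g j).natDegree := hd
    rw [hd2]
  by_cases hu0 : u = 0
  · refine ⟨Pi.single j 1 - Pi.single i c, ?_, ?_⟩
    · intro h
      have := congrFun h j
      simp [Ne.symm hij] at this
    · have : ∀ k, ((Pi.single j 1 - Pi.single i c : Fin K → ℚ) k) • g k =
          (Pi.single j (g j) : Fin K → ℚ[X]) k - (Pi.single i (c • g i) : Fin K → ℚ[X]) k := by
        intro k
        rw [Pi.sub_apply, sub_smul]
        congr 1
        · by_cases hk : k = j
          · subst hk; simp
          · simp [hk]
        · by_cases hk : k = i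
          · subst hk; simp
          · simp [hk]
      rw [Finset.sum_congr rfl (fun k _ => this k), Finset.sum_sub_distrib]
      simp [← hu, hu0]
  have hlt : u.natDegree < (g j).natDegree := natDegree_lt_natDegree hu0 hdeg
  set g2 : Fin K → ℚ[X] := Function.update g j u with hg2
  have hdet2 : (eulMat g2).det = 0 := by
    have : eulMat g2 = (eulMat g).updateCol j (fun k => eulMat g k j + (-C c) • eulMat g k i) := by
      ext1 k l
      by_cases hl : l = j
      · subst hl
        simp [eulMat, hg2, hu, smul_eq_C_mul, sub_eq_add_neg]
        rw [← smul_eq_C_mul, ← smul_eq_C_mul, map_smul]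
      · simp [eulMat, hg2, hl]
    rw [this, Matrix.det_updateCol_add_smul_self _ (Ne.symm hij), hdet]
  have hsum : ∑ k, (g2 k).natDegree < N := by
    rw [← hN]
    apply Finset.sum_lt_sum
    · intro k _
      by_cases hk : k = j
      · subst hk; simp [hg2]; exact hlt.le
      · simp [hg2, hk]
    · exact ⟨j, Finset.mem_univ _, by simpa [hg2] using hlt⟩
  obtain ⟨e, he0, he⟩ := ih _ hsum g2 rfl hdet2
  refine ⟨e - Pi.single i (c * e j), ?_, ?_⟩
  · intro h
    apply he0
    have hj := congrFun h j
    simp [Ne.symm hij] at hj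
    have h' := h
    simp [hj] at h'
    exact h'
  · have h1 : ∀ k, (e - Pi.single i (c * e j) : Fin K → ℚ) k • g k =
        e k • g2 k + ((Pi.single j ((e j * c) • g i) : Fin K → ℚ[X]) k - (Pi.single i ((c * e j) • g i) : Fin K → ℚ[X]) k) := by
      intro k
      rw [Pi.sub_apply, sub_smul]
      by_cases hk : k = j
      · subst hk
        simp [hg2, hu, Ne.symm hij, smul_sub, smul_smul]
      · by_cases hk2 : k = i
        · subst hk2; simp [hg2, hk]; ring
        · simp [hg2, hk, hk2]
    rw [Finset.sum_congr rfl (fun k _ => h1 k), Finset.sum_add_distrib, he, Finset.sum_sub_distrib]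
    simp [mul_comm]

end AB

namespace AB
open MvPolynomial

section Hasse
variable {n : ℕ} {R : Type*} [CommRing R]

/-- Product of binomial coefficients. -/
def bin (s t : Fin n →₀ ℕ) : ℕ := ∏ i, (s i).choose (t i)

/-- Hasse (divided) derivative. -/
noncomputable def hasse (t : Fin n →₀ ℕ) : MvPolynomial (Fin n) R →ₗ[R] MvPolynomial (Fin n) R :=
  (MvPolynomial.basisMonomials (Fin n) R).constr R fun s => monomial (s - t) (bin s t : R)

lemma hasse_monomial (t s : Fin n →₀ ℕ) (c : R) :
    hasse t (monomial s c) = monomial (s - t) (c * (bin s t : R)) := by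
  have h : (monomial s c : MvPolynomial (Fin n) R) = c • (MvPolynomial.basisMonomials (Fin n) R) s := by
    simp [MvPolynomial.coe_basisMonomials, smul_monomial]
  rw [h, map_smul, hasse, Module.Basis.constr_basis, smul_monomial, smul_eq_mul]

lemma bin_eq_zero {s t : Fin n →₀ ℕ} (h : ¬ t ≤ s) : bin s t = 0 := by
  rw [Finsupp.le_def] at h
  push Not at h
  obtain ⟨i, hi⟩ := h
  exact Finset.prod_eq_zero (Finset.mem_univ i) (Nat.choose_eq_zero_of_lt hi)

lemma coeff_hasse (t : Fin n →₀ ℕ) (p : MvPolynomial (Fin n) R) (u : Fin n →₀ ℕ) :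
    coeff u (hasse t p) = coeff (u + t) p * (bin (u + t) t : R) := by
  induction p using MvPolynomial.induction_on' with
  | add p q hp hq => rw [map_add, coeff_add, coeff_add, hp, hq]; ring
  | monomial s c =>
    rw [hasse_monomial, coeff_monomial, coeff_monomial]
    by_cases h : s = u + t
    · subst h; simp
    · rw [if_neg h, zero_mul]
      by_cases hts : t ≤ s
      · rw [if_neg]
        intro h2
        exact h (by rw [← h2, tsub_add_cancel_of_le hts])
      · simp [bin_eq_zero hts]

lemma hasse_zero (p : MvPolynomial (Fin n) R) : hasse 0 p = p := by
  ext u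
  simp [coeff_hasse, bin]

lemma bin_succ (u t : Fin n →₀ ℕ) (l : Fin n) :
    (u l + 1) * bin (u + Finsupp.single l 1 + t) t = (t l + 1) * bin (u + (t + Finsupp.single l 1)) (t + Finsupp.single l 1) := by
  unfold bin
  rw [← Finset.mul_prod_erase _ _ (Finset.mem_univ l), ← Finset.mul_prod_erase (a := l) Finset.univ (fun i => ((u + (t + Finsupp.single l 1) : Fin n →₀ ℕ) i).choose ((t + Finsupp.single l 1 : Fin n →₀ ℕ) i)) (Finset.mem_univ l)]
  have h1 : ∏ x ∈ Finset.univ.erase l, ((u + Finsupp.single l 1 + t : Fin n →₀ ℕ) x).choose (t x) =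
      ∏ x ∈ Finset.univ.erase l, ((u + (t + Finsupp.single l 1) : Fin n →₀ ℕ) x).choose ((t + Finsupp.single l 1 : Fin n →₀ ℕ) x) := by
    refine Finset.prod_congr rfl fun i hi => ?_
    have : l ≠ i := (Finset.ne_of_mem_erase hi).symm
    simp [Finsupp.single_apply, this]
  rw [h1, ← mul_assoc, ← mul_assoc]
  congr 1
  simp only [Finsupp.add_apply, Finsupp.single_eq_same]
  have := Nat.choose_succ_right_eq (u l + (t l + 1)) (t l)
  have h3 : u l + (t l + 1) - t l = u l + 1 := by omega
  rw [h3] at this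
  have h4 : u l + 1 + t l = u l + (t l + 1) := by omega
  rw [h4]
  linarith

lemma pderiv_hasse (t : Fin n →₀ ℕ) (l : Fin n) (p : MvPolynomial (Fin n) R) :
    pderiv l (hasse t p) = ((t l + 1 : ℕ) : R) • hasse (t + Finsupp.single l 1) p := by
  ext u
  rw [coeff_pderiv, coeff_hasse, coeff_smul, coeff_hasse, smul_eq_mul]
  have h := bin_succ u t l
  have h' : ((u l + 1 : ℕ) : R) * bin (u + Finsupp.single l 1 + t) t = ((t l + 1 : ℕ) : R) * bin (u + (t + Finsupp.single l 1)) (t + Finsupp.single l 1) := by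
    exact_mod_cast congrArg (Nat.cast (R := R)) h
  have e : u + Finsupp.single l 1 + t = u + (t + Finsupp.single l 1) := by abel
  rw [e] at h' ⊢
  push_cast at h' ⊢
  linear_combination (coeff (u + (t + Finsupp.single l 1)) p) * h'

end Hasse

section Wr
variable {n : ℕ}

/-- Kronecker substitution. -/
noncomputable def kron (w : Fin n → ℕ) : MvPolynomial (Fin n) ℚ →ₐ[ℚ] Polynomial ℚ :=
  aeval fun l => (Polynomial.X : Polynomial ℚ) ^ (w l)

lemma eul_mul (p q : Polynomial ℚ) : eul (p * q) = eul p * q + p * eul q := by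
  simp only [eul_apply, Polynomial.derivative_mul]; ring

lemma eul_kron (w : Fin n → ℕ) (g : MvPolynomial (Fin n) ℚ) :
    eul (kron w g) = ∑ l, ((w l : Polynomial ℚ) * Polynomial.X ^ (w l)) * kron w (pderiv l g) := by
  induction g using MvPolynomial.induction_on with
  | C a => simp [kron, eul_apply]
  | add p q hp hq =>
    simp only [map_add, hp, hq, mul_add, Finset.sum_add_distrib]
  | mul_X p i hp =>
    rw [map_mul, eul_mul, hp, Finset.sum_mul]
    have h1 : eul (kron w (X i)) = (w i : Polynomial ℚ) * Polynomial.X ^ (w i) := by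
      simp only [kron, aeval_X, eul_apply, Polynomial.derivative_X_pow]
      rcases Nat.eq_zero_or_pos (w i) with h | h
      · simp [h]
      · obtain ⟨k, hk⟩ : ∃ k, w i = k + 1 := ⟨w i - 1, by omega⟩
        rw [hk]; simp [pow_succ]; ring
    have h2 : ∀ l, (w l : Polynomial ℚ) * Polynomial.X ^ (w l) * kron w (pderiv l (p * X i)) =
        (w l : Polynomial ℚ) * Polynomial.X ^ (w l) * kron w (pderiv l p) * kron w (X i) +
        (if l = i then (w l : Polynomial ℚ) * Polynomial.X ^ (w l) * kron w p else 0) := by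
      intro l
      rw [pderiv_mul, pderiv_X]
      by_cases h : l = i
      · subst h; simp; ring
      · simp [h, Pi.single_apply, Ne.symm h]; ring
    simp_rw [h2]
    rw [Finset.sum_add_distrib, h1]
    simp
    ring

/-- The span of the operators of order at most `i`. -/
noncomputable def opSpan (w : Fin n → ℕ) (i : ℕ) :
    Submodule (Polynomial ℚ) (MvPolynomial (Fin n) ℚ → Polynomial ℚ) :=
  Submodule.span _ {F | ∃ t : Fin n →₀ ℕ, ∑ l, t l ≤ i ∧ F = fun f => kron w (hasse t f)}

lemma opSpan_mono (w : Fin n → ℕ) {i j : ℕ} (h : i ≤ j) : opSpan w i ≤ opSpan w j := by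
  apply Submodule.span_mono
  rintro F ⟨t, ht, rfl⟩
  exact ⟨t, ht.trans h, rfl⟩

lemma eul_opSpan (w : Fin n → ℕ) (i : ℕ) (F) (hF : F ∈ opSpan w i) :
    (fun f => eul (F f)) ∈ opSpan w (i + 1) := by
  induction hF using Submodule.span_induction with
  | mem F hF =>
    obtain ⟨t, ht, rfl⟩ := hF
    have : (fun f => eul (kron w (hasse t f))) = ∑ l, ((w l : Polynomial ℚ) * Polynomial.X ^ (w l) * ((t l + 1 : ℕ) : Polynomial ℚ)) • (fun f => kron w (hasse (t + Finsupp.single l 1) f)) := by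
      ext1 f
      rw [eul_kron, Finset.sum_apply]
      refine Finset.sum_congr rfl fun l _ => ?_
      rw [pderiv_hasse, map_smul, Pi.smul_apply, smul_eq_mul, Polynomial.smul_eq_C_mul]
      simp
      ring
    rw [this]
    refine Submodule.sum_mem _ fun l _ => Submodule.smul_mem _ _ (Submodule.subset_span ⟨_, ?_, rfl⟩)
    simp only [Finsupp.add_apply, Finset.sum_add_distrib]
    have : ∑ x, (Finsupp.single l 1 : Fin n →₀ ℕ) x = 1 := by
      simp [Finsupp.single_apply]
    omega
  | zero => simp only [Pi.zero_apply, map_zero]; exact Submodule.zero_mem _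
  | add F G _ _ hF hG =>
    have : (fun f => eul ((F + G) f)) = (fun f => eul (F f)) + (fun f => eul (G f)) := by
      ext1 f; simp
    rw [this]; exact Submodule.add_mem _ hF hG
  | smul c F hF' hF =>
    have : (fun f => eul ((c • F) f)) = (eul c) • F + c • (fun f => eul (F f)) := by
      ext1 f; simp [eul_mul]
    rw [this]
    exact Submodule.add_mem _ (Submodule.smul_mem _ _ (opSpan_mono w (Nat.le_succ i) hF'))
      (Submodule.smul_mem _ _ hF)

lemma eul_pow_mem (w : Fin n → ℕ) (i : ℕ) : (fun f => (eul ^ i) (kron w f)) ∈ opSpan w i := by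
  induction i with
  | zero =>
    refine Submodule.subset_span ⟨0, by simp, ?_⟩
    ext1 f; simp [hasse_zero]
  | succ i ih =>
    have := eul_opSpan w i _ ih
    simpa [pow_succ', Module.End.mul_apply] using this

lemma det_eq_zero_of_span {A : Type*} [CommRing A] {K : ℕ} (S : Fin K → Set (Fin K → A))
    (h : ∀ v : Fin K → Fin K → A, (∀ i, v i ∈ S i) → (Matrix.of v).det = 0)
    (v : Fin K → Fin K → A) (hv : ∀ i, v i ∈ Submodule.span A (S i)) : (Matrix.of v).det = 0 := by
  have key : ∀ T : Finset (Fin K), ∀ v : Fin K → Fin K → A, (∀ i ∈ T, v i ∈ Submodule.span A (S i)) →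
      (∀ i ∉ T, v i ∈ S i) → (Matrix.of v).det = 0 := by
    intro T
    induction T using Finset.induction_on with
    | empty => intro v _ h2; exact h v (fun i => h2 i (by simp))
    | insert a T ha ih =>
      intro v h1 h2
      have h3 : ∀ x ∈ Submodule.span A (S a), ((Matrix.of v).updateRow a x).det = 0 := by
        intro x hx
        induction hx using Submodule.span_induction with
        | mem x hx =>
          have : (Matrix.of v).updateRow a x = Matrix.of (Function.update v a x) := rfl
          rw [this]
          apply ih
          · intro i hi
            have : i ≠ a := fun h => ha (h ▸ hi)
            simp only [Function.update_of_ne this]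
            exact h1 i (Finset.mem_insert_of_mem hi)
          · intro i hi
            by_cases hia : i = a
            · subst hia; simpa using hx
            · simp only [Function.update_of_ne hia]
              exact h2 i (by simp [hia, hi])
        | zero => exact Matrix.det_eq_zero_of_row_eq_zero a (by intro j; simp)
        | add x y _ _ hx hy => rw [Matrix.det_updateRow_add, hx, hy, add_zero]
        | smul c x _ hx => rw [Matrix.det_updateRow_smul, hx, mul_zero]
      have := h3 (v a) (h1 a (Finset.mem_insert_self _ _))
      rwa [show (Matrix.of v).updateRow a (v a) = Matrix.of v from Function.update_eq_self a v] at this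
  exact key Finset.univ v (fun i _ => hv i) (fun i hi => absurd (Finset.mem_univ i) hi)

lemma kron_inj (B : ℕ) (f : MvPolynomial (Fin n) ℚ) (hB : ∀ s ∈ f.support, ∀ l, s l < B)
    (h : kron (fun l => B ^ (l : ℕ)) f = 0) : f = 0 := by
  have hk : kron (fun l => B ^ (l : ℕ)) f =
      ∑ s ∈ f.support, Polynomial.C (coeff s f) * Polynomial.X ^ (∑ l, s l * B ^ (l : ℕ)) := by
    conv_lhs => rw [f.as_sum]
    rw [map_sum]
    refine Finset.sum_congr rfl fun s _ => ?_
    rw [kron, aeval_monomial]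
    congr 1
    rw [Finsupp.prod_fintype _ _ (by simp), ← Finset.prod_pow_eq_pow_sum]
    refine Finset.prod_congr rfl fun l _ => ?_
    rw [← pow_mul, mul_comm]
  ext s
  rw [coeff_zero]
  by_contra hs
  have hs' : s ∈ f.support := mem_support_iff.mpr hs
  have := congrArg (fun p => Polynomial.coeff p (∑ l, s l * B ^ (l : ℕ))) (hk.symm.trans h)
  simp only [Polynomial.finsetSum_coeff, Polynomial.coeff_C_mul_X_pow, Polynomial.coeff_zero] at this
  rw [Finset.sum_eq_single_of_mem s hs'] at this
  · simp at this; exact hs this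
  · intro t ht hts
    rw [if_neg]
    intro heq
    apply hts
    have e := finFunctionFinEquiv_apply (fun l => (⟨t l, hB t ht l⟩ : Fin B))
    have e' := finFunctionFinEquiv_apply (fun l => (⟨s l, hB s hs' l⟩ : Fin B))
    simp only at e e'
    have e2 : finFunctionFinEquiv (fun l => (⟨t l, hB t ht l⟩ : Fin B)) = finFunctionFinEquiv (fun l => (⟨s l, hB s hs' l⟩ : Fin B)) := by
      apply Fin.ext; rw [e, e', heq]
    have e3 := finFunctionFinEquiv.injective e2
    ext l
    have := congrFun e3 l
    simpa using this

/-- Generalized Wronskian criterion. -/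
theorem exists_wronskian {K : ℕ} (f : Fin K → MvPolynomial (Fin n) ℚ) (hf : LinearIndependent ℚ f) :
    ∃ t : Fin K → (Fin n →₀ ℕ), (∀ i, ∑ l, t i l ≤ (i : ℕ)) ∧
      (Matrix.of fun i j => hasse (t i) (f j)).det ≠ 0 := by
  by_contra hcon
  push Not at hcon
  obtain ⟨B, hB⟩ : ∃ B : ℕ, ∀ j, ∀ s ∈ (f j).support, ∀ l, s l < B := by
    refine ⟨(Finset.univ.sup fun j => (f j).support.sup fun s => Finset.univ.sup fun l => s l) + 1, ?_⟩
    intro j s hs l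
    rw [Nat.lt_succ_iff]
    calc s l ≤ Finset.univ.sup fun l => s l := Finset.le_sup (f := fun l => s l) (Finset.mem_univ l)
      _ ≤ (f j).support.sup fun s => Finset.univ.sup fun l => s l :=
        Finset.le_sup (f := fun s : Fin n →₀ ℕ => Finset.univ.sup fun l => s l) hs
      _ ≤ _ := Finset.le_sup (f := fun j => (f j).support.sup fun s => Finset.univ.sup fun l => s l) (Finset.mem_univ j)
  set w : Fin n → ℕ := fun l => B ^ (l : ℕ) with hw
  have hdet : (eulMat fun j => kron w (f j)).det = 0 := by
    refine det_eq_zero_of_span (fun i => {v | ∃ t : Fin n →₀ ℕ, ∑ l, t l ≤ (i : ℕ) ∧ v = fun j => kron w (hasse t (f j))}) ?_ _ ?_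
    · intro v hv
      choose t ht1 ht2 using hv
      have h1 := hcon t ht1
      have h2 := congrArg (kron w) h1
      rw [map_zero, AlgHom.map_det] at h2
      convert h2 using 2
      ext1 i j
      simp [ht2]
    · intro i
      have h1 := eul_pow_mem w (i : ℕ)
      let ev : (MvPolynomial (Fin n) ℚ → Polynomial ℚ) →ₗ[Polynomial ℚ] (Fin K → Polynomial ℚ) :=
        LinearMap.funLeft _ _ f
      have h2 := Submodule.mem_map_of_mem (f := ev) h1
      rw [opSpan, Submodule.map_span] at h2
      refine Submodule.span_mono ?_ h2
      rintro _ ⟨F, ⟨t, ht, rfl⟩, rfl⟩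
      exact ⟨t, ht, rfl⟩
  obtain ⟨c, hc0, hc⟩ := exists_dep_of_det_eulMat _ _ rfl hdet
  apply hc0
  have h1 : kron w (∑ j, c j • f j) = 0 := by
    rw [map_sum]; simpa using hc
  have h2 := kron_inj B _ ?_ h1
  · ext j
    exact Fintype.linearIndependent_iff.mp hf c h2 j
  · intro s hs l
    classical
    have := MvPolynomial.support_sum hs
    rw [Finset.mem_biUnion] at this
    obtain ⟨j, _, hj⟩ := this
    exact hB j s (MvPolynomial.support_smul hj) l
end Wr
end AB

namespace AB
open MvPolynomial

section Shift
variable {n : ℕ}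

/-- Translation by a point. -/
noncomputable def shift (α : Fin n → ℚ) : MvPolynomial (Fin n) ℚ →ₐ[ℚ] MvPolynomial (Fin n) ℚ :=
  aeval fun i => X i + C (α i)

lemma pderiv_shift (α : Fin n → ℚ) (l : Fin n) (p : MvPolynomial (Fin n) ℚ) :
    pderiv l (shift α p) = shift α (pderiv l p) := by
  induction p using MvPolynomial.induction_on with
  | C a => simp [shift]
  | add p q hp hq => simp only [map_add, hp, hq]
  | mul_X p i hp =>
    rw [map_mul, pderiv_mul, pderiv_mul, hp, map_add, map_mul, map_mul]
    congr 2
    simp only [shift, aeval_X, map_add, pderiv_C, add_zero, pderiv_X]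
    by_cases h : i = l
    · subst h; simp
    · simp [h]

lemma shift_hasse (α : Fin n → ℚ) : ∀ (N : ℕ) (t : Fin n →₀ ℕ), ∑ l, t l = N →
    ∀ p, hasse t (shift α p) = shift α (hasse t p) := by
  intro N
  induction N with
  | zero =>
    intro t ht p
    have : t = 0 := by
      ext l
      exact Finset.sum_eq_zero_iff.mp ht l (Finset.mem_univ l)
    subst this
    rw [hasse_zero, hasse_zero]
  | succ N ih =>
    intro t ht p
    obtain ⟨l, hl⟩ : ∃ l, t l ≠ 0 := by
      by_contra h
      push Not at h
      simp [h] at ht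
    obtain ⟨t', rfl⟩ : ∃ t' : Fin n →₀ ℕ, t = t' + Finsupp.single l 1 := by
      refine ⟨t - Finsupp.single l 1, ?_⟩
      rw [tsub_add_cancel_of_le]
      rw [Finsupp.single_le_iff]; omega
    have h1 : ∑ l, t' l = N := by
      simp only [Finsupp.add_apply, Finset.sum_add_distrib] at ht
      have : ∑ x, (Finsupp.single l 1 : Fin n →₀ ℕ) x = 1 := by simp [Finsupp.single_apply]
      omega
    have h2 := congrArg (pderiv l) (ih t' h1 p)
    rw [pderiv_hasse, pderiv_shift, pderiv_hasse, map_smul] at h2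
    have h3 : ((t' l + 1 : ℕ) : ℚ) ≠ 0 := by positivity
    exact smul_right_injective _ h3 h2

/-- Weighted degree. -/
noncomputable def wt (r : Fin n → ℕ) (J : Fin n →₀ ℕ) : ℝ := ∑ i, (J i : ℝ) / r i

lemma wt_nonneg (r : Fin n → ℕ) (J : Fin n →₀ ℕ) : 0 ≤ wt r J :=
  Finset.sum_nonneg fun _ _ => by positivity

lemma wt_add (r : Fin n → ℕ) (J J' : Fin n →₀ ℕ) : wt r (J + J') = wt r J + wt r J' := by
  simp only [wt, Finsupp.add_apply, Nat.cast_add, add_div, Finset.sum_add_distrib]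

/-- The index at a point is at least `θ`. -/
def IndGE (r : Fin n → ℕ) (α : Fin n → ℚ) (θ : ℝ) (p : MvPolynomial (Fin n) ℚ) : Prop :=
  ∀ J, wt r J < θ → coeff J (shift α p) = 0

variable {r : Fin n → ℕ} {α : Fin n → ℚ}

lemma IndGE.mono {θ η : ℝ} {p} (h : IndGE r α θ p) (hle : η ≤ θ) : IndGE r α η p :=
  fun J hJ => h J (hJ.trans_le hle)

lemma IndGE.of_nonpos {θ : ℝ} (p) (h : θ ≤ 0) : IndGE r α θ p :=
  fun J hJ => absurd hJ (not_lt.mpr (h.trans (wt_nonneg r J)))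

lemma IndGE.max {θ : ℝ} {p} (h : IndGE r α θ p) : IndGE r α (max 0 θ) p := by
  rcases max_cases 0 θ with ⟨h1, _⟩ | ⟨h1, _⟩
  · rw [h1]; exact IndGE.of_nonpos p le_rfl
  · rw [h1]; exact h

lemma IndGE.mul {θ η : ℝ} {p q} (hp : IndGE r α θ p) (hq : IndGE r α η q) :
    IndGE r α (θ + η) (p * q) := by
  intro J hJ
  rw [map_mul, coeff_mul]
  refine Finset.sum_eq_zero fun x hx => ?_
  have hx := Finset.HasAntidiagonal.mem_antidiagonal.mp hx
  rw [← hx, wt_add] at hJ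
  by_cases h : wt r x.1 < θ
  · rw [hp _ h, zero_mul]
  · rw [hq x.2 (by linarith), mul_zero]

lemma IndGE.prod {ι : Type*} (S : Finset ι) (θ : ι → ℝ) (p : ι → MvPolynomial (Fin n) ℚ)
    (h : ∀ i ∈ S, IndGE r α (θ i) (p i)) : IndGE r α (∑ i ∈ S, θ i) (∏ i ∈ S, p i) := by
  classical
  induction S using Finset.induction_on with
  | empty => simp only [Finset.sum_empty]; exact IndGE.of_nonpos _ le_rfl
  | insert a S ha ih =>
    rw [Finset.sum_insert ha, Finset.prod_insert ha]
    exact (h a (Finset.mem_insert_self _ _)).mul (ih fun i hi => h i (Finset.mem_insert_of_mem hi))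

lemma IndGE.sum {ι : Type*} (S : Finset ι) (θ : ℝ) (p : ι → MvPolynomial (Fin n) ℚ)
    (h : ∀ i ∈ S, IndGE r α θ (p i)) : IndGE r α θ (∑ i ∈ S, p i) := by
  intro J hJ
  rw [map_sum, coeff_sum]
  exact Finset.sum_eq_zero fun i hi => h i hi J hJ

lemma IndGE.hasse {θ : ℝ} {p} (t : Fin n →₀ ℕ) (h : IndGE r α θ p) :
    IndGE r α (θ - wt r t) (hasse t p) := by
  intro J hJ
  rw [← shift_hasse α _ t rfl, coeff_hasse, h, zero_mul]
  rw [wt_add]; linarith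

lemma IndGE.det {K : ℕ} (M : Matrix (Fin K) (Fin K) (MvPolynomial (Fin n) ℚ)) (θ : Fin K → ℝ)
    (h : ∀ i j, IndGE r α (θ j) (M i j)) : IndGE r α (∑ j, θ j) M.det := by
  rw [Matrix.det_apply]
  refine IndGE.sum _ _ _ fun s _ => ?_
  have := IndGE.prod Finset.univ θ (fun j => M (s j) j) (fun j _ => h _ _)
  intro J hJ
  rw [Units.smul_def, map_zsmul, coeff_smul, this J hJ, smul_zero]
end Shift

section Slice
variable {σ τ : Type*} {R : Type*}

/-- Pull back of coefficients along an injection of exponents. -/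
noncomputable def slice [CommRing R] (ι : (σ →₀ ℕ) → (τ →₀ ℕ)) (hι : Function.Injective ι) (p : MvPolynomial τ R) :
    MvPolynomial σ R :=
  ∑ a ∈ p.support.preimage ι hι.injOn, monomial a (coeff (ι a) p)

lemma coeff_slice [CommRing R] (ι : (σ →₀ ℕ) → (τ →₀ ℕ)) (hι : Function.Injective ι) (p : MvPolynomial τ R)
    (a : σ →₀ ℕ) : coeff a (slice ι hι p) = coeff (ι a) p := by
  classical
  rw [slice, coeff_sum]
  simp only [coeff_monomial]
  rw [Finset.sum_ite_eq']
  split_ifs with h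
  · rfl
  · rw [Finset.mem_preimage, notMem_support_iff] at h
    exact h.symm

lemma l1_slice [NormedCommRing R] (ι : (σ →₀ ℕ) → (τ →₀ ℕ)) (hι : Function.Injective ι) (p : MvPolynomial τ R) :
    l1 (slice ι hι p) ≤ l1 p := by
  classical
  refine (l1_sum _ _).trans ?_
  simp only [l1_monomial]
  rw [← Finset.sum_image (f := fun s => ‖coeff s p‖) (g := ι) (fun a _ b _ h => hι h)]
  apply Finset.sum_le_sum_of_subset_of_nonneg
  · intro s hs
    rw [Finset.mem_image] at hs
    obtain ⟨a, ha, rfl⟩ := hs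
    exact Finset.mem_preimage.mp ha
  · intros; positivity
end Slice

section Emb
variable {n : ℕ}

lemma fin1_ext {b b' : Fin 1 →₀ ℕ} (h : b 0 = b' 0) : b = b' :=
  Finsupp.ext fun i => by rw [Subsingleton.elim i 0]; exact h

/-- Product of polynomials in separate variables. -/
noncomputable def emb (φ : MvPolynomial (Fin n) ℚ) (ψ : MvPolynomial (Fin 1) ℚ) : MvPolynomial (Fin (n+1)) ℚ :=
  rename Fin.succ φ * rename (fun _ : Fin 1 => (0 : Fin (n+1))) ψ

lemma emb_monomial (a : Fin n →₀ ℕ) (b : Fin 1 →₀ ℕ) (x y : ℚ) :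
    emb (monomial a x) (monomial b y) = monomial (Finsupp.cons (b 0) a) (x * y) := by
  rw [emb, rename_monomial, rename_monomial, monomial_mul]
  congr 2
  ext i
  rw [Finsupp.add_apply]
  refine Fin.cases ?_ (fun i => ?_) i
  · rw [Finsupp.cons_zero, Finsupp.mapDomain_of_notMem_range]
    · have : b = Finsupp.single 0 (b 0) := fin1_ext (by simp)
      rw [this, Finsupp.mapDomain_single]; simp
    · rintro ⟨j, hj⟩; exact Fin.succ_ne_zero j hj
  · rw [Finsupp.cons_succ, Finsupp.mapDomain_apply (Fin.succ_injective n), Finsupp.mapDomain_of_notMem_range]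
    · simp
    · rintro ⟨j, hj⟩; exact Fin.succ_ne_zero i hj.symm

lemma emb_add_left (p q : MvPolynomial (Fin n) ℚ) (s) : emb (p + q) s = emb p s + emb q s := by
  simp [emb, add_mul]
lemma emb_add_right (p : MvPolynomial (Fin n) ℚ) (s t) : emb p (s + t) = emb p s + emb p t := by
  simp [emb, mul_add]

lemma emb_induction {motive : MvPolynomial (Fin n) ℚ → MvPolynomial (Fin 1) ℚ → Prop}
    (hm : ∀ a b x y, motive (monomial a x) (monomial b y))
    (h1 : ∀ p q s, motive p s → motive q s → motive (p + q) s)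
    (h2 : ∀ p s t, motive p s → motive p t → motive p (s + t)) (p s) : motive p s := by
  induction p using MvPolynomial.induction_on' with
  | add p q hp hq => exact h1 _ _ _ hp hq
  | monomial a x =>
    induction s using MvPolynomial.induction_on' with
    | add s t hs ht => exact h2 _ _ _ hs ht
    | monomial b y => exact hm _ _ _ _

lemma cons_inj {a a' : Fin n →₀ ℕ} {i i' : ℕ} :
    Finsupp.cons i a = Finsupp.cons i' a' ↔ i = i' ∧ a = a' := by
  constructor
  · intro h
    refine ⟨by simpa using congrArg (fun f => f 0) h, ?_⟩
    ext j
    have := congrArg (fun f => f j.succ) h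
    simpa using this
  · rintro ⟨rfl, rfl⟩; rfl

lemma coeff_emb (φ : MvPolynomial (Fin n) ℚ) (ψ) (a : Fin n →₀ ℕ) (b : Fin 1 →₀ ℕ) :
    coeff (Finsupp.cons (b 0) a) (emb φ ψ) = coeff a φ * coeff b ψ := by
  refine emb_induction (motive := fun φ ψ => coeff (Finsupp.cons (b 0) a) (emb φ ψ) = coeff a φ * coeff b ψ) ?_ ?_ ?_ φ ψ
  · intro a' b' x y
    rw [emb_monomial, coeff_monomial, coeff_monomial, coeff_monomial]
    have h : b' 0 = b 0 ↔ b' = b := by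
      constructor
      · exact fin1_ext
      · rintro rfl; rfl
    simp only [cons_inj, h]
    by_cases h1 : a' = a <;> by_cases h2 : b' = b <;> simp [h1, h2]
  · intro p q s hp hq; rw [emb_add_left, coeff_add, coeff_add, hp, hq]; ring
  · intro p q s hp hq; rw [emb_add_right, coeff_add, coeff_add, hp, hq]; ring

lemma hasse_emb (φ : MvPolynomial (Fin n) ℚ) (ψ) (t : Fin n →₀ ℕ) (u : Fin 1 →₀ ℕ) :
    hasse (Finsupp.cons (u 0) t) (emb φ ψ) = emb (hasse t φ) (hasse u ψ) := by
  refine emb_induction (motive := fun φ ψ => hasse (Finsupp.cons (u 0) t) (emb φ ψ) = emb (hasse t φ) (hasse u ψ)) ?_ ?_ ?_ φ ψ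
  · intro a b x y
    rw [emb_monomial, hasse_monomial, hasse_monomial, hasse_monomial, emb_monomial]
    congr 1
    · congr 1
      ext i
      refine Fin.cases ?_ (fun i => ?_) i
      · simp
      · simp
    · have : bin (Finsupp.cons (b 0) a) (Finsupp.cons (u 0) t) = bin a t * bin b u := by
        simp [bin, Fin.prod_univ_succ, mul_comm]
      rw [this]; push_cast; ring
  · intro p q s hp hq; simp only [emb_add_left, map_add, hp, hq]
  · intro p q s hp hq; simp only [emb_add_right, map_add, hp, hq]

lemma shift_emb (α : Fin (n+1) → ℚ) (φ : MvPolynomial (Fin n) ℚ) (ψ) :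
    shift α (emb φ ψ) = emb (shift (fun i => α i.succ) φ) (shift (fun _ => α 0) ψ) := by
  have h1 : shift α (rename Fin.succ φ) = rename Fin.succ (shift (fun i => α i.succ) φ) := by
    rw [shift, aeval_rename, shift, ← AlgHom.comp_apply, comp_aeval]
    congr 1
    congr 1
    ext1 i; simp
  have h2 : shift α (rename (fun _ : Fin 1 => (0 : Fin (n+1))) ψ) = rename (fun _ : Fin 1 => (0 : Fin (n+1))) (shift (fun _ => α 0) ψ) := by
    rw [shift, aeval_rename, shift, ← AlgHom.comp_apply, comp_aeval]
    congr 1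
    congr 1
    ext1 i; simp
  rw [emb, emb, map_mul, h1, h2]

lemma cons_injective_right (i : ℕ) : Function.Injective (fun a : Fin n →₀ ℕ => Finsupp.cons i a) :=
  fun _ _ h => (cons_inj.mp h).2

lemma cons_injective_left (a : Fin n →₀ ℕ) :
    Function.Injective (fun b : Fin 1 →₀ ℕ => (Finsupp.cons (b 0) a : Fin (n+1) →₀ ℕ)) := by
  intro b b' h
  exact fin1_ext (cons_inj.mp h).1

lemma ext_cons {p q : MvPolynomial (Fin (n+1)) ℚ}
    (h : ∀ (a : Fin n →₀ ℕ) (b : Fin 1 →₀ ℕ), coeff (Finsupp.cons (b 0) a) p = coeff (Finsupp.cons (b 0) a) q) : p = q := by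
  ext s
  have := h (Finsupp.tail s) (Finsupp.single 0 (s 0))
  simpa [Finsupp.cons_tail] using this

/-- Decomposition exists with `K` terms. -/
def Dec (P : MvPolynomial (Fin (n+1)) ℚ) (K : ℕ) : Prop :=
  ∃ (φ : Fin K → MvPolynomial (Fin n) ℚ) (ψ : Fin K → MvPolynomial (Fin 1) ℚ), P = ∑ l, emb (φ l) (ψ l)

lemma dec_deg (P : MvPolynomial (Fin (n+1)) ℚ) (r : ℕ) (h : ∀ s ∈ P.support, s 0 ≤ r) : Dec P (r + 1) := by
  refine ⟨fun i => slice (fun a => Finsupp.cons (i : ℕ) a) (cons_injective_right _) P,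
    fun i => monomial (Finsupp.single 0 (i : ℕ)) 1, ?_⟩
  apply ext_cons
  intro a b
  rw [coeff_sum]
  simp only [coeff_emb, coeff_slice, coeff_monomial]
  by_cases hb : b 0 ≤ r
  · rw [Finset.sum_eq_single (⟨b 0, by omega⟩ : Fin (r+1))]
    · rw [if_pos]
      · simp
      · exact fin1_ext (by simp)
    · intro i _ hi
      rw [if_neg, mul_zero]
      intro h2
      apply hi
      ext
      have := congrArg (fun f => f 0) h2
      simpa using this
    · simp
  · rw [Finset.sum_eq_zero]
    · by_contra hc
      have := h _ (mem_support_iff.mpr hc)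
      simp at this; omega
    · intro i _
      rw [if_neg, mul_zero]
      intro h2
      rw [← h2] at hb
      simp at hb
      have := i.2
      omega

lemma dec_reduce_left {K : ℕ} (P : MvPolynomial (Fin (n+1)) ℚ) (φ : Fin (K+1) → MvPolynomial (Fin n) ℚ)
    (ψ : Fin (K+1) → MvPolynomial (Fin 1) ℚ) (h : P = ∑ l, emb (φ l) (ψ l))
    (g : Fin (K+1) → ℚ) (hg : ∑ i, g i • φ i = 0) (l) (hl : g l ≠ 0) : Dec P K := by
  refine ⟨fun i => φ (l.succAbove i), fun i => ψ (l.succAbove i) - (g (l.succAbove i) / g l) • ψ l, ?_⟩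
  rw [Fin.sum_univ_succAbove _ l] at h hg
  have h1 : φ l = - ∑ i, (g (l.succAbove i) / g l) • φ (l.succAbove i) := by
    apply smul_right_injective _ hl
    simp only
    rw [eq_neg_of_add_eq_zero_left hg, smul_neg, Finset.smul_sum]
    simp only [smul_smul]
    congr 1
    refine Finset.sum_congr rfl fun i _ => ?_
    congr 1
    field_simp
  rw [h]
  simp only [emb, map_sub, map_smul, mul_sub, Finset.sum_sub_distrib]
  conv_lhs => rw [h1]
  simp only [map_neg, map_sum, map_smul, Finset.sum_mul, neg_mul, smul_mul_assoc, mul_smul_comm]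
  ring

lemma dec_reduce_right {K : ℕ} (P : MvPolynomial (Fin (n+1)) ℚ) (φ : Fin (K+1) → MvPolynomial (Fin n) ℚ)
    (ψ : Fin (K+1) → MvPolynomial (Fin 1) ℚ) (h : P = ∑ l, emb (φ l) (ψ l))
    (g : Fin (K+1) → ℚ) (hg : ∑ i, g i • ψ i = 0) (l) (hl : g l ≠ 0) : Dec P K := by
  refine ⟨fun i => φ (l.succAbove i) - (g (l.succAbove i) / g l) • φ l, fun i => ψ (l.succAbove i), ?_⟩
  rw [Fin.sum_univ_succAbove _ l] at h hg
  have h1 : ψ l = - ∑ i, (g (l.succAbove i) / g l) • ψ (l.succAbove i) := by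
    apply smul_right_injective _ hl
    simp only
    rw [eq_neg_of_add_eq_zero_left hg, smul_neg, Finset.smul_sum]
    simp only [smul_smul]
    congr 1
    refine Finset.sum_congr rfl fun i _ => ?_
    congr 1
    field_simp
  rw [h]
  simp only [emb, map_sub, map_smul, sub_mul, Finset.sum_sub_distrib]
  conv_lhs => rw [h1]
  simp only [map_neg, map_sum, map_smul, Finset.mul_sum, mul_neg, smul_mul_assoc, mul_smul_comm]
  ring

lemma exists_decomp (P : MvPolynomial (Fin (n+1)) ℚ) (r : ℕ) (h : ∀ s ∈ P.support, s 0 ≤ r) :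
    ∃ K ≤ r + 1, ∃ (φ : Fin K → MvPolynomial (Fin n) ℚ) (ψ : Fin K → MvPolynomial (Fin 1) ℚ),
      P = ∑ l, emb (φ l) (ψ l) ∧ LinearIndependent ℚ φ ∧ LinearIndependent ℚ ψ := by
  classical
  have hex : ∃ K, Dec P K := ⟨_, dec_deg P r h⟩
  have hmin : ∀ K, Dec P K → Nat.find hex ≤ K := fun K hK => Nat.find_min' hex hK
  have hspec := Nat.find_spec hex
  set K := Nat.find hex with hK
  refine ⟨K, hmin _ (dec_deg P r h), ?_⟩
  obtain ⟨φ, ψ, hP⟩ := hspec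
  clear_value K
  refine ⟨φ, ψ, hP, ?_, ?_⟩
  · rw [Fintype.linearIndependent_iff]
    by_contra hc
    push Not at hc
    obtain ⟨g, hg, l, hl⟩ := hc
    cases K with
    | zero => exact l.elim0
    | succ K =>
      have := hmin _ (dec_reduce_left P φ ψ hP g hg l hl)
      omega
  · rw [Fintype.linearIndependent_iff]
    by_contra hc
    push Not at hc
    obtain ⟨g, hg, l, hl⟩ := hc
    cases K with
    | zero => exact l.elim0
    | succ K =>
      have := hmin _ (dec_reduce_right P φ ψ hP g hg l hl)
      omega
end Emb
end AB

namespace AB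
open MvPolynomial

section Gauss

/-- Conversion to a univariate polynomial. -/
noncomputable def toUni {R : Type*} [CommRing R] : MvPolynomial (Fin 1) R →ₐ[R] Polynomial R :=
  aeval fun _ => Polynomial.X

lemma coeff_toUni {R : Type*} [CommRing R] (W : MvPolynomial (Fin 1) R) (k : ℕ) :
    (toUni W).coeff k = coeff (Finsupp.single 0 k) W := by
  induction W using MvPolynomial.induction_on' with
  | add p q hp hq => rw [map_add, Polynomial.coeff_add, coeff_add, hp, hq]
  | monomial b y =>
    rw [toUni, aeval_monomial, coeff_monomial]
    have : b = Finsupp.single 0 (b 0) := fin1_ext (by simp)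
    have h2 : (b.prod fun _ e => (Polynomial.X : Polynomial R) ^ e) = Polynomial.X ^ (b 0) := by
      rw [this]; simp
    rw [h2, Polynomial.algebraMap_eq, Polynomial.coeff_C_mul, Polynomial.coeff_X_pow]
    by_cases h : k = b 0
    · rw [if_pos h, if_pos (by rw [h]; exact this)]; simp
    · rw [if_neg h, if_neg]
      · simp
      · intro hc; apply h; rw [hc]; simp

lemma toUni_shift (α : ℚ) (V : MvPolynomial (Fin 1) ℤ) :
    toUni (shift (fun _ => α) (map (Int.castRingHom ℚ) V)) =
      ((toUni V).map (Int.castRingHom ℚ)).comp (Polynomial.X + Polynomial.C α) := by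
  induction V using MvPolynomial.induction_on with
  | C a => simp [toUni, shift]
  | add p q hp hq => simp only [map_add, hp, hq, Polynomial.map_add, Polynomial.add_comp]
  | mul_X p i hp =>
    simp only [map_mul, hp, Polynomial.map_mul, Polynomial.mul_comp]
    congr 1
    simp [toUni, shift]

lemma gauss (V : MvPolynomial (Fin 1) ℤ) (hV : V ≠ 0) (p q : ℤ) (hq : 0 < q) (hpq : IsCoprime p q) :
    ∃ b : Fin 1 →₀ ℕ, coeff b (shift (fun _ => (p / q : ℚ)) (map (Int.castRingHom ℚ) V)) ≠ 0 ∧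
      (q : ℝ) ^ (b 0) ≤ l1 V := by
  set f := toUni V with hf
  have hf0 : f ≠ 0 := by
    intro h
    apply hV
    ext b
    have : b = Finsupp.single 0 (b 0) := fin1_ext (by simp)
    rw [this, ← coeff_toUni, ← hf, h]; simp
  set F := f.map (Int.castRingHom ℚ) with hF
  have hF0 : F ≠ 0 := by
    rw [hF, Ne, Polynomial.map_eq_zero_iff]
    · exact hf0
    · exact Int.cast_injective
  set l := F.rootMultiplicity (p / q : ℚ) with hl
  refine ⟨Finsupp.single 0 l, ?_, ?_⟩
  · rw [← coeff_toUni, toUni_shift, ← hf, ← hF, hl, Polynomial.rootMultiplicity_eq_natTrailingDegree]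
    apply Polynomial.coeff_natTrailingDegree_eq_zero.not.mpr
    rw [Polynomial.comp_X_add_C_eq_zero_iff]
    exact hF0
  · have hqQ : (q : ℚ) ≠ 0 := by exact_mod_cast hq.ne'
    set g : Polynomial ℤ := Polynomial.C q * Polynomial.X - Polynomial.C p with hg
    have hprim : g.IsPrimitive := by
      intro r hr
      rw [Polynomial.C_dvd_iff_dvd_coeff] at hr
      have h0 := hr 0
      have h1 := hr 1
      simp only [hg, Polynomial.coeff_sub, Polynomial.coeff_C_mul, Polynomial.coeff_X, Polynomial.coeff_C] at h0 h1
      norm_num at h0 h1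
      exact hpq.isUnit_of_dvd' h0 h1
    have h1 : (Polynomial.X - Polynomial.C (p / q : ℚ)) ^ l ∣ F := Polynomial.pow_rootMultiplicity_dvd F _
    have h2 : (g ^ l).map (Int.castRingHom ℚ) = Polynomial.C ((q : ℚ) ^ l) * (Polynomial.X - Polynomial.C (p / q : ℚ)) ^ l := by
      rw [Polynomial.map_pow, map_pow, ← mul_pow]
      congr 1
      simp only [hg, Polynomial.map_sub, Polynomial.map_mul, Polynomial.map_C, Polynomial.map_X, mul_sub, ← Polynomial.C_mul]
      congr 2
      simp; field_simp
    have h3 : (g ^ l).map (Int.castRingHom ℚ) ∣ F := by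
      rw [h2]
      exact (Polynomial.C_mul_dvd (pow_ne_zero l hqQ)).mpr h1
    have h4 : g ^ l ∣ f := by
      have : (g ^ l).IsPrimitive := by
        clear h3 h2
        induction l with
        | zero => simp
        | succ k ih => rw [pow_succ]; exact ih.mul hprim
      exact (Polynomial.IsPrimitive.Int.dvd_iff_map_cast_dvd_map_cast _ _ this).mpr h3
    obtain ⟨e, he⟩ := h4
    have h5 : g.leadingCoeff = q := by
      rw [hg, sub_eq_add_neg, ← Polynomial.C_neg]
      exact Polynomial.leadingCoeff_linear hq.ne'
    have h6 : f.leadingCoeff = q ^ l * e.leadingCoeff := by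
      rw [he, Polynomial.leadingCoeff_mul, Polynomial.leadingCoeff_pow, h5]
    have h7 : q ^ l ≤ |f.leadingCoeff| := by
      apply Int.le_of_dvd
      · rw [abs_pos]; exact Polynomial.leadingCoeff_ne_zero.mpr hf0
      · rw [dvd_abs, h6]; exact dvd_mul_right _ _
    have h8 : ‖f.leadingCoeff‖ ≤ l1 V := by
      rw [Polynomial.leadingCoeff, hf, coeff_toUni]
      exact norm_coeff_le_l1 _ _
    rw [Int.norm_eq_abs] at h8
    refine le_trans ?_ h8
    simp only [Finsupp.single_eq_same]
    exact_mod_cast h7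
end Gauss

section Height
variable {n : ℕ}

lemma bin_le (s t : Fin n →₀ ℕ) : bin s t ≤ 2 ^ (∑ i, s i) := by
  rw [bin, ← Finset.prod_pow_eq_pow_sum]
  exact Finset.prod_le_prod' fun i _ => Nat.choose_le_two_pow _ _

lemma l1_hasse (P : MvPolynomial (Fin n) ℤ) (r : Fin n → ℕ) (h : ∀ s ∈ P.support, ∀ i, s i ≤ r i) (t) :
    l1 (hasse t P) ≤ 2 ^ (∑ i, r i) * l1 P := by
  have h1 : hasse t P = ∑ s ∈ P.support, monomial (s - t) (coeff s P * bin s t) := by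
    conv_lhs => rw [P.as_sum, map_sum]
    simp only [hasse_monomial]
  rw [h1]
  refine (l1_sum _ _).trans ?_
  rw [l1, Finset.mul_sum]
  refine Finset.sum_le_sum fun s hs => ?_
  rw [l1_monomial, norm_mul, mul_comm]
  apply mul_le_mul_of_nonneg_right _ (norm_nonneg _)
  have h2 : bin s t ≤ 2 ^ (∑ i, r i) :=
    (bin_le s t).trans (Nat.pow_le_pow_right (by norm_num) (Finset.sum_le_sum fun i _ => h s hs i))
  rw [Int.norm_eq_abs]
  have h3 : ((bin s t : ℕ) : ℝ) ≤ 2 ^ (∑ i, r i) := by exact_mod_cast h2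
  simpa using h3

lemma l1_det {σ : Type*} {K : ℕ} (M : Matrix (Fin K) (Fin K) (MvPolynomial σ ℤ)) (B : ℝ) (hB : ∀ i j, l1 (M i j) ≤ B) :
    l1 M.det ≤ K.factorial * B ^ K := by
  rw [Matrix.det_apply]
  refine (l1_sum _ _).trans ?_
  refine (Finset.sum_le_card_nsmul _ _ (B ^ K) fun s _ => ?_).trans ?_
  · have : l1 (Equiv.Perm.sign s • ∏ i, M (s i) i) = l1 (∏ i, M (s i) i) := by
      rcases Int.units_eq_one_or (Equiv.Perm.sign s) with h | h
      · rw [h, one_smul]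
      · rw [h, Units.neg_smul, one_smul, l1_neg]
    rw [this]
    refine (l1_prod _ _).trans ?_
    refine (Finset.prod_le_prod (fun i _ => l1_nonneg _) (fun i _ => hB _ _)).trans ?_
    simp
  · simp [Fintype.card_perm]
end Height
end AB

namespace AB
open MvPolynomial

lemma sum_lower (K r0 : ℕ) (hK : 1 ≤ K) (hK2 : K ≤ r0 + 1) (h0 : 0 < r0) (θ : ℝ) (hθ : 0 < θ) (hθ1 : θ ≤ 1) :
    K * θ ^ 2 / 8 ≤ ∑ j : Fin K, max 0 (θ - (j : ℕ) / r0) := by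
  rw [Fin.sum_univ_eq_sum_range (fun j => max 0 (θ - (j : ℝ) / r0)) K]
  obtain ⟨k, rfl⟩ : ∃ k, K = k + 1 := ⟨K - 1, by omega⟩
  set M := ⌊θ * k / 2⌋₊ with hM
  have hMle : (M : ℝ) ≤ θ * k / 2 := Nat.floor_le (by positivity)
  have hMlt : θ * k / 2 < M + 1 := Nat.lt_floor_add_one _
  have hkr : (k : ℝ) ≤ r0 := by exact_mod_cast (by omega : k ≤ r0)
  have hk0 : (0 : ℝ) ≤ k := by positivity
  have hM0 : (0 : ℝ) ≤ M := by positivity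
  have hr0 : (0 : ℝ) < r0 := by exact_mod_cast h0
  have hMk : M + 1 ≤ k + 1 := by
    have : (M : ℝ) ≤ k := by nlinarith
    have : M ≤ k := by exact_mod_cast this
    omega
  calc _ ≤ ∑ j ∈ Finset.range (M + 1), θ / 2 := by
        rw [Finset.sum_const, Finset.card_range, nsmul_eq_mul]
        push_cast
        nlinarith
    _ ≤ ∑ j ∈ Finset.range (M + 1), max 0 (θ - (j : ℝ) / r0) := by
        refine Finset.sum_le_sum fun j hj => le_max_of_le_right ?_
        have hj' : (j : ℝ) ≤ M := by
          have := Finset.mem_range.mp hj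
          exact_mod_cast (by omega : j ≤ M)
        have : (j : ℝ) / r0 ≤ θ / 2 := by
          rw [div_le_iff₀ hr0]; nlinarith
        linarith
    _ ≤ _ := by
        apply Finset.sum_le_sum_of_subset_of_nonneg
        · exact Finset.range_mono hMk
        · intros; exact le_max_left _ _

lemma hasse_map {n : ℕ} (t : Fin n →₀ ℕ) (P : MvPolynomial (Fin n) ℤ) :
    map (Int.castRingHom ℚ) (hasse t P) = hasse t (map (Int.castRingHom ℚ) P) := by
  ext s
  rw [coeff_map, coeff_hasse, coeff_hasse, coeff_map]
  simp

lemma map_cast_injective {σ : Type*} : Function.Injective (map (σ := σ) (Int.castRingHom ℚ)) :=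
  map_injective _ Int.cast_injective

lemma degreeOf_hasse {n : ℕ} {R : Type*} [CommRing R] (t : Fin n →₀ ℕ) (P : MvPolynomial (Fin n) R) (h : Fin n) (d : ℕ)
    (hd : ∀ s ∈ P.support, s h ≤ d) : degreeOf h (hasse t P) ≤ d := by
  rw [degreeOf_le_iff]
  intro s hs
  rw [mem_support_iff, coeff_hasse] at hs
  have := hd (s + t) (mem_support_iff.mpr (left_ne_zero_of_mul hs))
  rw [Finsupp.add_apply] at this
  omega

lemma degreeOf_det {σ R : Type*} [CommRing R] {K : ℕ} (M : Matrix (Fin K) (Fin K) (MvPolynomial σ R)) (h : σ) (d : ℕ)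
    (hM : ∀ i j, degreeOf h (M i j) ≤ d) : degreeOf h M.det ≤ K * d := by
  rw [Matrix.det_apply]
  refine (degreeOf_sum_le _ _ _).trans (Finset.sup_le fun s _ => ?_)
  have : degreeOf h (Equiv.Perm.sign s • ∏ i, M (s i) i) = degreeOf h (∏ i, M (s i) i) := by
    rcases Int.units_eq_one_or (Equiv.Perm.sign s) with h | h
    · rw [h, one_smul]
    · rw [h, Units.neg_smul, one_smul, degreeOf_neg]
  rw [this]
  refine (degreeOf_prod_le _ _ _).trans ?_
  refine (Finset.sum_le_sum fun i _ => hM _ _).trans ?_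
  simp

lemma one_le_l1 {σ : Type*} (P : MvPolynomial σ ℤ) (hP : P ≠ 0) : 1 ≤ l1 P := by
  obtain ⟨s, hs⟩ := MvPolynomial.ne_zero_iff.mp hP
  refine le_trans ?_ (norm_coeff_le_l1 P s)
  rw [Int.norm_eq_abs]
  exact_mod_cast Int.one_le_abs hs

/-- Factorization of the Wronskian-like determinant. -/
lemma det_factor {n K : ℕ} (φ : Fin K → MvPolynomial (Fin n) ℚ) (ψ : Fin K → MvPolynomial (Fin 1) ℚ)
    (t : Fin K → (Fin n →₀ ℕ)) (u : Fin K → (Fin 1 →₀ ℕ)) :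
    (Matrix.of fun i j => hasse (Finsupp.cons (u j 0) (t i)) (∑ l, emb (φ l) (ψ l))).det =
      emb (Matrix.of fun i l => hasse (t i) (φ l)).det (Matrix.of fun j l => hasse (u j) (ψ l)).det := by
  set A := (rename Fin.succ : MvPolynomial (Fin n) ℚ →ₐ[ℚ] MvPolynomial (Fin (n+1)) ℚ).mapMatrix
    (Matrix.of fun i l => hasse (t i) (φ l)) with hA
  set B := (rename (fun _ : Fin 1 => (0 : Fin (n+1))) : MvPolynomial (Fin 1) ℚ →ₐ[ℚ] MvPolynomial (Fin (n+1)) ℚ).mapMatrix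
    (Matrix.of fun j l => hasse (u j) (ψ l)) with hB
  rw [emb, AlgHom.map_det, AlgHom.map_det, ← hA, ← hB, ← Matrix.det_transpose B, ← Matrix.det_mul]
  congr 1
  ext1 i j
  rw [Matrix.mul_apply, Matrix.of_apply, map_sum]
  refine Finset.sum_congr rfl fun l _ => ?_
  rw [hasse_emb]
  rfl

lemma wt_cons {n : ℕ} (r : Fin (n+1) → ℕ) (b : ℕ) (a : Fin n →₀ ℕ) :
    wt r (Finsupp.cons b a) = b / r 0 + wt (fun i => r i.succ) a := by
  simp [wt, Fin.sum_univ_succ]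

theorem roth_lemma (n : ℕ) : ∀ ε : ℝ, 0 < ε → ε ≤ 1 → ∃ ω : ℝ, 0 < ω ∧
    ∀ (r : Fin n → ℕ) (p q : Fin n → ℤ) (R : ℝ) (P : MvPolynomial (Fin n) ℤ), 0 < R → (∀ h, 0 < r h) →
    (∀ i j, i < j → (r i : ℝ) ≤ ω * r j) → (∀ h, 0 < q h) → (∀ h, IsCoprime (p h) (q h)) →
    (∀ h, R ≤ r h * Real.log (q h)) → (∑ h, (r h : ℝ)) ≤ ω * R → P ≠ 0 →
    (∀ s ∈ P.support, ∀ h, s h ≤ r h) → Real.log (l1 P) ≤ ω * R →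
    ∃ J, wt r J ≤ ε ∧ coeff J (shift (fun h => (p h / q h : ℚ)) (map (Int.castRingHom ℚ) P)) ≠ 0 := by
  induction n with
  | zero =>
    intro ε hε _
    refine ⟨1, one_pos, ?_⟩
    intro r p q R P _ _ _ _ _ _ _ hP _ _
    refine ⟨0, by simp [wt, hε.le], ?_⟩
    obtain ⟨c, rfl⟩ := MvPolynomial.C_surjective (Fin 0) P
    have hcc : coeff 0 (shift (fun h => (p h / q h : ℚ)) (map (Int.castRingHom ℚ) (C c : MvPolynomial (Fin 0) ℤ))) = (c : ℚ) := by
      rw [map_C, shift, aeval_C, MvPolynomial.algebraMap_eq, coeff_C, if_pos rfl]; rfl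
    rw [hcc]
    intro h
    apply hP
    have : c = 0 := by simpa using h
    rw [this, map_zero]
  | succ n ih =>
    intro ε hε hε1
    obtain ⟨ω', hω', hIH⟩ := ih (ε ^ 2 / 200) (by positivity) (by nlinarith)
    set ε1 := ε ^ 2 / 200 with hε1d
    have hε1pos : 0 < ε1 := by positivity
    obtain ⟨ω, hω, hωa, hωb, hωc⟩ : ∃ ω : ℝ, 0 < ω ∧ ω ≤ ω' / 4 ∧ ω ≤ ε / 4 ∧ ω ≤ ε1 / 4 :=
      ⟨min (ω' / 4) (min (ε / 4) (ε1 / 4)), by positivity, min_le_left _ _,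
        (min_le_right _ _).trans (min_le_left _ _), (min_le_right _ _).trans (min_le_right _ _)⟩
    refine ⟨ω, hω, ?_⟩
    intro r p q R P hR hr hrr hq hpq hRq hsum hP hdeg hlog
    by_contra hcon
    push Not at hcon
    set α : Fin (n+1) → ℚ := fun h => (p h / q h : ℚ) with hα
    set Pq := map (Int.castRingHom ℚ) P with hPq
    have hInd : IndGE r α ε Pq := fun J hJ => hcon J hJ.le
    have hPq0 : Pq ≠ 0 := by
      intro h; apply hP; apply map_cast_injective; rw [← hPq, h, map_zero]
    have hsuppq : ∀ s ∈ Pq.support, ∀ h, s h ≤ r h := fun s hs h => hdeg s (support_map_subset _ _ hs) h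
    obtain ⟨K, hKr, φ, ψ, hdec, hφ, hψ⟩ := exists_decomp Pq (r 0) (fun s hs => hsuppq s hs 0)
    have hK : 1 ≤ K := by
      rcases Nat.eq_zero_or_pos K with h | h
      · subst h; exact absurd (by simpa using hdec) hPq0
      · exact h
    obtain ⟨t, ht, htdet⟩ := exists_wronskian φ hφ
    obtain ⟨u, hu, hudet⟩ := exists_wronskian ψ hψ
    set U := (Matrix.of fun i l => hasse (t i) (φ l)).det with hU
    set V := (Matrix.of fun j l => hasse (u j) (ψ l)).det with hV
    set MZ : Matrix (Fin K) (Fin K) (MvPolynomial (Fin (n+1)) ℤ) :=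
      Matrix.of fun i j => hasse (Finsupp.cons (u j 0) (t i)) P with hMZ
    set W := MZ.det with hW
    have hWq : map (Int.castRingHom ℚ) W = (Matrix.of fun i j => hasse (Finsupp.cons (u j 0) (t i)) Pq).det := by
      rw [hW, RingHom.map_det]
      congr 1
      ext1 i j
      simp only [RingHom.mapMatrix_apply, Matrix.map_apply, hMZ, Matrix.of_apply, hasse_map, hPq]
    have hWe : map (Int.castRingHom ℚ) W = emb U V := by
      rw [hWq, hdec, det_factor]
    -- height of W
    have hl1P := one_le_l1 P hP
    have hK0 : (0 : ℝ) < K := by exact_mod_cast hK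
    have hr0 : (0 : ℝ) < r 0 := by exact_mod_cast hr 0
    have hheight : Real.log (l1 W) ≤ 4 * K * ω * R := by
      have h1 : l1 W ≤ K.factorial * (2 ^ (∑ i, r i) * l1 P) ^ K :=
        l1_det _ _ fun i j => l1_hasse P r hdeg _
      have h2 : (K.factorial : ℝ) ≤ (K : ℝ) ^ K := by exact_mod_cast Nat.factorial_le_pow K
      have h3 : l1 W ≤ (K * (2 ^ (∑ i, r i) * l1 P)) ^ K := by
        rw [mul_pow]; exact h1.trans (mul_le_mul_of_nonneg_right h2 (by positivity))
      rcases (l1_nonneg W).eq_or_lt with h0 | h0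
      · rw [← h0, Real.log_zero]; positivity
      · have h4 := Real.log_le_log h0 h3
        rw [Real.log_pow, Real.log_mul hK0.ne' (by positivity), Real.log_mul (by positivity) (by positivity), Real.log_pow] at h4
        have h5 : Real.log K ≤ r 0 := by
          have := Real.log_le_sub_one_of_pos hK0
          have h6 : (K : ℝ) ≤ r 0 + 1 := by exact_mod_cast hKr
          linarith
        have h6 : (r 0 : ℝ) ≤ ∑ h, (r h : ℝ) :=
          Finset.single_le_sum (f := fun h => (r h : ℝ)) (fun _ _ => by positivity) (Finset.mem_univ 0)
        have h7 : Real.log 2 ≤ 1 := by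
          have := Real.log_le_sub_one_of_pos (x := 2) (by norm_num); linarith
        have h8 : ((∑ i, r i : ℕ) : ℝ) * Real.log 2 ≤ ω * R := by
          push_cast
          refine le_trans ?_ hsum
          have : (0 : ℝ) ≤ ∑ h, (r h : ℝ) := by positivity
          nlinarith
        have h9 : 0 < ω * R := by positivity
        refine h4.trans ?_
        have : Real.log K + (((∑ i, r i : ℕ) : ℝ) * Real.log 2 + Real.log (l1 P)) ≤ 4 * (ω * R) := by linarith
        nlinarith
    obtain ⟨a0, ha0⟩ := MvPolynomial.ne_zero_iff.mp htdet
    obtain ⟨b0, hb0⟩ := MvPolynomial.ne_zero_iff.mp hudet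
    -- the slices
    set U' := slice (fun a => Finsupp.cons (b0 0) a) (cons_injective_right _) W with hU'
    set V' := slice (fun b : Fin 1 →₀ ℕ => (Finsupp.cons (b 0) a0 : Fin (n+1) →₀ ℕ)) (cons_injective_left a0) W with hV'
    have hcW : ∀ a (b : Fin 1 →₀ ℕ), ((coeff (Finsupp.cons (b 0) a) W : ℤ) : ℚ) = coeff a U * coeff b V := by
      intro a b
      rw [← coeff_emb, ← hWe, coeff_map]; rfl
    have hUq : map (Int.castRingHom ℚ) U' = coeff b0 V • U := by
      ext a
      rw [coeff_map, coeff_slice, coeff_smul, smul_eq_mul, mul_comm]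
      exact hcW a b0
    have hVq : map (Int.castRingHom ℚ) V' = coeff a0 U • V := by
      ext b
      rw [coeff_map, coeff_slice, coeff_smul, smul_eq_mul]
      exact hcW a0 b
    have hU'0 : U' ≠ 0 := by
      intro h
      rw [h, map_zero] at hUq
      have := congrArg (coeff a0) hUq
      rw [coeff_smul, coeff_zero, smul_eq_mul] at this
      exact mul_ne_zero hb0 ha0 this.symm
    have hV'0 : V' ≠ 0 := by
      intro h
      rw [h, map_zero] at hVq
      have := congrArg (coeff b0) hVq
      rw [coeff_smul, coeff_zero, smul_eq_mul] at this
      exact mul_ne_zero ha0 hb0 this.symm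
    have hlU : Real.log (l1 U') ≤ 4 * K * ω * R :=
      (Real.log_le_log (by linarith [one_le_l1 U' hU'0]) (l1_slice _ _ _)).trans hheight
    have hlV : Real.log (l1 V') ≤ 4 * K * ω * R :=
      (Real.log_le_log (by linarith [one_le_l1 V' hV'0]) (l1_slice _ _ _)).trans hheight
    obtain ⟨J, hJ, hJ0⟩ := hIH (fun i => K * r i.succ) (fun i => p i.succ) (fun i => q i.succ) (K * R) U'
      (by positivity) (fun h => Nat.mul_pos hK (hr _))
      (by
        intro i j hij
        have := hrr i.succ j.succ (Fin.succ_lt_succ_iff.mpr hij)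
        push_cast
        have h2 : (0 : ℝ) ≤ r j.succ := by positivity
        have h3 : ω * r j.succ ≤ ω' * r j.succ := mul_le_mul_of_nonneg_right (by linarith) h2
        nlinarith)
      (fun h => hq _) (fun h => hpq _)
      (by
        intro h
        have := hRq h.succ
        push_cast
        nlinarith)
      (by
        push_cast
        rw [← Finset.mul_sum]
        rw [Fin.sum_univ_succ] at hsum
        have : ω * R ≤ ω' * R := mul_le_mul_of_nonneg_right (by linarith) hR.le
        nlinarith)
      hU'0
      (by
        intro s hs h
        rw [mem_support_iff, coeff_slice] at hs
        have h1 : degreeOf h.succ W ≤ K * r h.succ :=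
          degreeOf_det _ _ _ fun i j => degreeOf_hasse _ _ _ _ fun s hs => hdeg s hs _
        have := (degreeOf_le_iff.mp h1) _ (mem_support_iff.mpr hs)
        simpa using this)
      (by
        have : ω * R ≤ ω' / 4 * R := mul_le_mul_of_nonneg_right hωa hR.le
        nlinarith)
    obtain ⟨b, hb, hbl⟩ := gauss V' hV'0 (p 0) (q 0) (hq 0) (hpq 0)
    rw [hUq, map_smul, coeff_smul, smul_eq_mul] at hJ0
    rw [hVq, map_smul, coeff_smul, smul_eq_mul] at hb
    have hlogq : 0 < Real.log (q 0) := by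
      by_contra h
      push Not at h
      have := hRq 0
      nlinarith
    have hq0 : (0 : ℝ) < q 0 := by exact_mod_cast hq 0
    have hbr : (b 0 : ℝ) / r 0 ≤ K * ε1 := by
      have h1 := Real.log_le_log (by positivity) hbl
      rw [Real.log_pow] at h1
      have h2 := hRq 0
      have h3 : (b 0 : ℝ) * Real.log (q 0) ≤ (4 * K * ω * r 0) * Real.log (q 0) := by
        have : (4 * K * ω) * R ≤ (4 * K * ω) * (r 0 * Real.log (q 0)) := mul_le_mul_of_nonneg_left h2 (by positivity)
        linarith
      have h4 := le_of_mul_le_mul_right h3 hlogq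
      rw [div_le_iff₀ hr0]
      have : (4 * ω) * (K * r 0) ≤ ε1 * (K * r 0) := mul_le_mul_of_nonneg_right (by linarith) (by positivity)
      linarith
    have hwJ : wt (fun i => r i.succ) J ≤ K * ε1 := by
      have : wt (fun i => K * r (Fin.succ i)) J = wt (fun i => r i.succ) J / K := by
        simp only [wt, Finset.sum_div]
        refine Finset.sum_congr rfl fun i _ => ?_
        push_cast
        rw [div_div, mul_comm]
      rw [this, div_le_iff₀ hK0] at hJ
      linarith
    have hnz : coeff (Finsupp.cons (b 0) J) (shift α (map (Int.castRingHom ℚ) W)) ≠ 0 := by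
      rw [hWe, shift_emb, coeff_emb]
      exact mul_ne_zero (right_ne_zero_of_mul hJ0) (right_ne_zero_of_mul hb)
    -- lower bound on the index
    have hIndW : IndGE r α (∑ j : Fin K, max 0 ((ε - ω) - (j : ℕ) / r 0)) (map (Int.castRingHom ℚ) W) := by
      rw [hWq]
      apply IndGE.det
      intro i j
      apply IndGE.max
      rw [Matrix.of_apply]
      refine (hInd.hasse (Finsupp.cons (u j 0) (t i))).mono ?_
      rw [wt_cons]
      have h1 : (u j 0 : ℝ) / r 0 ≤ (j : ℕ) / r 0 := by
        apply div_le_div_of_nonneg_right _ hr0.le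
        have := hu j
        simp only [Finset.univ_unique, Fin.default_eq_zero, Finset.sum_singleton] at this
        exact_mod_cast this
      have h2 : wt (fun i => r (Fin.succ i)) (t i) ≤ ω := by
        have h3 : ∀ l : Fin n, (t i l : ℝ) / r l.succ ≤ t i l * (ω / r 0) := by
          intro l
          rw [div_eq_mul_inv]
          apply mul_le_mul_of_nonneg_left _ (by positivity)
          have h4 := hrr 0 l.succ (Fin.succ_pos l)
          have h5 : (0 : ℝ) < r l.succ := by exact_mod_cast hr _
          rw [inv_le_iff_one_le_mul₀ h5, div_mul_eq_mul_div, le_div_iff₀ hr0]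
          linarith
        refine (Finset.sum_le_sum fun l _ => h3 l).trans ?_
        rw [← Finset.sum_mul]
        have h4 : ((∑ l, t i l : ℕ) : ℝ) ≤ r 0 := by
          have := ht i
          have h5 := i.2
          exact_mod_cast (by omega : ∑ l, t i l ≤ r 0)
        push_cast at h4
        calc _ ≤ (r 0 : ℝ) * (ω / r 0) := mul_le_mul_of_nonneg_right h4 (by positivity)
          _ = ω := by field_simp
      linarith
    apply hnz
    apply hIndW
    rw [wt_cons]
    have hlow := sum_lower K (r 0) hK hKr (hr 0) (ε - ω) (by linarith) (by linarith)
    have : (3 / 4 * ε) ^ 2 ≤ (ε - ω) ^ 2 := by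
      apply pow_le_pow_left₀ (by positivity); linarith
    have h2 : K * ε1 + K * ε1 < K * (ε - ω) ^ 2 / 8 := by
      have h3 : ε1 + ε1 < (ε - ω) ^ 2 / 8 := by
        rw [hε1d]; nlinarith
      have := mul_lt_mul_of_pos_left h3 hK0
      linarith
    linarith

end AB

namespace AB
open Filter Topology

lemma cfConv_succ (a : ℕ → ℕ) (n : ℕ) : cfConv a (n+1) = 1 / (a 0 + cfConv (fun i => a (i+1)) n) := by
  have h : ∀ (b : ℕ) (l : List ℕ), cfValR (b :: l) = b + cfValR (0 :: l) := by
    intro b l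
    cases l with
    | nil => simp [cfValR]
    | cons c l => simp [cfValR]
  rw [cfConv, List.ofFn_succ, cfValR, h, cfConv]
  simp

lemma cfConv_zero (a : ℕ → ℕ) : cfConv a 0 = 0 := by simp [cfConv, cfValR]

lemma cfConv_nonneg (n : ℕ) : ∀ (a : ℕ → ℕ), 0 ≤ cfConv a n := by
  induction n with
  | zero => intro a; rw [cfConv_zero]
  | succ n ih => intro a; rw [cfConv_succ]; have := ih (fun i => a (i+1)); positivity

lemma cfConv_le_one (n : ℕ) (a : ℕ → ℕ) (ha : ∀ n, 1 ≤ a n) : cfConv a n ≤ 1 := by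
  cases n with
  | zero => rw [cfConv_zero]; norm_num
  | succ n =>
    rw [cfConv_succ]
    have h1 := cfConv_nonneg n (fun i => a (i+1))
    have h2 : (1:ℝ) ≤ a 0 := by exact_mod_cast ha 0
    rw [div_le_one (by linarith)]; linarith

lemma cf_mem {x : ℝ} (hx : Irrational x) {a : ℕ → ℕ} (ha : ∀ n, 1 ≤ a n) (h : HasCF x a) : 0 < x ∧ x < 1 := by
  have h0 : 0 ≤ x := ge_of_tendsto' h fun n => cfConv_nonneg n a
  have h1 : x ≤ 1 := le_of_tendsto' h fun n => cfConv_le_one n a ha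
  refine ⟨lt_of_le_of_ne h0 (Ne.symm ?_), lt_of_le_of_ne h1 ?_⟩
  · exact_mod_cast hx.ne_nat 0
  · exact_mod_cast hx.ne_nat 1

lemma cf_tail {x : ℝ} (hx : Irrational x) {a : ℕ → ℕ} (ha : ∀ n, 1 ≤ a n) (h : HasCF x a) :
    HasCF (1 / x - a 0) (fun i => a (i+1)) := by
  have hx0 := (cf_mem hx ha h).1
  have h1 : Tendsto (fun n => cfConv a (n+1)) atTop (𝓝 x) := (tendsto_add_atTop_iff_nat 1).mpr h
  have h2 : Tendsto (fun n => 1 / cfConv a (n+1) - a 0) atTop (𝓝 (1 / x - a 0)) :=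
    (tendsto_const_nhds.div h1 hx0.ne').sub_const _
  refine h2.congr fun n => ?_
  rw [cfConv_succ]; simp

lemma irr_tail {x : ℝ} (hx : Irrational x) (k : ℕ) : Irrational (1 / x - k) := by
  rw [one_div]; exact (irrational_inv_iff.mpr hx).sub_natCast k

/-- Complete quotients (inverted). -/
noncomputable def tl (x : ℝ) (a : ℕ → ℕ) : ℕ → ℝ
  | 0 => x
  | n+1 => 1 / tl x a n - a n

lemma tl_spec {x : ℝ} (hx : Irrational x) {a : ℕ → ℕ} (ha : ∀ n, 1 ≤ a n) (h : HasCF x a) (n : ℕ) :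
    Irrational (tl x a n) ∧ HasCF (tl x a n) (fun i => a (i + n)) := by
  induction n with
  | zero => exact ⟨hx, h⟩
  | succ n ih =>
    refine ⟨irr_tail ih.1 _, ?_⟩
    have := cf_tail ih.1 (fun i => ha _) ih.2
    simp only [zero_add] at this
    have e : (fun i => a (i + (n + 1))) = fun i => a (i + 1 + n) := by
      funext i; congr 1; omega
    rw [e]
    exact this

lemma tl_mem {x : ℝ} (hx : Irrational x) {a : ℕ → ℕ} (ha : ∀ n, 1 ≤ a n) (h : HasCF x a) (n : ℕ) :
    0 < tl x a n ∧ tl x a n < 1 :=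
  cf_mem (tl_spec hx ha h n).1 (fun i => ha _) (tl_spec hx ha h n).2

lemma cf_head {x : ℝ} (hx : Irrational x) {a : ℕ → ℕ} (ha : ∀ n, 1 ≤ a n) (h : HasCF x a) : (a 0 : ℤ) = ⌊1 / x⌋ := by
  have := tl_mem hx ha h 1
  simp only [tl] at this
  symm
  rw [Int.floor_eq_iff]
  push_cast
  constructor <;> linarith

lemma cf_unique (n : ℕ) : ∀ {x : ℝ} (_ : Irrational x) {a b : ℕ → ℕ} (_ : ∀ n, 1 ≤ a n) (_ : HasCF x a)
    (_ : ∀ n, 1 ≤ b n) (_ : HasCF x b), a n = b n := by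
  have h0 : ∀ {x : ℝ} (_ : Irrational x) {a b : ℕ → ℕ} (_ : ∀ n, 1 ≤ a n) (_ : HasCF x a)
    (_ : ∀ n, 1 ≤ b n) (_ : HasCF x b), a 0 = b 0 := by
    intro x hx a b ha h hb h'
    have := (cf_head hx ha h).trans (cf_head hx hb h').symm
    exact_mod_cast this
  induction n with
  | zero => exact h0
  | succ n ih =>
    intro x hx a b ha h hb h'
    have e := h0 hx ha h hb h'
    have h2 := cf_tail hx hb h'
    rw [← e] at h2
    exact ih (irr_tail hx (a 0)) (a := fun i => a (i+1)) (b := fun i => b (i+1)) (fun i => ha _) (cf_tail hx ha h) (fun i => hb _) h2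

/-- Product matrix of partial quotients. -/
def cm (a : ℕ → ℕ) : ℕ → Matrix (Fin 2) (Fin 2) ℤ
  | 0 => 1
  | n+1 => cm a n * !![(a n : ℤ), 1; 1, 0]

lemma cm_left (a : ℕ → ℕ) (n : ℕ) : cm a (n+1) = !![(a 0 : ℤ), 1; 1, 0] * cm (fun i => a (i+1)) n := by
  induction n with
  | zero => simp [cm]
  | succ n ih => rw [cm, ih, cm, Matrix.mul_assoc]

lemma cm_transpose (m : ℕ) : ∀ (a b : ℕ → ℕ), (∀ i, i < m → b i = a (m - 1 - i)) → (cm a m).transpose = cm b m := by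
  induction m with
  | zero => intros; simp [cm]
  | succ m ih =>
    intro a b h
    rw [cm_left b, cm, Matrix.transpose_mul]
    have h0 := h 0 (by omega)
    rw [ih a (fun i => b (i+1)), h0]
    · simp only [Nat.add_sub_cancel, Nat.sub_zero]
      congr 1
      ext i j; fin_cases i <;> fin_cases j <;> rfl
    · intro i hi
      rw [h (i+1) (by omega)]
      congr 1; omega

lemma cm_det (a : ℕ → ℕ) (n : ℕ) : (cm a n).det = (-1)^n := by
  induction n with
  | zero => simp [cm]
  | succ n ih => rw [cm, Matrix.det_mul, ih, pow_succ]; simp [Matrix.det_fin_two]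

lemma cm_det' (a : ℕ → ℕ) (n : ℕ) : cm a n 0 0 * cm a n 1 1 - cm a n 0 1 * cm a n 1 0 = (-1)^n := by
  rw [← cm_det, Matrix.det_fin_two]

lemma cm_succ (a : ℕ → ℕ) (n : ℕ) (i : Fin 2) : cm a (n+1) i 0 = a n * cm a n i 0 + cm a n i 1 ∧ cm a (n+1) i 1 = cm a n i 0 := by
  constructor <;> simp [cm, Matrix.mul_apply, Fin.sum_univ_two] <;> ring

lemma cm_pos (a : ℕ → ℕ) (ha : ∀ n, 1 ≤ a n) (n : ℕ) :
    (n : ℤ) ≤ cm a n 0 0 ∧ 1 ≤ cm a n 0 0 ∧ 0 ≤ cm a n 0 1 ∧ (1 ≤ n → 1 ≤ cm a n 0 1) ∧ cm a n 0 1 ≤ cm a n 0 0 := by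
  induction n with
  | zero => simp [cm]
  | succ n ih =>
    obtain ⟨h1, h2, h3, h4, h5⟩ := ih
    rw [(cm_succ a n 0).1, (cm_succ a n 0).2]
    have h6 : (1:ℤ) ≤ a n := by exact_mod_cast ha n
    have h7 : cm a n 0 0 ≤ a n * cm a n 0 0 := by nlinarith
    refine ⟨?_, by linarith, by linarith, fun _ => by linarith, by linarith⟩
    rcases Nat.eq_zero_or_pos n with h | h
    · subst h; push_cast; linarith
    · have := h4 h; push_cast; linarith

lemma cm_tl {x : ℝ} (hx : Irrational x) {a : ℕ → ℕ} (ha : ∀ n, 1 ≤ a n) (h : HasCF x a) (n : ℕ) :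
    ∃ l : ℝ, 0 < l ∧ 1 = l * (cm a n 0 0 + cm a n 0 1 * tl x a n) ∧ x = l * (cm a n 1 0 + cm a n 1 1 * tl x a n) := by
  induction n with
  | zero => exact ⟨1, one_pos, by simp [cm], by simp [cm, tl]⟩
  | succ n ih =>
    obtain ⟨l, hl, h1, h2⟩ := ih
    have h3 := (tl_mem hx ha h n).1
    refine ⟨l * tl x a n, by positivity, ?_, ?_⟩
    · rw [(cm_succ a n 0).1, (cm_succ a n 0).2, tl]
      push_cast
      refine h1.trans ?_
      field_simp; ring
    · rw [(cm_succ a n 1).1, (cm_succ a n 1).2, tl]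
      push_cast
      refine h2.trans ?_
      field_simp; ring

lemma cm_approx {x : ℝ} (hx : Irrational x) {a : ℕ → ℕ} (ha : ∀ n, 1 ≤ a n) (h : HasCF x a) (n : ℕ) :
    |(cm a n 0 0 : ℝ) * x - cm a n 1 0| ≤ 1 / cm a n 0 0 ∧ |(cm a n 0 1 : ℝ) * x - cm a n 1 1| ≤ 1 / cm a n 0 0 := by
  obtain ⟨l, hl, h1, h2⟩ := cm_tl hx ha h n
  obtain ⟨_, p1, p2, _, _⟩ := cm_pos a ha n
  have hQ : (1:ℝ) ≤ cm a n 0 0 := by exact_mod_cast p1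
  have hQ' : (0:ℝ) ≤ cm a n 0 1 := by exact_mod_cast p2
  obtain ⟨t0, t1⟩ := tl_mem hx ha h n
  have hd : (cm a n 0 0 : ℝ) * cm a n 1 1 - cm a n 0 1 * cm a n 1 0 = (-1)^n := by exact_mod_cast cm_det' a n
  have hl1 : l ≤ 1 / cm a n 0 0 := by
    rw [le_div_iff₀ (by linarith)]
    have : 0 ≤ l * (cm a n 0 1 * tl x a n) := by positivity
    linarith
  have e1 : (cm a n 0 0 : ℝ) * x - cm a n 1 0 = l * tl x a n * (-1)^n := by
    rw [← hd]
    linear_combination (cm a n 0 0 : ℝ) * h2 - (cm a n 1 0 : ℝ) * h1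
  have e2 : (cm a n 0 1 : ℝ) * x - cm a n 1 1 = - (l * (-1)^n) := by
    rw [← hd]
    linear_combination (cm a n 0 1 : ℝ) * h2 - (cm a n 1 1 : ℝ) * h1
  rw [e1, e2]
  simp only [abs_neg, abs_mul, abs_pow, abs_one, one_pow, mul_one]
  rw [abs_of_pos hl, abs_of_pos t0]
  exact ⟨by nlinarith, hl1⟩

/-- Simultaneous approximations from palindromes. -/
lemma pal_approx {x : ℝ} (hx : Irrational x) {a : ℕ → ℕ} (ha : ∀ n, 1 ≤ a n) (h : HasCF x a)
    (hpal : ∀ N : ℕ, ∃ m, N ≤ m ∧ PalindromicPrefix a m) (N : ℕ) :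
    ∃ q p r : ℤ, (N : ℤ) ≤ q ∧ 0 < q ∧ IsCoprime p q ∧ |(q : ℝ) * x - p| ≤ 1 / q ∧ |(q : ℝ) * x^2 - r| ≤ 2 / q := by
  obtain ⟨m, hm, hp⟩ := hpal N
  obtain ⟨p0, p1, p2, _, _⟩ := cm_pos a ha m
  obtain ⟨b1, b2⟩ := cm_approx hx ha h m
  have hsym : cm a m 0 1 = cm a m 1 0 := by
    have := cm_transpose m a a hp
    have := congrFun (congrFun this 1) 0
    simpa [Matrix.transpose_apply] using this
  have hd := cm_det' a m
  refine ⟨cm a m 0 0, cm a m 1 0, cm a m 1 1, le_trans (by exact_mod_cast hm) p0, by linarith, ?_, b1, ?_⟩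
  · rw [hsym] at hd
    refine ⟨- (-1)^m * cm a m 1 0, (-1)^m * cm a m 1 1, ?_⟩
    have : ((-1:ℤ)^m) * (-1)^m = 1 := by rw [← mul_pow]; simp
    linear_combination (-1)^m * hd + this
  · obtain ⟨x0, x1⟩ := cf_mem hx ha h
    rw [hsym] at b2
    have e : (cm a m 0 0 : ℝ) * x^2 - cm a m 1 1 = x * (cm a m 0 0 * x - cm a m 1 0) + (cm a m 1 0 * x - cm a m 1 1) := by ring
    rw [e]
    refine (abs_add_le _ _).trans ?_
    rw [abs_mul, abs_of_pos x0]
    have h3 : x * |(cm a m 0 0 : ℝ) * x - cm a m 1 0| ≤ 1 / cm a m 0 0 := by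
      refine le_trans ?_ b1
      have := abs_nonneg ((cm a m 0 0 : ℝ) * x - cm a m 1 0)
      nlinarith
    have : (2:ℝ) / cm a m 0 0 = 1 / cm a m 0 0 + 1 / cm a m 0 0 := by ring
    linarith
end AB

namespace AB

lemma lagrange_int {x : ℝ} (hx : Irrational x) {a : ℕ → ℕ} (ha : ∀ n, 1 ≤ a n) (h : HasCF x a)
    (A B C : ℤ) (hA : A ≠ 0) (he : (A : ℝ) * x ^ 2 + B * x + C = 0) :
    ∃ c p : ℕ, 0 < p ∧ ∀ n, c ≤ n → a (n + p) = a n := by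
  obtain ⟨x0, x1⟩ := cf_mem hx ha h
  -- bound for values of the form
  have key : ∀ (u v u' v' : ℤ) (M : ℝ), 1 ≤ M → |(u:ℝ)| ≤ M → |(u':ℝ)| ≤ M → |(u:ℝ) * x - v| ≤ 1 / M → |(u':ℝ) * x - v'| ≤ 1 / M →
      |2 * A * v * v' + B * (u * v' + u' * v) + 2 * C * u * u'| ≤ 6 * |A| + 2 * |B| := by
    intro u v u' v' M hM hu hu' hd hd'
    have hM0 : 0 < M := by linarith
    obtain ⟨d, hd1⟩ : ∃ d : ℝ, d = u * x - v := ⟨_, rfl⟩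
    obtain ⟨d', hd1'⟩ : ∃ d : ℝ, d = u' * x - v' := ⟨_, rfl⟩
    rw [← hd1] at hd
    rw [← hd1'] at hd'
    have e : (2 * A * v * v' + B * (u * v' + u' * v) + 2 * C * u * u' : ℝ) =
        - (2 * A * x + B) * (u * d') - (2 * A * x + B) * (u' * d) + 2 * A * (d * d') := by
      rw [hd1, hd1']
      linear_combination (2 * (u:ℝ) * u') * he
    have b1 : |(u:ℝ) * d'| ≤ 1 := by
      rw [abs_mul]
      calc _ ≤ M * (1 / M) := mul_le_mul hu hd' (abs_nonneg _) hM0.le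
        _ = 1 := by field_simp
    have b2 : |(u':ℝ) * d| ≤ 1 := by
      rw [abs_mul]
      calc _ ≤ M * (1 / M) := mul_le_mul hu' hd (abs_nonneg _) hM0.le
        _ = 1 := by field_simp
    have hM1 : 1 / M ≤ 1 := by rw [div_le_one hM0]; exact hM
    have b3 : |d * d'| ≤ 1 := by
      rw [abs_mul]
      exact mul_le_one₀ (hd.trans hM1) (abs_nonneg _) (hd'.trans hM1)
    have b4 : |2 * (A:ℝ) * x + B| ≤ 2 * |(A:ℝ)| + |(B:ℝ)| := by
      refine (abs_add_le _ _).trans ?_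
      rw [abs_mul, abs_mul, abs_of_pos x0, abs_two]
      have := abs_nonneg (A:ℝ)
      nlinarith
    have : |(2 * A * v * v' + B * (u * v' + u' * v) + 2 * C * u * u' : ℝ)| ≤ 6 * |(A:ℝ)| + 2 * |(B:ℝ)| := by
      rw [e]
      have c1 : |(2 * (A:ℝ) * x + B) * (u * d')| ≤ 2 * |(A:ℝ)| + |(B:ℝ)| := by
        rw [abs_mul]
        have := abs_nonneg (2 * (A:ℝ) * x + B)
        nlinarith
      have c2 : |(2 * (A:ℝ) * x + B) * (u' * d)| ≤ 2 * |(A:ℝ)| + |(B:ℝ)| := by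
        rw [abs_mul]
        have := abs_nonneg (2 * (A:ℝ) * x + B)
        nlinarith
      have c3 : |2 * (A:ℝ) * (d * d')| ≤ 2 * |(A:ℝ)| := by
        rw [abs_mul, abs_mul, abs_two]
        have := abs_nonneg (A:ℝ)
        nlinarith
      rw [abs_le] at c1 c2 c3 ⊢
      constructor <;> linarith
    exact_mod_cast this
  set N := 2 * (6 * |A| + 2 * |B|) with hN
  have hN0 : 0 ≤ 6 * |A| + 2 * |B| := by positivity
  -- the finite set of values
  set S : Set ℝ := ⋃ t ∈ ((Finset.Icc (-N) N ×ˢ Finset.Icc (-N) N ×ˢ Finset.Icc (-N) N).filter (fun t : ℤ × ℤ × ℤ => t ≠ 0) : Finset (ℤ × ℤ × ℤ)),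
    {y : ℝ | (t.1 : ℝ) * y ^ 2 + t.2.1 * y + t.2.2 = 0} with hS
  have hSfin : S.Finite := by
    apply Set.Finite.biUnion (Finset.finite_toSet _)
    intro t ht
    have ht0 : t ≠ 0 := (Finset.mem_filter.mp ht).2
    set f : Polynomial ℝ := Polynomial.C (t.1 : ℝ) * Polynomial.X ^ 2 + Polynomial.C (t.2.1 : ℝ) * Polynomial.X + Polynomial.C (t.2.2 : ℝ) with hf
    have hf0 : f ≠ 0 := by
      intro hz
      apply ht0
      have c0 := congrArg (fun g => Polynomial.coeff g 0) hz
      have c1 := congrArg (fun g => Polynomial.coeff g 1) hz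
      have c2 := congrArg (fun g => Polynomial.coeff g 2) hz
      simp only [hf, Polynomial.coeff_add, Polynomial.coeff_C_mul, Polynomial.coeff_X_pow, Polynomial.coeff_X, Polynomial.coeff_C, Polynomial.coeff_zero] at c0 c1 c2
      norm_num at c0 c1 c2
      ext <;> simp [c0, c1, c2]
    refine (f.roots.toFinset.finite_toSet).subset ?_
    intro y hy
    simp only [Finset.mem_coe, Multiset.mem_toFinset, Polynomial.mem_roots hf0, Polynomial.IsRoot.def]
    simpa [hf] using hy
  have hmem : ∀ n, tl x a n ∈ S := by
    intro n
    obtain ⟨l, hl, h1, h2⟩ := cm_tl hx ha h n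
    obtain ⟨_, p1, p2, _, p5⟩ := cm_pos a ha n
    obtain ⟨b1, b2⟩ := cm_approx hx ha h n
    have hd := cm_det' a n
    set Q := cm a n 0 0
    set Q' := cm a n 0 1
    set P := cm a n 1 0
    set P' := cm a n 1 1
    have hQ : (1:ℝ) ≤ Q := by exact_mod_cast p1
    have hQQ : |(Q:ℝ)| ≤ Q := by rw [abs_of_nonneg]; linarith
    have hQQ' : |(Q':ℝ)| ≤ Q := by rw [abs_of_nonneg]; exact_mod_cast p5; exact_mod_cast p2
    have k1 := key Q P Q P Q hQ hQQ hQQ b1 b1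
    have k2 := key Q P Q' P' Q hQ hQQ hQQ' b1 b2
    have k3 := key Q' P' Q' P' Q hQ hQQ' hQQ' b2 b2
    simp only [hS, Set.mem_iUnion]
    refine ⟨(2 * A * P' * P' + B * (Q' * P' + Q' * P') + 2 * C * Q' * Q',
      2 * (2 * A * P * P' + B * (Q * P' + Q' * P) + 2 * C * Q * Q'),
      2 * A * P * P + B * (Q * P + Q * P) + 2 * C * Q * Q), ?_, ?_⟩
    · rw [Finset.mem_filter]
      constructor
      · simp only [Finset.mem_product, Finset.mem_Icc]
        rw [abs_le] at k1 k2 k3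
        refine ⟨⟨?_, ?_⟩, ⟨?_, ?_⟩, ?_, ?_⟩ <;> linarith
      · intro hz
        rw [Prod.ext_iff, Prod.ext_iff] at hz
        obtain ⟨z1, z2, z3⟩ := hz
        simp only [Prod.fst_zero, Prod.snd_zero] at z1 z2 z3
        have hsq : ((-1:ℤ)^n) ^ 2 = 1 := by rw [← pow_mul, mul_comm, pow_mul]; simp
        rw [← hd] at hsq
        apply hA
        have : 2 * A = 0 := by
          linear_combination (-2 * A) * hsq + Q^2 * z1 - Q * Q' * z2 + Q'^2 * z3
        omega
    · simp only [Set.mem_ofPred_eq]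
      push_cast
      have hl2 : l ^ 2 * ((2 * A * P' * P' + B * (Q' * P' + Q' * P') + 2 * C * Q' * Q' : ℝ) * tl x a n ^ 2 +
          2 * (2 * A * P * P' + B * (Q * P' + Q' * P) + 2 * C * Q * Q') * tl x a n +
          (2 * A * P * P + B * (Q * P + Q * P) + 2 * C * Q * Q)) = 0 := by
        set t := tl x a n
        have e1 : l * (P + P' * t) = x := h2.symm
        have e2 : l * (Q + Q' * t) = 1 := h1.symm
        calc _ = 2 * (A * (l * (P + P' * t)) ^ 2 + B * (l * (Q + Q' * t)) * (l * (P + P' * t)) + C * (l * (Q + Q' * t)) ^ 2) := by ring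
          _ = 0 := by rw [e1, e2]; linear_combination 2 * he
      exact (mul_eq_zero.mp hl2).resolve_left (by positivity)
  have hninj : ¬ Function.Injective (tl x a) := by
    intro hinj
    exact Set.infinite_range_of_injective hinj (hSfin.subset (by rintro _ ⟨n, rfl⟩; exact hmem n))
  rw [Function.Injective] at hninj
  push Not at hninj
  obtain ⟨i, j, hij, hne⟩ := hninj
  have main : ∀ i j, i < j → tl x a i = tl x a j → ∃ c p : ℕ, 0 < p ∧ ∀ n, c ≤ n → a (n + p) = a n := by
    intro i j hlt hij
    refine ⟨i, j - i, by omega, ?_⟩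
    intro n hn
    have s1 := tl_spec hx ha h i
    have s2 := tl_spec hx ha h j
    rw [← hij] at s2
    have := cf_unique (n - i) s1.1 (fun k => ha _) s1.2 (fun k => ha _) s2.2
    rw [show n - i + i = n by omega, show n - i + j = n + (j - i) by omega] at this
    exact this.symm
  rcases lt_or_gt_of_ne hne with hlt | hlt
  · exact main i j hlt hij
  · exact main j i hlt hij.symm

lemma lagrange {x : ℝ} (hx : Irrational x) {a : ℕ → ℕ} (ha : ∀ n, 1 ≤ a n) (h : HasCF x a)
    (A B C : ℚ) (hA : A ≠ 0) (he : (A : ℝ) * x ^ 2 + B * x + C = 0) :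
    ∃ c p : ℕ, 0 < p ∧ ∀ n, c ≤ n → a (n + p) = a n := by
  apply lagrange_int hx ha h (A.num * B.den * C.den) (B.num * A.den * C.den) (C.num * A.den * B.den)
  · have := Rat.num_ne_zero.mpr hA
    have h2 := B.den_nz
    have h3 := C.den_nz
    positivity
  · have hh : ∀ q : ℚ, (q.num : ℝ) = q * q.den := by
      intro q
      have := Rat.mul_den_eq_num q
      exact_mod_cast this.symm
    push_cast
    rw [hh A, hh B, hh C]
    linear_combination ((A.den : ℝ) * B.den * C.den) * he
end AB

namespace AB

lemma box (q : ℕ) (hq : 0 < q) (c : Fin 2 → ℤ) (A : Fin 2 → ℕ) (hA : q < (A 0 + 1) * (A 1 + 1)) :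
    ∃ y : Fin 2 → ℤ, y ≠ 0 ∧ (∀ i, |y i| ≤ A i) ∧ (q : ℤ) ∣ c 0 * y 0 + c 1 * y 1 := by
  have : NeZero q := ⟨hq.ne'⟩
  have hcard : (Finset.univ : Finset (ZMod q)).card < (Finset.range (A 0 + 1) ×ˢ Finset.range (A 1 + 1)).card := by
    rw [Finset.card_univ, ZMod.card, Finset.card_product, Finset.card_range, Finset.card_range]; exact hA
  obtain ⟨s, hs, t, ht, hne, heq⟩ := Finset.exists_ne_map_eq_of_card_lt_of_maps_to hcard
    (f := fun s : ℕ × ℕ => ((c 0 * s.1 + c 1 * s.2 : ℤ) : ZMod q)) (fun _ _ => Finset.mem_coe.mpr (Finset.mem_univ _))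
  simp only [Finset.mem_product, Finset.mem_range] at hs ht
  refine ⟨![(s.1 : ℤ) - t.1, (s.2 : ℤ) - t.2], ?_, ?_, ?_⟩
  · intro h
    apply hne
    have h0 := congrFun h 0
    have h1 := congrFun h 1
    simp at h0 h1
    ext
    · omega
    · omega
  · intro i
    fin_cases i
    · simp; rw [abs_le]; constructor <;> omega
    · simp; rw [abs_le]; constructor <;> omega
  · have := (ZMod.intCast_eq_intCast_iff_dvd_sub _ _ _).mp heq
    simp only [Matrix.cons_val_zero, Matrix.cons_val_one]
    rw [← dvd_neg]
    have e : -(c 0 * ((s.1 : ℤ) - t.1) + c 1 * ((s.2 : ℤ) - t.2)) = (c 0 * t.1 + c 1 * t.2) - (c 0 * s.1 + c 1 * s.2) := by ring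
    rw [e]
    exact this

lemma lattice (q : ℕ) (hq : 0 < q) (c : Fin 2 → ℤ) : ∃ (H : ℕ) (j : Fin 2) (y y' : Fin 2 → ℤ), 1 ≤ H ∧ H ^ 2 ≤ q ∧
    (q : ℤ) ∣ c 0 * y 0 + c 1 * y 1 ∧ (q : ℤ) ∣ c 0 * y' 0 + c 1 * y' 1 ∧ y ≠ 0 ∧ |y j| ≤ H ∧ |y (j+1)| ≤ H ∧
    |y' j| ≤ H ∧ |y' (j+1)| * H ≤ q ∧ y 0 * y' 1 - y 1 * y' 0 ≠ 0 := by
  classical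
  let p : ℕ → Prop := fun H => ∃ y : Fin 2 → ℤ, y ≠ 0 ∧ (∀ i, |y i| ≤ H) ∧ (q : ℤ) ∣ c 0 * y 0 + c 1 * y 1
  have hex0 : p (Nat.sqrt q) := box q hq c (fun _ => Nat.sqrt q) (Nat.lt_succ_sqrt q)
  have hex : ∃ H, p H := ⟨_, hex0⟩
  have hmin : ∀ H, p H → Nat.find hex ≤ H := fun H h => Nat.find_min' hex h
  have hspec := Nat.find_spec hex
  set H := Nat.find hex
  clear_value H
  obtain ⟨y, hy0, hyH, hyd⟩ := hspec
  have hH1 : 1 ≤ H := by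
    by_contra hc
    have : H = 0 := by omega
    apply hy0
    funext i
    have := hyH i
    subst H
    simpa using this
  have hHq : H ^ 2 ≤ q := by
    have h1 := hmin _ hex0
    calc H ^ 2 ≤ (Nat.sqrt q) ^ 2 := Nat.pow_le_pow_left h1 2
      _ ≤ q := Nat.sqrt_le' q
  obtain ⟨j, hj⟩ : ∃ j, |y j| = H := by
    by_contra hc
    push Not at hc
    have := hmin (H - 1) ⟨y, hy0, fun i => by
      have h1 := hyH i
      have h2 := hc i
      omega, hyd⟩
    omega
  have hjne : j + 1 ≠ j := by fin_cases j <;> decide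
  have hall : ∀ i, i = j ∨ i = j + 1 := by fin_cases j <;> decide
  have hdiv : q < H * (q / H + 1) := by
    have := Nat.lt_div_mul_add (a := q) (b := H) (by omega)
    rw [mul_add, mul_comm H]; omega
  obtain ⟨y', hy'0, hy'A, hy'd⟩ := box q hq c (fun i => if i = j then H - 1 else q / H) (by
    have h1 : H - 1 + 1 = H := by omega
    fin_cases j
    · simpa [h1] using hdiv
    · simp [h1]; rw [mul_comm]; exact hdiv)
  have a1 := hy'A j
  have a2 := hy'A (j+1)
  rw [if_pos rfl] at a1
  rw [if_neg hjne] at a2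
  have a1' : |y' j| ≤ (H:ℤ) - 1 := by omega
  refine ⟨H, j, y, y', hH1, hHq, hyd, hy'd, hy0, hyH j, hyH _, by omega, ?_, ?_⟩
  · have : ((q / H : ℕ) : ℤ) * H ≤ q := by exact_mod_cast Nat.div_mul_le_self q H
    have hH0 : (0:ℤ) ≤ H := by positivity
    nlinarith
  · intro hdet
    have hprod : y j * y' (j+1) = y (j+1) * y' j := by
      fin_cases j
      · simp; linarith
      · simp; linarith
    have hp2 := congrArg abs hprod
    rw [abs_mul, abs_mul, hj] at hp2
    have b1 := hyH (j+1)
    have hHpos : (1:ℤ) ≤ H := by exact_mod_cast hH1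
    have b2 : |y' (j+1)| ≤ (H:ℤ) - 1 := by
      have n1 := abs_nonneg (y' j)
      have : (H:ℤ) * |y' (j+1)| ≤ H * (H - 1) := by
        rw [hp2]; nlinarith
      exact le_of_mul_le_mul_left this (by linarith)
    have := hmin (H-1) ⟨y', hy'0, fun i => by
      rcases hall i with h | h
      · rw [h]; omega
      · rw [h]; omega, hy'd⟩
    omega
end AB

namespace AB

lemma alg_setup (x : ℝ) (hx : IsAlgebraic ℚ x) : ∃ d : ℕ, 0 < d ∧ ∃ (D : ℤ) (f : Fin d → ℤ), 0 < D ∧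
    (D : ℝ) * x ^ d = ∑ i, (f i : ℝ) * x ^ (i : ℕ) ∧
    ∀ g : Fin d → ℚ, ∑ i, (g i : ℝ) * x ^ (i : ℕ) = 0 → g = 0 := by
  have hxint := hx.isIntegral
  set P := minpoly ℚ x with hP
  refine ⟨P.natDegree, minpoly.natDegree_pos hxint, ?_⟩
  set D : ℕ := ∏ i ∈ Finset.range P.natDegree, (P.coeff i).den with hD
  have hD0 : 0 < D := Finset.prod_pos fun i _ => (P.coeff i).den_pos
  have hex : ∀ i : Fin P.natDegree, ∃ z : ℤ, (z : ℚ) = - (D * P.coeff i) := by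
    intro i
    obtain ⟨k, hk⟩ : (P.coeff i).den ∣ D := Finset.dvd_prod_of_mem (fun i => (P.coeff i).den) (Finset.mem_range.mpr i.2)
    refine ⟨- (k * (P.coeff i).num), ?_⟩
    have := Rat.mul_den_eq_num (P.coeff i)
    rw [hk]
    push_cast
    rw [← this]; ring
  choose f hf using hex
  refine ⟨(D : ℤ), f, by exact_mod_cast hD0, ?_, ?_⟩
  · have h0 : Polynomial.aeval x P = 0 := minpoly.aeval ℚ x
    rw [Polynomial.aeval_eq_sum_range, Finset.sum_range_succ] at h0
    have hm : P.coeff P.natDegree = 1 := (minpoly.monic hxint).coeff_natDegree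
    rw [hm, one_smul] at h0
    have h1 : x ^ P.natDegree = - ∑ i ∈ Finset.range P.natDegree, P.coeff i • x ^ i := by linarith
    rw [h1, ← Fin.sum_univ_eq_sum_range (fun i => P.coeff i • x ^ i), mul_neg, Finset.mul_sum, ← Finset.sum_neg_distrib]
    refine Finset.sum_congr rfl fun i _ => ?_
    have : (f i : ℝ) = - (D * (P.coeff i : ℝ)) := by exact_mod_cast congrArg (fun q : ℚ => (q : ℝ)) (hf i)
    rw [this, Algebra.smul_def]
    simp; ring
  · intro g hg
    have := linearIndependent_pow (K := ℚ) x
    rw [Fintype.linearIndependent_iff] at this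
    funext i
    refine this g ?_ i
    rw [← hg]
    refine Finset.sum_congr rfl fun i _ => ?_
    rw [Algebra.smul_def]; rfl

lemma pow_red {x : ℝ} {d : ℕ} (hd : 0 < d) {D : ℤ} {f : Fin d → ℤ} (hD : 0 < D)
    (h : (D : ℝ) * x ^ d = ∑ i, (f i : ℝ) * x ^ (i : ℕ)) :
    ∃ W : ℝ, 1 ≤ W ∧ (D : ℝ) ≤ W ∧ ∀ e : ℕ, ∃ v : Fin d → ℤ, (D : ℝ) ^ e * x ^ e = ∑ i, (v i : ℝ) * x ^ (i : ℕ) ∧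
      ∀ i, |(v i : ℝ)| ≤ W ^ e := by
  obtain ⟨k, rfl⟩ : ∃ k, d = k + 1 := ⟨d - 1, by omega⟩
  have hD1 : (1 : ℝ) ≤ D := by exact_mod_cast hD
  have hs : (0:ℝ) ≤ ∑ i, |(f i : ℝ)| := by positivity
  refine ⟨D + ∑ i, |(f i : ℝ)|, by linarith, by linarith, ?_⟩
  set W := D + ∑ i, |(f i : ℝ)|
  have hW : 0 ≤ W := by positivity
  intro e
  induction e with
  | zero =>
    refine ⟨fun i => if i = 0 then 1 else 0, ?_, ?_⟩
    · simp
    · intro i; by_cases hi : i = 0 <;> simp [hi]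
  | succ e ih =>
    obtain ⟨v, hv, hb⟩ := ih
    refine ⟨fun i => Fin.cases 0 (fun l => D * v l.castSucc) i + v (Fin.last k) * f i, ?_, ?_⟩
    · have e1 : (D : ℝ) ^ (e+1) * x ^ (e+1) = D * x * (D ^ e * x ^ e) := by ring
      rw [e1, hv, Fin.sum_univ_castSucc]
      have e2 : ∀ i : Fin (k+1), ((Fin.cases 0 (fun l => D * v l.castSucc) i + v (Fin.last k) * f i : ℤ) : ℝ) * x ^ (i : ℕ)
          = ((Fin.cases 0 (fun l => D * v l.castSucc) i : ℤ) : ℝ) * x ^ (i : ℕ) + v (Fin.last k) * (f i * x ^ (i : ℕ)) := by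
        intro i; push_cast; ring
      rw [Finset.sum_congr rfl fun i _ => e2 i, Finset.sum_add_distrib, ← Finset.mul_sum, ← h, Fin.sum_univ_succ]
      simp only [Fin.cases_zero, Fin.cases_succ, Fin.val_succ, Fin.val_last, Fin.val_castSucc]
      rw [mul_add, Finset.mul_sum]
      push_cast
      have : ∑ i : Fin k, (D:ℝ) * x * (v i.castSucc * x ^ (i:ℕ)) = ∑ i : Fin k, (D:ℝ) * v i.castSucc * x ^ ((i:ℕ)+1) :=
        Finset.sum_congr rfl fun i _ => by ring
      rw [this]; ring
    · intro i
      push_cast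
      have hl := hb (Fin.last k)
      have hfi : |(f i : ℝ)| ≤ ∑ i, |(f i : ℝ)| :=
        Finset.single_le_sum (f := fun i => |(f i : ℝ)|) (fun _ _ => abs_nonneg _) (Finset.mem_univ i)
      have hWe : 0 ≤ W ^ e := by positivity
      have t1 : |(v (Fin.last k) : ℝ) * f i| ≤ W ^ e * ∑ i, |(f i : ℝ)| := by
        rw [abs_mul]; exact mul_le_mul hl hfi (abs_nonneg _) hWe
      have t2 : |((Fin.cases 0 (fun l => D * v l.castSucc) i : ℤ) : ℝ)| ≤ W ^ e * D := by
        refine Fin.cases ?_ (fun l => ?_) i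
        · simp only [Fin.cases_zero, Int.cast_zero, abs_zero]; positivity
        · simp only [Fin.cases_succ]
          push_cast
          rw [abs_mul, abs_of_pos (by linarith : (0:ℝ) < D), mul_comm]
          exact mul_le_mul_of_nonneg_right (hb _) (by linarith)
      refine (abs_add_le _ _).trans ?_
      have : W ^ (e+1) = W ^ e * D + W ^ e * ∑ i, |(f i : ℝ)| := by rw [pow_succ, ← mul_add]
      linarith

lemma liouville (x : ℝ) (hx : IsAlgebraic ℚ x) : ∃ (d : ℕ) (c : ℝ), 0 < c ∧ ∀ (y : Fin 3 → ℤ) (H : ℝ), 1 ≤ H →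
    (∀ i, |(y i : ℝ)| ≤ H) → ∑ k, (y k : ℝ) * x ^ (k : ℕ) ≠ 0 → c ≤ |∑ k, (y k : ℝ) * x ^ (k : ℕ)| * H ^ d := by
  obtain ⟨d, hd, D, f, hD, hf, hind⟩ := alg_setup x hx
  obtain ⟨W, hW1, hDW, hred⟩ := pow_red hd hD hf
  choose v hv hvb using hred
  have hD1 : (1:ℝ) ≤ D := by exact_mod_cast hD
  -- constants
  set B : ℝ := 3 * (W ^ (d+1)) with hB
  have hB1 : 1 ≤ B := by
    have : 1 ≤ W ^ (d+1) := one_le_pow₀ hW1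
    linarith
  have hxs : (0:ℝ) ≤ ∑ j : Fin d, |x| ^ (j:ℕ) := by positivity
  have hx1 : (1:ℝ) ≤ ∑ j : Fin d, |x| ^ (j:ℕ) := by
    have := Finset.single_le_sum (f := fun j : Fin d => |x| ^ (j:ℕ)) (fun _ _ => by positivity) (Finset.mem_univ ⟨0, hd⟩)
    simpa using this
  set Z : ℝ := (D:ℝ) ^ (d+1) * (d.factorial * B ^ d * ∑ j : Fin d, |x| ^ (j:ℕ)) with hZ
  have hZ0 : 0 < Z := by positivity
  refine ⟨d, 1 / Z, by positivity, ?_⟩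
  intro y H hH hy hne
  set S := ∑ k, (y k : ℝ) * x ^ (k : ℕ) with hS
  set M : Matrix (Fin d) (Fin d) ℤ := Matrix.of fun i j => ∑ k : Fin 3, y k * D ^ (d + 1 - (i + k)) * v (i + k) j with hM
  have hMx : ∀ i : Fin d, ∑ j, (M i j : ℝ) * x ^ (j:ℕ) = (D:ℝ) ^ (d+1) * S * x ^ (i:ℕ) := by
    intro i
    simp only [hM, Matrix.of_apply]
    push_cast
    simp only [Finset.sum_mul]
    rw [Finset.sum_comm, hS, Finset.mul_sum, Finset.sum_mul]
    refine Finset.sum_congr rfl fun k _ => ?_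
    have h1 : ∑ j, (y k : ℝ) * D ^ (d + 1 - (i + k)) * v (i + k) j * x ^ (j:ℕ) =
      (y k : ℝ) * D ^ (d + 1 - (i + k)) * ∑ j, (v (i+k) j : ℝ) * x ^ (j:ℕ) := by
      rw [Finset.mul_sum]; exact Finset.sum_congr rfl fun j _ => by ring
    rw [h1, ← hv]
    have h2 : (d + 1 - ((i:ℕ) + k)) + (i + k) = d + 1 := by
      have := i.2; have := k.2; omega
    rw [← h2, pow_add]
    simp only [Nat.add_sub_cancel]
    ring
  have hMb : ∀ i j, |(M i j : ℝ)| ≤ B * H := by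
    intro i j
    simp only [hM, Matrix.of_apply]
    push_cast
    refine (Finset.abs_sum_le_sum_abs _ _).trans ?_
    have : ∀ k : Fin 3, |(y k : ℝ) * D ^ (d + 1 - (i + k)) * v (i + k) j| ≤ H * W ^ (d+1) := by
      intro k
      have h2 : (d + 1 - ((i:ℕ) + k)) + (i + k) = d + 1 := by
        have := i.2; have := k.2; omega
      rw [abs_mul, abs_mul, mul_assoc]
      apply mul_le_mul (hy k) _ (by positivity) (by linarith)
      rw [← h2, pow_add]
      simp only [Nat.add_sub_cancel]
      apply mul_le_mul _ (hvb _ _) (abs_nonneg _) (by positivity)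
      rw [abs_pow, abs_of_pos (by linarith : (0:ℝ) < D)]
      exact pow_le_pow_left₀ (by linarith) hDW _
    refine (Finset.sum_le_sum fun k _ => this k).trans ?_
    simp [hB]; linarith
  have hdet : M.det ≠ 0 := by
    intro h0
    have h1 : (M.map (Int.cast : ℤ → ℚ)).det = 0 := by
      have := Int.cast_det (R := ℚ) M
      rw [h0] at this; simpa using this.symm
    obtain ⟨u, hu0, hu⟩ := Matrix.exists_vecMul_eq_zero_iff.mpr h1
    apply hu0
    apply hind
    have h2 : (D:ℝ) ^ (d+1) * S * ∑ i, (u i : ℝ) * x ^ (i:ℕ) = 0 := by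
      calc _ = ∑ i, (u i : ℝ) * ((D:ℝ) ^ (d+1) * S * x ^ (i:ℕ)) := by
            rw [Finset.mul_sum]; exact Finset.sum_congr rfl fun i _ => by ring
        _ = ∑ i, ∑ j, (u i : ℝ) * M i j * x ^ (j:ℕ) := by
            refine Finset.sum_congr rfl fun i _ => ?_
            rw [← hMx, Finset.mul_sum]; exact Finset.sum_congr rfl fun j _ => by ring
        _ = ∑ j, (∑ i, (u i : ℝ) * M i j) * x ^ (j:ℕ) := by
            rw [Finset.sum_comm]; exact Finset.sum_congr rfl fun j _ => by rw [Finset.sum_mul]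
        _ = 0 := by
            refine Finset.sum_eq_zero fun j _ => ?_
            have h3 := congrFun hu j
            simp only [Matrix.vecMul, dotProduct, Matrix.map_apply, Pi.zero_apply] at h3
            have h4 : (∑ i, (u i : ℝ) * M i j) = 0 := by exact_mod_cast congrArg (fun q : ℚ => (q : ℝ)) h3
            rw [h4, zero_mul]
    exact (mul_eq_zero.mp h2).resolve_left (mul_ne_zero (by positivity) hne)
  have hdet1 : (1:ℝ) ≤ |(M.det : ℝ)| := by exact_mod_cast Int.one_le_abs hdet
  set i0 : Fin d := ⟨0, hd⟩
  -- Cramer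
  have hcr : (M.det : ℝ) = (D:ℝ) ^ (d+1) * S * ∑ i, (M.adjugate i0 i : ℝ) * x ^ (i:ℕ) := by
    have h1 : ∀ j, ∑ i, M.adjugate i0 i * M i j = if i0 = j then M.det else 0 := by
      intro j
      have := congrFun (congrFun (Matrix.adjugate_mul M) i0) j
      rw [Matrix.mul_apply] at this
      rw [this, Matrix.smul_apply, Matrix.one_apply]
      simp
    calc (M.det : ℝ) = ∑ j, ((if i0 = j then M.det else 0 : ℤ) : ℝ) * x ^ (j:ℕ) := by
          rw [Finset.sum_eq_single i0]
          · simp [i0]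
          · intro j _ hj; rw [if_neg (Ne.symm hj)]; simp
          · simp
      _ = ∑ j, (∑ i, (M.adjugate i0 i : ℝ) * M i j) * x ^ (j:ℕ) := by
          refine Finset.sum_congr rfl fun j _ => ?_
          rw [← h1]; push_cast; rfl
      _ = ∑ i, (M.adjugate i0 i : ℝ) * ∑ j, (M i j : ℝ) * x ^ (j:ℕ) := by
          simp only [Finset.sum_mul, Finset.mul_sum]
          rw [Finset.sum_comm]
          exact Finset.sum_congr rfl fun j _ => Finset.sum_congr rfl fun i _ => by ring
      _ = _ := by
          rw [Finset.mul_sum]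
          refine Finset.sum_congr rfl fun i _ => ?_
          rw [hMx]; ring
  have hadj : ∀ i, |(M.adjugate i0 i : ℝ)| ≤ d.factorial * (B * H) ^ d := by
    intro i
    rw [Matrix.adjugate_apply, Int.cast_det]
    have := Matrix.det_le (abv := IsAbsoluteValue.toAbsoluteValue (abs : ℝ → ℝ)) (x := B * H)
      (A := ((M.updateRow i (Pi.single i0 1)).map (Int.cast : ℤ → ℝ))) (by
        intro k l
        simp only [Matrix.map_apply, Matrix.updateRow_apply]
        have hBH : 1 ≤ B * H := one_le_mul_of_one_le_of_one_le hB1 hH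
        show |((if k = i then (Pi.single i0 1 : Fin d → ℤ) l else M k l : ℤ) : ℝ)| ≤ B * H
        split_ifs
        · by_cases hl : l = i0
          · subst hl; simpa using hBH
          · simp [Pi.single_apply, hl]; linarith
        · exact hMb k l)
    simpa using this
  have hfin : |(M.det : ℝ)| ≤ |S| * H ^ d * Z := by
    rw [hcr, abs_mul, abs_mul, abs_pow, abs_of_pos (by linarith : (0:ℝ) < D)]
    have : |∑ i, (M.adjugate i0 i : ℝ) * x ^ (i:ℕ)| ≤ d.factorial * (B * H) ^ d * ∑ j : Fin d, |x| ^ (j:ℕ) := by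
      refine (Finset.abs_sum_le_sum_abs _ _).trans ?_
      rw [Finset.mul_sum]
      refine Finset.sum_le_sum fun i _ => ?_
      rw [abs_mul, abs_pow]
      exact mul_le_mul_of_nonneg_right (hadj i) (by positivity)
    calc _ ≤ (D:ℝ) ^ (d+1) * |S| * (d.factorial * (B * H) ^ d * ∑ j : Fin d, |x| ^ (j:ℕ)) :=
          mul_le_mul_of_nonneg_left this (by positivity)
      _ = _ := by rw [hZ, mul_pow]; ring
  rw [div_le_iff₀ hZ0]
  linarith
end AB

namespace AB

set_option maxHeartbeats 2000000 in
lemma block (x : ℝ) (hx : IsAlgebraic ℚ x) (h0 : 0 < x) (h1 : x < 1)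
    (hind : ∀ y : Fin 3 → ℤ, ∑ k, (y k : ℝ) * x ^ (k : ℕ) = 0 → y = 0) :
    ∃ δ : ℝ, 0 < δ ∧ ∃ N0 : ℕ, ∀ q p r : ℤ, (N0 : ℤ) ≤ q → |(q:ℝ) * x - p| ≤ 1 / q → |(q:ℝ) * x ^ 2 - r| ≤ 2 / q →
      ∃ (Y Y' : Fin 3 → ℤ) (l : Fin 3 → ℝ), q * Y 0 + p * Y 1 + r * Y 2 = 0 ∧ q * Y' 0 + p * Y' 1 + r * Y' 2 = 0 ∧
        Y 1 * Y' 2 - Y 2 * Y' 1 ≠ 0 ∧ (∀ k, |l k| ≤ 2) ∧ ∑ k, l k ≤ -δ ∧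
        (∀ k, k ≠ 0 → |(Y k : ℝ)| ≤ Real.exp (l k * Real.log q) ∧ |(Y' k : ℝ)| ≤ Real.exp (l k * Real.log q)) ∧
        |∑ k, (Y k : ℝ) * x ^ (k : ℕ)| ≤ 3 * Real.exp (l 0 * Real.log q) ∧
        |∑ k, (Y' k : ℝ) * x ^ (k : ℕ)| ≤ 3 * Real.exp (l 0 * Real.log q) := by
  obtain ⟨d, c, hc, hL⟩ := liouville x hx
  obtain ⟨N1, hN1⟩ := exists_nat_gt (3 * 5 ^ d / c)
  refine ⟨1 / (d + 1), by positivity, N1 + 2, ?_⟩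
  intro q p r hq hp hr
  have hqN : (N1 : ℝ) + 2 ≤ q := by exact_mod_cast hq
  have hq2 : (2:ℝ) ≤ q := by have : (0:ℝ) ≤ N1 := by positivity
                             linarith
  have hq0 : 0 < q := by have : (0:ℝ) < q := by linarith
                         exact_mod_cast this
  obtain ⟨H, j, y, y', hH1, hHq, hdy, hdy', hy0, hyj, hyj', hyj1, hyj1', hdet⟩ :=
    lattice q.toNat (by omega) ![p, r]
  have hqn : ((q.toNat : ℕ) : ℤ) = q := Int.toNat_of_nonneg hq0.le
  have hqnR : ((q.toNat : ℕ) : ℝ) = q := by exact_mod_cast congrArg (Int.cast : ℤ → ℝ) hqn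
  rw [hqn] at hdy hdy' hyj1'
  obtain ⟨z, hz⟩ := hdy
  obtain ⟨z', hz'⟩ := hdy'
  simp only [Matrix.cons_val_zero, Matrix.cons_val_one] at hz hz'
  have hqR : (0:ℝ) < q := by linarith
  have hHR : (1:ℝ) ≤ H := by exact_mod_cast hH1
  have hHqR : (H:ℝ) ^ 2 ≤ q := by rw [← hqnR]; exact_mod_cast hHq
  have hlq : 0 < Real.log q := Real.log_pos (by linarith)
  set τ := Real.log H / Real.log q with hτ
  have hτ0 : 0 ≤ τ := div_nonneg (Real.log_nonneg hHR) hlq.le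
  have hτ1 : τ ≤ 1 / 2 := by
    rw [hτ, div_le_iff₀ hlq]
    have := Real.log_le_log (by positivity) hHqR
    rw [Real.log_pow] at this
    push_cast at this
    linarith
  have eτ : Real.exp (τ * Real.log q) = H := by
    rw [hτ, div_mul_cancel₀ _ hlq.ne', Real.exp_log (by linarith)]
  have eτ1 : Real.exp ((1 - τ) * Real.log q) = q / H := by
    rw [sub_mul, one_mul, Real.exp_sub, eτ, Real.exp_log hqR]
  have eτ2 : Real.exp ((-(1 + τ)) * Real.log q) = 1 / (q * H) := by
    rw [neg_mul, Real.exp_neg, add_mul, one_mul, Real.exp_add, eτ, Real.exp_log hqR, one_div]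
  have hqH : (H:ℝ) ≤ q / H := by rw [le_div_iff₀ (by linarith)]; nlinarith
  -- evaluation
  have hev : ∀ (u : Fin 2 → ℤ) (w : ℤ) (B : ℝ), p * u 0 + r * u 1 = q * w → (∀ i, |(u i : ℝ)| ≤ B) →
      |((-w : ℤ) : ℝ) + u 0 * x + u 1 * x ^ 2| ≤ 3 * B / q ^ 2 := by
    intro u w B hw hB
    have hwR : (p:ℝ) * u 0 + r * u 1 = q * w := by exact_mod_cast hw
    have e : ((-w : ℤ) : ℝ) + u 0 * x + u 1 * x ^ 2 = (u 0 * (q * x - p) + u 1 * (q * x ^ 2 - r)) / q := by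
      push_cast
      rw [eq_div_iff hqR.ne']
      linear_combination hwR
    rw [e, abs_div, abs_of_pos hqR, div_le_div_iff₀ hqR (by positivity)]
    have h1 : |(u 0 : ℝ) * (q * x - p) + u 1 * (q * x ^ 2 - r)| ≤ 3 * B / q := by
      refine (abs_add_le _ _).trans ?_
      rw [abs_mul, abs_mul]
      have hB0 : 0 ≤ B := (abs_nonneg _).trans (hB 0)
      have a1 := mul_le_mul (hB 0) hp (abs_nonneg _) hB0
      have a2 := mul_le_mul (hB 1) hr (abs_nonneg _) hB0
      calc _ ≤ _ := add_le_add a1 a2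
        _ = _ := by ring
    rw [le_div_iff₀ hqR] at h1
    nlinarith
  have hyb : ∀ i, |(y i : ℝ)| ≤ H := by
    intro i
    have h1 : |(y j : ℝ)| ≤ H := by exact_mod_cast hyj
    have h2 : |(y (j+1) : ℝ)| ≤ H := by exact_mod_cast hyj'
    fin_cases j <;> fin_cases i <;> first | exact h1 | exact h2
  have b1 : |(y' j : ℝ)| ≤ H := by exact_mod_cast hyj1
  have b2 : |(y' (j+1) : ℝ)| ≤ q / H := by
    rw [le_div_iff₀ (by linarith)]; exact_mod_cast hyj1'
  have hyb' : ∀ i, |(y' i : ℝ)| ≤ q / H := by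
    intro i
    fin_cases j <;> fin_cases i <;> first | exact b2 | exact b1.trans hqH
  have hYx := hev y z H hz hyb
  have hYx' := hev y' z' _ hz' hyb'
  -- lower bound for H
  have hτ2 : 1 / ((d:ℝ) + 1) ≤ τ := by
    have hne : ∑ k : Fin 3, ((![-z, y 0, y 1] : Fin 3 → ℤ) k : ℝ) * x ^ (k : ℕ) ≠ 0 := by
      intro h
      apply hy0
      have := hind _ h
      ext i
      fin_cases i
      · simpa using congrFun this 1
      · simpa using congrFun this 2
    have hsum : ∑ k : Fin 3, ((![-z, y 0, y 1] : Fin 3 → ℤ) k : ℝ) * x ^ (k : ℕ) =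
        ((-z : ℤ) : ℝ) + y 0 * x + y 1 * x ^ 2 := by
      simp [Fin.sum_univ_three]
    have a0 := hyb 0
    have a1 := hyb 1
    have hzb : |((-z : ℤ) : ℝ)| ≤ 5 * H := by
      have e : ((-z : ℤ) : ℝ) = (((-z : ℤ) : ℝ) + y 0 * x + y 1 * x ^ 2) - y 0 * x - y 1 * x ^ 2 := by ring
      rw [e]
      have c0 : |(y 0 : ℝ) * x| ≤ H := by
        rw [abs_mul, abs_of_pos h0]; nlinarith [abs_nonneg (y 0 : ℝ)]
      have c1 : |(y 1 : ℝ) * x ^ 2| ≤ H := by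
        rw [abs_mul, abs_of_pos (by positivity : 0 < x ^ 2)]
        have : x ^ 2 ≤ 1 := by nlinarith
        nlinarith [abs_nonneg (y 1 : ℝ)]
      have c2 : 3 * (H:ℝ) / q ^ 2 ≤ 3 * H := by
        apply div_le_self (by positivity); nlinarith
      calc _ ≤ |((-z : ℤ) : ℝ) + y 0 * x + y 1 * x ^ 2| + |(y 0 : ℝ) * x| + |(y 1 : ℝ) * x ^ 2| :=
            (abs_sub _ _).trans (add_le_add (abs_sub _ _) le_rfl)
        _ ≤ _ := by linarith
    have := hL ![-z, y 0, y 1] (5 * H) (by linarith) (by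
      intro i
      fin_cases i
      · exact hzb
      · exact a0.trans (by linarith)
      · exact a1.trans (by linarith)) hne
    rw [hsum] at this
    have h3 : c ≤ 3 * H / q ^ 2 * (5 * H) ^ d := this.trans (by gcongr)
    have h4 : (q:ℝ) ≤ H ^ (d + 1) := by
      have h5 : c * q ^ 2 ≤ 3 * 5 ^ d * H ^ (d + 1) := by
        calc c * q ^ 2 ≤ 3 * H / q ^ 2 * (5 * H) ^ d * q ^ 2 := by gcongr
          _ = _ := by rw [mul_pow]; field_simp; ring
      have h6 : 3 * 5 ^ d ≤ c * q := by
        rw [div_lt_iff₀ hc] at hN1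
        nlinarith
      have h7 : (3 * 5 ^ d : ℝ) * q ≤ 3 * 5 ^ d * H ^ (d + 1) := by
        calc (3 * 5 ^ d : ℝ) * q ≤ c * q * q := by gcongr
          _ = c * q ^ 2 := by ring
          _ ≤ _ := h5
      exact le_of_mul_le_mul_left h7 (by positivity)
    have := Real.log_le_log hqR h4
    rw [Real.log_pow] at this
    push_cast at this
    rw [hτ, div_le_div_iff₀ (by positivity) hlq]
    linarith
  have key1 : 3 * (H:ℝ) / q ^ 2 ≤ 3 * Real.exp ((-(1 + τ)) * Real.log q) := by
    rw [eτ2, mul_div_assoc]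
    refine mul_le_mul_of_nonneg_left ?_ (by norm_num)
    rw [div_le_div_iff₀ (by positivity) (by positivity)]
    nlinarith
  have key2 : 3 * ((q:ℝ) / H) / q ^ 2 = 3 * Real.exp ((-(1 + τ)) * Real.log q) := by
    rw [eτ2]; field_simp
  refine ⟨![-z, y 0, y 1], ![-z', y' 0, y' 1], if j = 0 then ![-(1 + τ), τ, 1 - τ] else ![-(1 + τ), 1 - τ, τ],
    ?_, ?_, ?_, ?_, ?_, ?_, ?_, ?_⟩
  · simp; linarith
  · simp; linarith
  · simpa using hdet
  · intro k
    fin_cases j <;> fin_cases k <;> simp <;> rw [abs_le] <;> constructor <;> linarith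
  · fin_cases j <;> simp [Fin.sum_univ_three] <;> rw [← one_div] <;> linarith
  · intro k hk
    have a0 := hyb 0
    have a1 := hyb 1
    fin_cases j
    · have b1 : |(y' 0 : ℝ)| ≤ H := b1
      have b2 : |(y' 1 : ℝ)| ≤ q / H := b2
      fin_cases k
      · exact absurd rfl hk
      · simp only [Fin.zero_eta, if_true]
        simp only [Fin.mk_one, Matrix.cons_val_one, Matrix.cons_val_zero, eτ]
        exact ⟨a0, b1⟩
      · simp only [Fin.zero_eta, if_true, Fin.reduceFinMk, Matrix.cons_val, eτ1]
        exact ⟨a1.trans hqH, b2⟩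
    · have b1 : |(y' 1 : ℝ)| ≤ H := b1
      have b2 : |(y' 0 : ℝ)| ≤ q / H := b2
      fin_cases k
      · exact absurd rfl hk
      · simp only [Fin.mk_one, one_ne_zero, if_false, Matrix.cons_val_one, Matrix.cons_val_zero, eτ1]
        exact ⟨a0.trans hqH, b2⟩
      · simp only [Fin.mk_one, one_ne_zero, if_false, Fin.reduceFinMk, Matrix.cons_val, eτ]
        exact ⟨a1, b1⟩
  · have e : (if j = 0 then ![-(1 + τ), τ, 1 - τ] else ![-(1 + τ), 1 - τ, τ]) 0 = -(1 + τ) := by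
      split_ifs <;> rfl
    rw [e]
    refine le_trans ?_ key1
    simpa [Fin.sum_univ_three] using hYx
  · have e : (if j = 0 then ![-(1 + τ), τ, 1 - τ] else ![-(1 + τ), 1 - τ, τ]) 0 = -(1 + τ) := by
      split_ifs <;> rfl
    rw [e, ← key2]
    simpa [Fin.sum_univ_three] using hYx'

end AB

namespace AB
open Finset

/-- exponent triples of total degree `r`. -/
def tri (r : ℕ) : Finset (Fin 3 → ℕ) := Finset.piAntidiag Finset.univ r

lemma mem_tri {r : ℕ} {i : Fin 3 → ℕ} : i ∈ tri r ↔ ∑ k, i k = r := by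
  simp [tri]

lemma tri_le {r : ℕ} {i : Fin 3 → ℕ} (h : i ∈ tri r) (k : Fin 3) : i k ≤ r := by
  rw [mem_tri] at h
  rw [← h]
  exact Finset.single_le_sum (f := i) (fun _ _ => Nat.zero_le _) (Finset.mem_univ k)

lemma tri_nonempty (r : ℕ) : (tri r).Nonempty :=
  ⟨![r, 0, 0], by rw [mem_tri]; simp [Fin.sum_univ_three]⟩

lemma tri_card (r : ℕ) : (tri r).card ≤ 8 ^ r := by
  have h : tri r ⊆ Fintype.piFinset (fun _ : Fin 3 => Finset.range (r + 1)) := by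
    intro i hi
    rw [Fintype.mem_piFinset]
    intro k
    rw [Finset.mem_range]
    have := tri_le hi k
    omega
  refine (Finset.card_le_card h).trans ?_
  rw [Fintype.card_piFinset]
  simp only [Finset.card_range, Finset.prod_const, Finset.card_univ, Fintype.card_fin]
  have : r + 1 ≤ 2 ^ r := Nat.lt_two_pow_self
  calc (r + 1) ^ 3 ≤ (2 ^ r) ^ 3 := Nat.pow_le_pow_left this 3
    _ = 8 ^ r := by rw [← pow_mul, mul_comm, pow_mul]; norm_num

lemma tri_sum_comp (r : ℕ) (k : Fin 3) : ∑ i ∈ tri r, (i k : ℝ) = (tri r).card * r / 3 := by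
  have hsym : ∀ k k' : Fin 3, ∑ i ∈ tri r, (i k : ℝ) = ∑ i ∈ tri r, (i k' : ℝ) := by
    intro k k'
    refine Finset.sum_bij' (fun i _ => i ∘ Equiv.swap k k') (fun i _ => i ∘ Equiv.swap k k') ?_ ?_ ?_ ?_ ?_
    · intro i hi
      rw [mem_tri] at hi ⊢
      rw [← hi]
      exact Equiv.sum_comp (Equiv.swap k k') i
    · intro i hi
      rw [mem_tri] at hi ⊢
      rw [← hi]
      exact Equiv.sum_comp (Equiv.swap k k') i
    · intro i _; ext a; simp
    · intro i _; ext a; simp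
    · intro i _; simp
  have htot : ∑ k : Fin 3, ∑ i ∈ tri r, (i k : ℝ) = (tri r).card * r := by
    rw [Finset.sum_comm]
    rw [Finset.sum_congr rfl (g := fun _ => (r : ℝ))]
    · simp
    · intro i hi
      rw [mem_tri] at hi
      exact_mod_cast hi
  rw [Finset.sum_congr rfl (fun k' _ => hsym k' k)] at htot
  simp at htot
  linarith

lemma tri_mgf (r : ℕ) (hr : 0 < r) (l : Fin 3 → ℝ) (δ : ℝ) (hl : ∀ k, |l k| ≤ 2) (hs : ∑ k, l k ≤ -δ)
    (s : ℝ) (hs0 : 0 ≤ s) (hs1 : s ≤ 1 / 2) :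
    ∑ i ∈ tri r, Real.exp (s * ((∑ k, l k * i k) / r)) ≤ (tri r).card * Real.exp (-(s * δ / 3) + 4 * s ^ 2) := by
  have hrR : (0:ℝ) < r := by exact_mod_cast hr
  have hX : ∀ i ∈ tri r, |(∑ k, l k * i k) / r| ≤ 2 := by
    intro i hi
    rw [abs_div, abs_of_pos hrR, div_le_iff₀ hrR]
    refine (Finset.abs_sum_le_sum_abs _ _).trans ?_
    calc ∑ k, |l k * i k| ≤ ∑ k, 2 * (i k : ℝ) := by
          refine Finset.sum_le_sum fun k _ => ?_
          rw [abs_mul, Nat.abs_cast]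
          exact mul_le_mul_of_nonneg_right (hl k) (Nat.cast_nonneg _)
      _ = 2 * r := by
          rw [← Finset.mul_sum]; rw [mem_tri] at hi; rw [← hi]; push_cast; rfl
  have h1 : ∀ i ∈ tri r, Real.exp (s * ((∑ k, l k * i k) / r)) ≤
      1 + s * ((∑ k, l k * i k) / r) + 4 * s ^ 2 := by
    intro i hi
    have hx := hX i hi
    set X := (∑ k, l k * i k) / r
    have hu : |s * X| ≤ 1 := by
      rw [abs_mul, abs_of_nonneg hs0]; nlinarith [abs_nonneg X]
    have := Real.abs_exp_sub_one_sub_id_le hu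
    rw [abs_le] at this
    have hx2 : X ^ 2 ≤ 4 := by rw [← sq_abs]; nlinarith [abs_nonneg X]
    nlinarith [sq_nonneg s]
  refine (Finset.sum_le_sum h1).trans ?_
  have h2 : ∑ i ∈ tri r, ((∑ k, l k * (i k : ℝ)) / r) = (tri r).card * (∑ k, l k) / 3 := by
    rw [← Finset.sum_div, Finset.sum_comm]
    simp only [← Finset.mul_sum, tri_sum_comp]
    rw [← Finset.sum_mul]
    field_simp
  rw [Finset.sum_add_distrib, Finset.sum_add_distrib, ← Finset.mul_sum, h2]
  simp only [Finset.sum_const, nsmul_eq_mul, mul_one]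
  have hc : (0:ℝ) ≤ (tri r).card := Nat.cast_nonneg _
  calc (tri r).card + s * ((tri r).card * (∑ k, l k) / 3) + (tri r).card * (4 * s ^ 2)
      = (tri r).card * (1 + s * (∑ k, l k) / 3 + 4 * s ^ 2) := by ring
    _ ≤ (tri r).card * ((-(s * δ / 3) + 4 * s ^ 2) + 1) := by
        refine mul_le_mul_of_nonneg_left ?_ hc
        nlinarith
    _ ≤ _ := mul_le_mul_of_nonneg_left (Real.add_one_le_exp _) hc

/-- multi-exponents. -/
def box3 {m : ℕ} (r : Fin m → ℕ) : Finset (Fin m → Fin 3 → ℕ) := Fintype.piFinset fun h => tri (r h)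

lemma mem_box3 {m : ℕ} {r : Fin m → ℕ} {I : Fin m → Fin 3 → ℕ} : I ∈ box3 r ↔ ∀ h, I h ∈ tri (r h) :=
  Fintype.mem_piFinset

lemma box3_card {m : ℕ} (r : Fin m → ℕ) : ((box3 r).card : ℝ) = ∏ h, ((tri (r h)).card : ℝ) := by
  rw [box3, Fintype.card_piFinset]; push_cast; rfl

lemma box3_card_le {m : ℕ} (r : Fin m → ℕ) : (box3 r).card ≤ 8 ^ (∑ h, r h) := by
  rw [box3, Fintype.card_piFinset, ← Finset.prod_pow_eq_pow_sum]
  exact Finset.prod_le_prod' fun h _ => tri_card _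

lemma box3_nonempty {m : ℕ} (r : Fin m → ℕ) : (box3 r).Nonempty :=
  Fintype.piFinset_nonempty.mpr fun _ => tri_nonempty _

lemma chernoff {m : ℕ} (r : Fin m → ℕ) (hr : ∀ h, 0 < r h) (l : Fin m → Fin 3 → ℝ) (δ : ℝ) (hδ : 0 < δ) (hδ1 : δ ≤ 1)
    (hl : ∀ h k, |l h k| ≤ 2) (hs : ∀ h, ∑ k, l h k ≤ -δ) :
    (((box3 r).filter fun I => -(m * δ / 6) < ∑ h, (∑ k, l h k * I h k) / r h).card : ℝ) ≤
      (box3 r).card * Real.exp (-(m * δ ^ 2 / 576)) := by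
  set s := δ / 48 with hsd
  have hs0 : 0 ≤ s := by positivity
  have hs1 : s ≤ 1 / 2 := by rw [hsd]; linarith
  calc (((box3 r).filter fun I => -(m * δ / 6) < ∑ h, (∑ k, l h k * I h k) / r h).card : ℝ)
      = ∑ I ∈ (box3 r).filter fun I => -(m * δ / 6) < ∑ h, (∑ k, l h k * I h k) / r h, (1:ℝ) := by simp
    _ ≤ ∑ I ∈ (box3 r).filter fun I => -(m * δ / 6) < ∑ h, (∑ k, l h k * I h k) / r h,
          Real.exp (s * (∑ h, (∑ k, l h k * I h k) / r h + m * δ / 6)) := by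
        refine Finset.sum_le_sum fun I hI => ?_
        rw [Finset.mem_filter] at hI
        rw [Real.one_le_exp_iff]
        exact mul_nonneg hs0 (by linarith [hI.2])
    _ ≤ ∑ I ∈ box3 r, Real.exp (s * (∑ h, (∑ k, l h k * I h k) / r h + m * δ / 6)) :=
        Finset.sum_le_sum_of_subset_of_nonneg (Finset.filter_subset _ _) fun _ _ _ => (Real.exp_pos _).le
    _ = Real.exp (s * (m * δ / 6)) * ∏ h, ∑ i ∈ tri (r h), Real.exp (s * ((∑ k, l h k * i k) / r h)) := by
        rw [Finset.prod_univ_sum, Finset.mul_sum]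
        refine Finset.sum_congr rfl fun I _ => ?_
        rw [← Real.exp_sum, ← Real.exp_add, ← Finset.mul_sum]
        ring_nf
    _ ≤ Real.exp (s * (m * δ / 6)) * ∏ h : Fin m, ((tri (r h)).card * Real.exp (-(s * δ / 3) + 4 * s ^ 2)) := by
        refine mul_le_mul_of_nonneg_left ?_ (Real.exp_pos _).le
        refine Finset.prod_le_prod (fun h _ => Finset.sum_nonneg fun _ _ => (Real.exp_pos _).le) fun h _ => ?_
        exact tri_mgf _ (hr h) _ δ (hl h) (hs h) s hs0 hs1
    _ = _ := by
        rw [Finset.prod_mul_distrib, ← box3_card, Finset.prod_const, Finset.card_univ, Fintype.card_fin,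
          ← Real.exp_nat_mul, mul_left_comm, ← Real.exp_add]
        congr 2
        rw [hsd]; ring

open Matrix in
attribute [local instance] Matrix.seminormedAddCommGroup in
lemma siegel {α β : Type} [Fintype α] [Fintype β] [Nonempty β] (hc : 2 * Fintype.card α ≤ Fintype.card β)
    (A : Matrix α β ℤ) (K : ℝ) (hK : 1 ≤ K) (hA : ∀ a b, |(A a b : ℝ)| ≤ K) :
    ∃ t : β → ℤ, t ≠ 0 ∧ A *ᵥ t = 0 ∧ ∀ b, |(t b : ℝ)| ≤ Fintype.card β * K := by
  classical
  have hβ : 0 < Fintype.card β := Fintype.card_pos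
  have hβR : (1:ℝ) ≤ Fintype.card β := by exact_mod_cast hβ
  rcases Nat.eq_zero_or_pos (Fintype.card α) with h0 | h0
  · have := Fintype.card_eq_zero_iff.mp h0
    refine ⟨fun _ => 1, ?_, ?_, ?_⟩
    · intro h; simpa using congrFun h (Classical.arbitrary β)
    · ext a; exact isEmptyElim a
    · intro b; simp; nlinarith
  · obtain ⟨t, ht, hAt, hb⟩ := Int.Matrix.exists_ne_zero_int_vec_norm_le A (by omega) h0
    refine ⟨t, ht, hAt, fun b => ?_⟩
    have h1 : |(t b : ℝ)| ≤ ‖t‖ := by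
      have := norm_le_pi_norm t b
      rwa [Int.norm_eq_abs] at this
    refine (h1.trans hb).trans ?_
    have hn : ‖A‖ ≤ K := by
      rw [Matrix.norm_le_iff (by linarith)]
      intro i j
      rw [Int.norm_eq_abs]; exact hA i j
    have hbase : (1:ℝ) ≤ Fintype.card β * max 1 ‖A‖ := by
      have := le_max_left (1:ℝ) ‖A‖
      nlinarith
    have hexp : (Fintype.card α : ℝ) / (Fintype.card β - Fintype.card α) ≤ 1 := by
      have h2 : (2:ℝ) * Fintype.card α ≤ Fintype.card β := by exact_mod_cast hc
      have h3 : (0:ℝ) < Fintype.card α := by exact_mod_cast h0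
      rw [div_le_one (by linarith)]; linarith
    calc _ ≤ (Fintype.card β * max 1 ‖A‖ : ℝ) ^ (1:ℝ) := Real.rpow_le_rpow_of_exponent_le hbase hexp
      _ = Fintype.card β * max 1 ‖A‖ := Real.rpow_one _
      _ ≤ _ := by gcongr; exact max_le hK hn
end AB

namespace AB
open MvPolynomial Finset

noncomputable def polyN (i : Fin 3 → ℕ) : MvPolynomial (Fin 3) ℤ :=
  (X 0 - X 1 - X 2) ^ (i 0) * X 1 ^ (i 1) * X 2 ^ (i 2)

noncomputable def N1 (i i' : Fin 3 → ℕ) : ℤ := coeff (Finsupp.equivFunOnFinite.symm i') (polyN i)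

lemma polyN_hom (i : Fin 3 → ℕ) : (polyN i).IsHomogeneous (∑ k, i k) := by
  have h1 : ((X 0 - X 1 - X 2 : MvPolynomial (Fin 3) ℤ)).IsHomogeneous 1 :=
    ((isHomogeneous_X ℤ 0).sub (isHomogeneous_X ℤ 1)).sub (isHomogeneous_X ℤ 2)
  have := ((h1.pow (i 0)).mul ((isHomogeneous_X ℤ (1 : Fin 3)).pow (i 1))).mul
    ((isHomogeneous_X ℤ (2 : Fin 3)).pow (i 2))
  rw [Fin.sum_univ_three]
  simpa only [one_mul, polyN] using this

lemma N1_eval {A : Type} [CommRing A] (u : Fin 3 → A) {r : ℕ} {i : Fin 3 → ℕ} (hi : i ∈ tri r) :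
    (u 0 - u 1 - u 2) ^ (i 0) * u 1 ^ (i 1) * u 2 ^ (i 2) =
      ∑ i' ∈ tri r, (N1 i i' : A) * ∏ k, u k ^ i' k := by
  have h1 : (u 0 - u 1 - u 2) ^ (i 0) * u 1 ^ (i 1) * u 2 ^ (i 2) = eval₂ (Int.castRingHom A) u (polyN i) := by
    simp [polyN]
  rw [h1, eval₂_eq']
  rw [Finset.sum_subset (s₂ := (tri r).map Finsupp.equivFunOnFinite.symm.toEmbedding)]
  · rw [Finset.sum_map]
    rfl
  · intro d hd
    rw [Finset.mem_map]
    refine ⟨d, ?_, ?_⟩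
    · have := polyN_hom i (mem_support_iff.mp hd)
      rw [mem_tri] at hi ⊢
      rw [← hi, ← this]
      simp [Finsupp.weight_apply, Finsupp.sum_fintype]
    · ext; rfl
  · intro d _ hd
    rw [notMem_support_iff] at hd
    rw [hd]; simp

lemma N1_bound {r : ℕ} {i : Fin 3 → ℕ} (hi : i ∈ tri r) (i' : Fin 3 → ℕ) : |(N1 i i' : ℝ)| ≤ 3 ^ r := by
  have h1 := norm_coeff_le_l1 (polyN i) (Finsupp.equivFunOnFinite.symm i')
  rw [Int.norm_eq_abs] at h1
  refine h1.trans ?_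
  have h3 : l1 (X 0 - X 1 - X 2 : MvPolynomial (Fin 3) ℤ) ≤ 3 := by
    rw [sub_eq_add_neg, sub_eq_add_neg]
    have a1 := l1_add (X 0 + -X 1 : MvPolynomial (Fin 3) ℤ) (-X 2)
    have a2 := l1_add (X 0 : MvPolynomial (Fin 3) ℤ) (-X 1)
    rw [l1_neg, l1_X] at a1 a2
    rw [l1_X] at a2
    linarith
  unfold polyN
  have hp : ∀ (k : Fin 3) (n : ℕ), l1 (X k ^ n : MvPolynomial (Fin 3) ℤ) ≤ 1 := by
    intro k n
    refine (l1_pow _ _).trans ?_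
    rw [l1_X, one_pow]
  calc _ ≤ l1 ((X 0 - X 1 - X 2 : MvPolynomial (Fin 3) ℤ) ^ (i 0) * X 1 ^ (i 1)) * l1 (X 2 ^ (i 2) : MvPolynomial (Fin 3) ℤ) := l1_mul _ _
    _ ≤ l1 ((X 0 - X 1 - X 2 : MvPolynomial (Fin 3) ℤ) ^ (i 0) * X 1 ^ (i 1)) * 1 :=
        mul_le_mul_of_nonneg_left (hp _ _) (l1_nonneg _)
    _ ≤ l1 ((X 0 - X 1 - X 2 : MvPolynomial (Fin 3) ℤ) ^ (i 0)) * l1 (X 1 ^ (i 1) : MvPolynomial (Fin 3) ℤ) * 1 := by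
        rw [mul_one, mul_one]; exact l1_mul _ _
    _ ≤ l1 ((X 0 - X 1 - X 2 : MvPolynomial (Fin 3) ℤ) ^ (i 0)) * 1 * 1 := by
        rw [mul_one, mul_one, mul_one]
        exact mul_le_of_le_one_right (l1_nonneg _) (hp _ _)
    _ ≤ 3 ^ (i 0) := by
        rw [mul_one, mul_one]
        exact (l1_pow _ _).trans (pow_le_pow_left₀ (l1_nonneg _) h3 _)
    _ ≤ 3 ^ r := pow_le_pow_right₀ (by norm_num) (tri_le hi 0)

variable {m : ℕ}

/-- Evaluation of a multihomogeneous form given by its coefficients. -/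
noncomputable def ev {A : Type} [CommRing A] (r : Fin m → ℕ) (c : (Fin m → Fin 3 → ℕ) → ℤ) (y : Fin m → Fin 3 → A) : A :=
  ∑ I ∈ box3 r, (c I : A) * ∏ h, ∏ k, y h k ^ I h k

noncomputable def evR {A : Type} [CommRing A] [Algebra ℝ A] (r : Fin m → ℕ) (c : (Fin m → Fin 3 → ℕ) → ℝ)
    (y : Fin m → Fin 3 → A) : A :=
  ∑ I ∈ box3 r, algebraMap ℝ A (c I) * ∏ h, ∏ k, y h k ^ I h k

lemma map_ev {A B : Type} [CommRing A] [CommRing B] (f : A →+* B) (r : Fin m → ℕ) (c : (Fin m → Fin 3 → ℕ) → ℤ)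
    (y : Fin m → Fin 3 → A) : f (ev r c y) = ev r c (fun h k => f (y h k)) := by
  simp [ev, map_sum, map_prod]

/-- total power of `ξ`. -/
def wx (I : Fin m → Fin 3 → ℕ) : ℕ := ∑ h, (I h 1 + 2 * I h 2)

lemma wx_le {r : Fin m → ℕ} {I : Fin m → Fin 3 → ℕ} (hI : I ∈ box3 r) : wx I ≤ 2 * ∑ h, r h := by
  rw [mem_box3] at hI
  rw [wx, Finset.mul_sum]
  refine Finset.sum_le_sum fun h _ => ?_
  have := hI h
  rw [mem_tri, Fin.sum_univ_three] at this
  omega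

noncomputable def NN (I I' : Fin m → Fin 3 → ℕ) : ℤ := ∏ h, N1 (I h) (I' h)

lemma NN_bound {r : Fin m → ℕ} {I : Fin m → Fin 3 → ℕ} (hI : I ∈ box3 r) (I' : Fin m → Fin 3 → ℕ) :
    |(NN I I' : ℝ)| ≤ 3 ^ (∑ h, r h) := by
  rw [mem_box3] at hI
  rw [NN]; push_cast
  rw [Finset.abs_prod, ← Finset.prod_pow_eq_pow_sum]
  exact Finset.prod_le_prod (fun _ _ => abs_nonneg _) fun h _ => N1_bound (hI h) _

/-- new coefficients. -/
noncomputable def chat (ξ : ℝ) (r : Fin m → ℕ) (c : (Fin m → Fin 3 → ℕ) → ℤ) (I' : Fin m → Fin 3 → ℕ) : ℝ :=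
  ∑ I ∈ box3 r, (c I : ℝ) * ξ ^ wx I * NN I I'

/-- linear change of variables. -/
noncomputable def sub3 {A : Type} [CommRing A] [Algebra ℝ A] (ξ : ℝ) (u : Fin m → Fin 3 → A) (h : Fin m) (k : Fin 3) : A :=
  if k = 0 then u h 0 - u h 1 - u h 2 else algebraMap ℝ A (ξ ^ (k : ℕ)) * u h k

lemma ev_sub3 {A : Type} [CommRing A] [Algebra ℝ A] (ξ : ℝ) (r : Fin m → ℕ) (c : (Fin m → Fin 3 → ℕ) → ℤ)
    (u : Fin m → Fin 3 → A) : ev r c (sub3 ξ u) = evR r (chat ξ r c) u := by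
  unfold ev evR chat
  simp only [map_sum, Finset.sum_mul]
  rw [Finset.sum_comm]
  refine Finset.sum_congr rfl fun I hI => ?_
  have h1 : ∀ h, ∏ k, sub3 ξ u h k ^ I h k =
      algebraMap ℝ A (ξ ^ (I h 1 + 2 * I h 2)) * ∑ i' ∈ tri (r h), (N1 (I h) i' : A) * ∏ k, u h k ^ i' k := by
    intro h
    rw [← N1_eval (u h) (mem_box3.mp hI h), Fin.prod_univ_three]
    have e0 : sub3 ξ u h 0 = u h 0 - u h 1 - u h 2 := rfl
    have e1 : sub3 ξ u h 1 = algebraMap ℝ A ξ * u h 1 := by simp [sub3]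
    have e2 : sub3 ξ u h 2 = algebraMap ℝ A ξ ^ 2 * u h 2 := by simp [sub3]
    rw [e0, e1, e2, map_pow]
    ring
  simp only [h1]
  rw [Finset.prod_mul_distrib, Finset.prod_univ_sum, ← map_prod, Finset.prod_pow_eq_pow_sum, Finset.mul_sum,
    Finset.mul_sum]
  refine Finset.sum_congr rfl fun I' _ => ?_
  rw [Finset.prod_mul_distrib, map_mul, map_mul, NN, wx]
  push_cast
  simp only [map_intCast, map_prod]
  ring
end AB

namespace AB
open Finset

lemma exists_m (d : ℕ) (δ : ℝ) (hδ : 0 < δ) : ∃ m : ℕ, 0 < m ∧ 2 * d * Real.exp (-(m * δ ^ 2 / 576)) ≤ 1 := by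
  obtain ⟨m, hm⟩ := exists_nat_ge (2 * d * 576 / δ ^ 2)
  refine ⟨m + 1, Nat.succ_pos _, ?_⟩
  rw [Real.exp_neg, ← div_eq_mul_inv, div_le_one (Real.exp_pos _)]
  rw [div_le_iff₀ (by positivity)] at hm
  have := Real.add_one_le_exp (((m + 1 : ℕ) : ℝ) * δ ^ 2 / 576)
  push_cast at this ⊢
  nlinarith [sq_nonneg δ]

lemma aux_poly (ξ : ℝ) (hξ : IsAlgebraic ℚ ξ) (δ : ℝ) (hδ : 0 < δ) (hδ1 : δ ≤ 1) :
    ∃ (m : ℕ) (C : ℝ), 0 < m ∧ 1 ≤ C ∧ ∀ (r : Fin m → ℕ), (∀ h, 0 < r h) → ∀ l : Fin m → Fin 3 → ℝ,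
      (∀ h k, |l h k| ≤ 2) → (∀ h, ∑ k, l h k ≤ -δ) →
      ∃ c : (Fin m → Fin 3 → ℕ) → ℤ, (∃ I ∈ box3 r, c I ≠ 0) ∧ ∑ I ∈ box3 r, |(c I : ℝ)| ≤ C ^ (∑ h, r h) ∧
        ∑ I ∈ box3 r, |chat ξ r c I| ≤ C ^ (∑ h, r h) ∧
        ∀ I ∈ box3 r, chat ξ r c I ≠ 0 → ∑ h, (∑ k, l h k * I h k) / r h ≤ -(m * δ / 6) := by
  classical
  obtain ⟨d, hd, D, f, hD, hf, -⟩ := alg_setup ξ hξ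
  obtain ⟨W, hW1, hDW, hv⟩ := pow_red hd hD hf
  choose v hv1 hv2 using hv
  obtain ⟨m, hm, hmd⟩ := exists_m d δ hδ
  set M := max 1 |ξ| with hM
  have hM1 : 1 ≤ M := le_max_left _ _
  refine ⟨m, 8 * (8 * (8 * (3 * W ^ 2) * (3 * M ^ 2))), hm, ?_, ?_⟩
  · have : 1 ≤ W ^ 2 := one_le_pow₀ hW1
    have : 1 ≤ M ^ 2 := one_le_pow₀ hM1
    nlinarith
  intro r hr l hl hs
  set S := ∑ h, r h with hS
  set bad := (box3 r).filter fun I => -(m * δ / 6) < ∑ h, (∑ k, l h k * I h k) / r h with hbad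
  have hch := chernoff r hr l δ hδ hδ1 hl hs
  rw [← hbad] at hch
  have : Nonempty (box3 r) := (box3_nonempty r).to_subtype
  -- the matrix
  let V : (Fin m → Fin 3 → ℕ) → Fin d → ℤ := fun I i => D ^ (2 * S - wx I) * v (wx I) i
  have hV1 : ∀ I ∈ box3 r, (D:ℝ) ^ (2 * S) * ξ ^ wx I = ∑ i, (V I i : ℝ) * ξ ^ (i : ℕ) := by
    intro I hI
    have h1 : 2 * S = (2 * S - wx I) + wx I := (Nat.sub_add_cancel (wx_le hI)).symm
    conv_lhs => rw [h1, pow_add, mul_assoc, hv1]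
    rw [Finset.mul_sum]
    refine Finset.sum_congr rfl fun i _ => ?_
    simp only [V]; push_cast; ring
  have hV2 : ∀ I ∈ box3 r, ∀ i, |(V I i : ℝ)| ≤ W ^ (2 * S) := by
    intro I hI i
    simp only [V]; push_cast
    have hDR : (0:ℝ) < D := by exact_mod_cast hD
    rw [abs_mul, abs_pow, abs_of_pos hDR]
    calc (D:ℝ) ^ (2 * S - wx I) * |(v (wx I) i : ℝ)| ≤ W ^ (2 * S - wx I) * W ^ wx I := by
          gcongr
          exact hv2 _ _
      _ = _ := by rw [← pow_add, Nat.sub_add_cancel (wx_le hI)]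
  let A : Matrix (bad × Fin d) (box3 r) ℤ := fun a I => NN I.1 a.1.1 * V I.1 a.2
  have hcard : 2 * Fintype.card (bad × Fin d) ≤ Fintype.card (box3 r) := by
    rw [Fintype.card_prod, Fintype.card_fin, Fintype.card_coe, Fintype.card_coe]
    have hn : (0:ℝ) ≤ (box3 r).card := Nat.cast_nonneg _
    have : (2 * (bad.card * d) : ℝ) ≤ (box3 r).card := by
      calc (2 * (bad.card * d) : ℝ) = bad.card * (2 * d) := by ring
        _ ≤ (box3 r).card * Real.exp (-(m * δ ^ 2 / 576)) * (2 * d) := by gcongr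
        _ = (box3 r).card * (2 * d * Real.exp (-(m * δ ^ 2 / 576))) := by ring
        _ ≤ _ := mul_le_of_le_one_right hn hmd
    exact_mod_cast this
  obtain ⟨t, ht0, hAt, htb⟩ := siegel hcard A ((3 * W ^ 2) ^ S)
    (one_le_pow₀ (by have : 1 ≤ W ^ 2 := one_le_pow₀ hW1
                     linarith))
    (by
      rintro ⟨a, i⟩ ⟨I, hI⟩
      simp only [A]; push_cast
      rw [abs_mul, mul_pow, ← pow_mul]
      exact mul_le_mul (NN_bound hI _) (hV2 I hI i) (abs_nonneg _) (by positivity))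
  rw [Fintype.card_coe] at htb
  have hcardR : ((box3 r).card : ℝ) ≤ 8 ^ S := by exact_mod_cast box3_card_le r
  refine ⟨fun I => if hI : I ∈ box3 r then t ⟨I, hI⟩ else 0, ?_, ?_⟩
  · obtain ⟨b, hb⟩ := Function.ne_iff.mp ht0
    refine ⟨b.1, b.2, ?_⟩
    simpa using hb
  set c : (Fin m → Fin 3 → ℕ) → ℤ := fun I => if hI : I ∈ box3 r then t ⟨I, hI⟩ else 0 with hc
  have hcI : ∀ I (hI : I ∈ box3 r), c I = t ⟨I, hI⟩ := by intro I hI; simp [hc, hI]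
  have hcb : ∀ I ∈ box3 r, |(c I : ℝ)| ≤ (8 * (3 * W ^ 2)) ^ S := by
    intro I hI
    rw [hcI I hI, mul_pow]
    refine (htb _).trans ?_
    gcongr
  have hsum : ∑ I ∈ box3 r, |(c I : ℝ)| ≤ (8 * (8 * (3 * W ^ 2))) ^ S := by
    calc _ ≤ ∑ I ∈ box3 r, (8 * (3 * W ^ 2)) ^ S := Finset.sum_le_sum hcb
      _ = (box3 r).card * (8 * (3 * W ^ 2)) ^ S := by simp
      _ ≤ 8 ^ S * (8 * (3 * W ^ 2)) ^ S := by gcongr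
      _ = _ := by rw [← mul_pow]
  have hW2 : 1 ≤ W ^ 2 := one_le_pow₀ hW1
  have hM2 : 1 ≤ M ^ 2 := one_le_pow₀ hM1
  refine ⟨?_, ?_, ?_⟩
  · refine hsum.trans (pow_le_pow_left₀ (by positivity) ?_ _)
    nlinarith
  · have hchb : ∀ I', |chat ξ r c I'| ≤ (8 * (8 * (3 * W ^ 2) * (3 * M ^ 2))) ^ S := by
      intro I'
      unfold chat
      refine (Finset.abs_sum_le_sum_abs _ _).trans ?_
      calc _ ≤ ∑ I ∈ box3 r, |(c I : ℝ)| * (3 * M ^ 2) ^ S := by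
            refine Finset.sum_le_sum fun I hI => ?_
            rw [abs_mul, abs_mul, mul_assoc]
            refine mul_le_mul_of_nonneg_left ?_ (abs_nonneg _)
            rw [mul_comm, mul_pow, ← pow_mul]
            refine mul_le_mul (NN_bound hI _) ?_ (abs_nonneg _) (by positivity)
            rw [abs_pow]
            calc |ξ| ^ wx I ≤ M ^ wx I := pow_le_pow_left₀ (abs_nonneg _) (le_max_right _ _) _
              _ ≤ M ^ (2 * S) := pow_le_pow_right₀ hM1 (wx_le hI)
        _ = (∑ I ∈ box3 r, |(c I : ℝ)|) * (3 * M ^ 2) ^ S := by rw [Finset.sum_mul]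
        _ ≤ (8 * (8 * (3 * W ^ 2))) ^ S * (3 * M ^ 2) ^ S := by gcongr
        _ = _ := by rw [← mul_pow]; ring
    calc _ ≤ ∑ I ∈ box3 r, (8 * (8 * (3 * W ^ 2) * (3 * M ^ 2))) ^ S := Finset.sum_le_sum fun I _ => hchb I
      _ = (box3 r).card * (8 * (8 * (3 * W ^ 2) * (3 * M ^ 2))) ^ S := by simp
      _ ≤ 8 ^ S * (8 * (8 * (3 * W ^ 2) * (3 * M ^ 2))) ^ S := by gcongr
      _ = _ := by rw [← mul_pow]
  · intro I' hI' hne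
    by_contra hcon
    rw [not_le] at hcon
    apply hne
    have hb : I' ∈ bad := by rw [hbad, Finset.mem_filter]; exact ⟨hI', hcon⟩
    have hDR : (0:ℝ) < D := by exact_mod_cast hD
    have h0 : (D:ℝ) ^ (2 * S) * chat ξ r c I' = 0 := by
      unfold chat
      rw [Finset.mul_sum]
      calc _ = ∑ I ∈ box3 r, ∑ i, (c I : ℝ) * NN I I' * (V I i : ℝ) * ξ ^ (i : ℕ) := by
            refine Finset.sum_congr rfl fun I hI => ?_
            have := hV1 I hI
            calc _ = (c I : ℝ) * NN I I' * ((D:ℝ) ^ (2 * S) * ξ ^ wx I) := by ring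
              _ = _ := by rw [this, Finset.mul_sum]; exact Finset.sum_congr rfl fun i _ => by ring
        _ = ∑ i, (∑ I ∈ box3 r, (c I : ℝ) * NN I I' * (V I i : ℝ)) * ξ ^ (i : ℕ) := by
            rw [Finset.sum_comm]
            exact Finset.sum_congr rfl fun i _ => by rw [Finset.sum_mul]
        _ = 0 := by
            refine Finset.sum_eq_zero fun i _ => ?_
            have h1 := congrFun hAt (⟨I', hb⟩, i)
            simp only [Matrix.mulVec, dotProduct, A, Pi.zero_apply] at h1
            have h2 : ∑ I ∈ box3 r, c I * NN I I' * V I i = 0 := by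
              rw [← h1, ← Finset.sum_coe_sort]
              refine Finset.sum_congr rfl fun I _ => ?_
              rw [hcI I.1 I.2]; ring
            have h3 : ∑ I ∈ box3 r, (c I : ℝ) * NN I I' * (V I i : ℝ) = 0 := by exact_mod_cast h2
            rw [h3, zero_mul]
    exact (mul_eq_zero.mp h0).resolve_left (by positivity)
end AB

namespace AB
open MvPolynomial Finset

variable {m : ℕ}

/-- the exponents of the zeroth variables. -/
noncomputable def zpart (d : Fin m × Fin 3 →₀ ℕ) : Fin m →₀ ℕ := Finsupp.equivFunOnFinite.symm fun h => d (h, 0)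

/-- The parametrised points. -/
noncomputable def yG (Y Y' : Fin m → Fin 3 → ℤ) (h : Fin m) (k : Fin 3) : MvPolynomial (Fin m × Fin 3) ℤ :=
  C (Y h k) * X (h, 1) + C (Y' h k) * X (h, 2) + if k = 0 then X (h, 0) else 0

noncomputable def col (I : Fin m → Fin 3 → ℕ) (k : Fin 3) : Fin m →₀ ℕ := Finsupp.equivFunOnFinite.symm fun h => I h k

lemma col_apply (I : Fin m → Fin 3 → ℕ) (k : Fin 3) (h : Fin m) : col I k h = I h k := rfl

lemma prod_X_pow {R : Type} [CommRing R] (e : Fin m →₀ ℕ) : ∏ h, (X h : MvPolynomial (Fin m) R) ^ e h = monomial e 1 := by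
  rw [monomial_eq, C_1, one_mul, Finsupp.prod_fintype _ _ (fun _ => pow_zero _)]

lemma phi_vanish {A : Type} [CommRing A] (r : Fin m → ℕ) (ε : ℝ) (G : MvPolynomial (Fin m × Fin 3) ℤ)
    (hG : ∀ d, wt r (zpart d) ≤ ε → coeff d G = 0) (a b : Fin m → A) (J : Fin m →₀ ℕ) (hJ : wt r J ≤ ε) :
    coeff J (eval₂Hom (Int.castRingHom (MvPolynomial (Fin m) A))
      (fun hk : Fin m × Fin 3 => (![X hk.1, C (a hk.1), C (b hk.1)] : Fin 3 → MvPolynomial (Fin m) A) hk.2) G) = 0 := by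
  classical
  rw [coe_eval₂Hom, eval₂_eq', coeff_sum]
  refine Finset.sum_eq_zero fun d hd => ?_
  have h1 : ∏ i : Fin m × Fin 3, (![X i.1, C (a i.1), C (b i.1)] : Fin 3 → MvPolynomial (Fin m) A) i.2 ^ d i =
      monomial (zpart d) (∏ h, (a h ^ d (h, 1) * b h ^ d (h, 2))) := by
    rw [Fintype.prod_prod_type]
    simp only [Fin.prod_univ_three, Matrix.cons_val_zero, Matrix.cons_val_one, Matrix.cons_val]
    simp only [mul_assoc]
    rw [Finset.prod_mul_distrib]
    have : ∀ h, (X h : MvPolynomial (Fin m) A) ^ d (h, 0) = X h ^ zpart d h := fun h => rfl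
    simp only [this]
    rw [prod_X_pow]
    simp only [← map_pow, ← map_mul, ← map_prod]
    rw [mul_comm, C_mul_monomial, mul_one]
  rw [h1]
  have h2 : (Int.castRingHom (MvPolynomial (Fin m) A)) (coeff d G) = C ((coeff d G : ℤ) : A) := by simp
  rw [h2, coeff_C_mul, coeff_monomial]
  split_ifs with h
  · exfalso
    rw [mem_support_iff] at hd
    exact hd (hG d (by rw [h]; exact hJ))
  · rw [mul_zero]

lemma nonvanish (r : Fin m → ℕ) (c : (Fin m → Fin 3 → ℕ) → ℤ) (hc : ∃ I ∈ box3 r, c I ≠ 0) (p q w : Fin m → ℤ)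
    (hq : ∀ h, 0 < q h) (Y Y' : Fin m → Fin 3 → ℤ)
    (hY : ∀ h, q h * Y h 0 + p h * Y h 1 + w h * Y h 2 = 0)
    (hY' : ∀ h, q h * Y' h 0 + p h * Y' h 1 + w h * Y' h 2 = 0)
    (hdet : ∀ h, Y h 1 * Y' h 2 - Y h 2 * Y' h 1 ≠ 0) (ε : ℝ)
    (hG : ∀ d, wt r (zpart d) ≤ ε → coeff d (ev r c (yG Y Y')) = 0) :
    ∃ P : MvPolynomial (Fin m) ℤ, P ≠ 0 ∧ (∀ s ∈ P.support, ∀ h, s h ≤ r h) ∧ l1 P ≤ ∑ I ∈ box3 r, |(c I : ℝ)| ∧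
      ∀ J, wt r J ≤ ε → coeff J (shift (fun h => (((-p h : ℤ) : ℚ) / q h : ℚ)) (map (Int.castRingHom ℚ) P)) = 0 := by
  classical
  -- minimal exponent
  obtain ⟨I1, hI1, hcI1⟩ := hc
  obtain ⟨e, hemin⟩ := Finset.exists_minimal
    (s := ((box3 r).filter fun I => c I ≠ 0).image fun I => col I 2) ⟨col I1 2, by
      rw [Finset.mem_image]
      exact ⟨I1, by rw [Finset.mem_filter]; exact ⟨hI1, hcI1⟩, rfl⟩⟩
  obtain ⟨he, hmin⟩ := hemin
  rw [Finset.mem_image] at he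
  obtain ⟨I0, hI0, rfl⟩ := he
  rw [Finset.mem_filter] at hI0
  obtain ⟨hI0, hc0⟩ := hI0
  set e := col I0 2 with hedef
  have hmin' : ∀ I ∈ box3 r, c I ≠ 0 → col I 2 ≤ e → col I 2 = e := by
    intro I hI hcI hle
    refine le_antisymm hle (hmin (Finset.mem_image.mpr ?_) hle)
    exact ⟨I, by rw [Finset.mem_filter]; exact ⟨hI, hcI⟩, rfl⟩
  set T := (box3 r).filter fun I => col I 2 = e with hT
  set P : MvPolynomial (Fin m) ℤ := ∑ I ∈ T, monomial (col I 0) (c I) with hP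
  have hinj : ∀ I ∈ T, ∀ I' ∈ T, col I 0 = col I' 0 → I = I' := by
    intro I hI I' hI' h
    rw [hT, Finset.mem_filter] at hI hI'
    funext a
    have h0 := congrArg (fun f => f a) h
    have h2 := congrArg (fun f => f a) (hI.2.trans hI'.2.symm)
    simp only [col_apply] at h0 h2
    have s1 := mem_tri.mp (mem_box3.mp hI.1 a)
    have s2 := mem_tri.mp (mem_box3.mp hI'.1 a)
    rw [Fin.sum_univ_three] at s1 s2
    funext k
    fin_cases k
    · exact h0
    · show I a 1 = I' a 1; omega
    · exact h2
  have hI0T : I0 ∈ T := by rw [hT, Finset.mem_filter]; exact ⟨hI0, rfl⟩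
  refine ⟨P, ?_, ?_, ?_, ?_⟩
  · intro h0
    have : coeff (col I0 0) P = c I0 := by
      rw [hP, coeff_sum]
      rw [Finset.sum_eq_single I0]
      · simp
      · intro I hI hne
        rw [coeff_monomial, if_neg]
        intro h
        exact hne (hinj I hI I0 hI0T h)
      · intro h; exact absurd hI0T h
    rw [h0, coeff_zero] at this
    exact hc0 this.symm
  · intro s hs h
    have hs2 := MvPolynomial.support_sum hs
    rw [Finset.mem_biUnion] at hs2
    obtain ⟨I, hI, hsI⟩ := hs2
    have := support_monomial_subset hsI
    rw [Finset.mem_singleton] at this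
    rw [this, col_apply]
    rw [hT, Finset.mem_filter] at hI
    exact tri_le (mem_box3.mp hI.1 h) 0
  · refine (l1_sum _ _).trans ?_
    simp only [l1_monomial, Int.norm_eq_abs]
    exact Finset.sum_le_sum_of_subset_of_nonneg (Finset.filter_subset _ _) fun _ _ _ => abs_nonneg _
  · intro J hJ
    let A := MvPolynomial (Fin m) ℚ
    let Δ : Fin m → ℚ := fun h => Y h 1 * Y' h 2 - Y h 2 * Y' h 1
    have hΔ : ∀ h, Δ h ≠ 0 := fun h => by simp only [Δ]; exact_mod_cast hdet h
    let a : Fin m → A := fun h => C (1 / Δ h) * (C (Y' h 2 : ℚ) - X h * C (Y' h 1 : ℚ))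
    let b : Fin m → A := fun h => C (1 / Δ h) * (X h * C (Y h 1 : ℚ) - C (Y h 2 : ℚ))
    have key := phi_vanish r ε _ hG a b J hJ
    rw [map_ev] at key
    have hqQ : ∀ h, (q h : ℚ) ≠ 0 := fun h => by exact_mod_cast (hq h).ne'
    -- images of coordinates
    have haux : ∀ h, (Y h 1 : A) * a h + (Y' h 1 : A) * b h = 1 ∧ (Y h 2 : A) * a h + (Y' h 2 : A) * b h = X h ∧
        (Y h 0 : A) * a h + (Y' h 0 : A) * b h = C (-(p h : ℚ) / q h) + C (-(w h : ℚ) / q h) * X h := by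
      intro h
      have hΔ1 : (C (1 / Δ h) : A) * ((Y h 1 : A) * (Y' h 2 : A) - (Y h 2 : A) * (Y' h 1 : A)) = 1 := by
        have : ((Y h 1 : A) * (Y' h 2 : A) - (Y h 2 : A) * (Y' h 1 : A)) = C (Δ h) := by simp [Δ, A]
        rw [this, ← C_mul, one_div, inv_mul_cancel₀ (hΔ h), C_1]
      have hc1 : ∀ n : ℤ, (C (n : ℚ) : A) = (n : A) := fun n => by simp [A]
      have e1 : (Y h 1 : A) * a h + (Y' h 1 : A) * b h = 1 := by
        simp only [a, b, hc1]
        linear_combination hΔ1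
      have e2 : (Y h 2 : A) * a h + (Y' h 2 : A) * b h = X h := by
        simp only [a, b, hc1]
        linear_combination X h * hΔ1
      refine ⟨e1, e2, ?_⟩
      have hYA : (q h : A) * Y h 0 + p h * Y h 1 + w h * Y h 2 = 0 := by exact_mod_cast congrArg (Int.cast : ℤ → A) (hY h)
      have hYA' : (q h : A) * Y' h 0 + p h * Y' h 1 + w h * Y' h 2 = 0 := by exact_mod_cast congrArg (Int.cast : ℤ → A) (hY' h)
      have hqA : (C (1 / (q h : ℚ)) : A) * (q h : A) = 1 := by
        rw [← hc1, ← C_mul, one_div, inv_mul_cancel₀ (hqQ h), C_1]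
      have ep : (C (-(p h : ℚ) / q h) : A) = - C (1 / (q h : ℚ)) * (p h : A) := by
        rw [← hc1, ← C_neg, ← C_mul]; congr 1; ring
      have ew : (C (-(w h : ℚ) / q h) : A) = - C (1 / (q h : ℚ)) * (w h : A) := by
        rw [← hc1, ← C_neg, ← C_mul]; congr 1; ring
      rw [ep, ew]
      linear_combination (C (1 / (q h : ℚ)) : A) * (a h) * hYA + (C (1 / (q h : ℚ)) : A) * (b h) * hYA'
        - (C (1 / (q h : ℚ)) : A) * (p h) * e1 - (C (1 / (q h : ℚ)) : A) * (w h) * e2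
        - (Y h 0 * a h + Y' h 0 * b h) * hqA
    set Φ := eval₂Hom (Int.castRingHom (MvPolynomial (Fin m) A))
      (fun hk : Fin m × Fin 3 => (![X hk.1, C (a hk.1), C (b hk.1)] : Fin 3 → MvPolynomial (Fin m) A) hk.2) with hΦ
    have hΦk : ∀ h k, Φ (yG Y Y' h k) = C ((Y h k : A) * a h + (Y' h k : A) * b h) + if k = 0 then X h else 0 := by
      intro h k
      rw [yG, map_add, map_add, map_mul, map_mul]
      simp only [hΦ, coe_eval₂Hom, eval₂_C, eval₂_X, Matrix.cons_val_one, Matrix.cons_val_zero, Matrix.cons_val]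
      congr 1
      · simp
      · split_ifs <;> simp
    let F : (Fin m → Fin 3 → ℕ) → MvPolynomial (Fin m) A := fun I =>
      ∏ h, (X h + C (C (-(p h : ℚ) / q h) + C (-(w h : ℚ) / q h) * X h)) ^ I h 0
    have hterm : ∀ I, ∏ h, ∏ k, Φ (yG Y Y' h k) ^ I h k = C (monomial (col I 2) (1:ℚ)) * F I := by
      intro I
      have : ∀ h, ∏ k, Φ (yG Y Y' h k) ^ I h k =
          C (X h ^ (col I 2 h) : A) * (X h + C (C (-(p h : ℚ) / q h) + C (-(w h : ℚ) / q h) * X h)) ^ I h 0 := by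
        intro h
        rw [Fin.prod_univ_three, hΦk, hΦk, hΦk, (haux h).1, (haux h).2.1, (haux h).2.2, col_apply]
        simp only [if_true, one_ne_zero, if_false, Fin.reduceEq, map_pow]
        rw [C_1]
        ring
      simp only [this]
      rw [Finset.prod_mul_distrib, ← map_prod, prod_X_pow]
    have hshift : ∀ I, coeff J (shift (fun h => (((-p h : ℤ) : ℚ) / q h : ℚ)) (monomial (col I 0) (1:ℚ))) =
        constantCoeff (coeff J (F I)) := by
      intro I
      rw [← coeff_map]
      congr 1
      simp only [F, map_prod, map_pow, map_add, MvPolynomial.map_X, MvPolynomial.map_C, map_mul, constantCoeff_C,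
        constantCoeff_X, mul_zero, add_zero]
      rw [← prod_X_pow, map_prod]
      refine Finset.prod_congr rfl fun h _ => ?_
      rw [map_pow, shift, aeval_X, col_apply]
      push_cast
      simp
    have key2 : coeff e (coeff J (ev r c fun h k => Φ (yG Y Y' h k))) = 0 := by rw [key, coeff_zero]
    rw [ev, coeff_sum, coeff_sum] at key2
    rw [hP, map_sum, map_sum, coeff_sum]
    rw [← key2, hT, Finset.sum_filter]
    refine Finset.sum_congr rfl fun I hI => ?_
    rw [hterm]
    have h3 : ((c I : ℤ) : MvPolynomial (Fin m) A) * (C (monomial (col I 2) (1:ℚ)) * F I) =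
        C (monomial (col I 2) (c I : ℚ)) * F I := by
      have : ((c I : ℤ) : MvPolynomial (Fin m) A) = C (C (c I : ℚ)) := by simp [A]
      rw [this, ← mul_assoc, ← C_mul, C_mul_monomial, mul_one]
    rw [h3, coeff_C_mul, coeff_monomial_mul']
    split_ifs with h1 h2 h2
    · rw [h1, tsub_self, ← constantCoeff_eq, ← hshift]
      have : map (Int.castRingHom ℚ) (monomial (col I 0) (c I)) = (c I : ℚ) • monomial (col I 0) (1:ℚ) := by
        rw [map_monomial, smul_monomial, smul_eq_mul, mul_one]; rfl
      rw [this, map_smul, coeff_smul, smul_eq_mul]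
    · exact absurd h1.le h2
    · have : c I = 0 := by
        by_contra hcI
        exact h1 (hmin' I hI hcI h2)
      rw [this]; simp
    · rfl
end AB

namespace AB
open MvPolynomial Finset

variable {m : ℕ}

lemma coeff_scale {σ : Type} [Fintype σ] (a : σ → ℝ) (p : MvPolynomial σ ℤ) (d : σ →₀ ℕ) :
    coeff d (eval₂Hom (Int.castRingHom (MvPolynomial σ ℝ)) (fun i => C (a i) * X i) p) =
      ((coeff d p : ℤ) : ℝ) * ∏ i, a i ^ d i := by
  classical
  induction p using MvPolynomial.induction_on' with
  | monomial e n =>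
    rw [coe_eval₂Hom, eval₂_monomial, Finsupp.prod_fintype _ _ (fun _ => pow_zero _)]
    simp only [mul_pow]
    rw [Finset.prod_mul_distrib]
    have h1 : ∏ i, (X i : MvPolynomial σ ℝ) ^ e i = monomial e 1 := by
      rw [monomial_eq, C_1, one_mul, Finsupp.prod_fintype _ _ (fun _ => pow_zero _)]
    have h2 : (Int.castRingHom (MvPolynomial σ ℝ)) n = C (n : ℝ) := by simp
    rw [h1, h2]
    simp only [← map_pow, ← map_prod]
    rw [C_mul_monomial, C_mul_monomial, coeff_monomial, coeff_monomial, mul_one]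
    split_ifs with h
    · rw [h]
    · simp
  | add p q hp hq => rw [map_add, coeff_add, hp, hq, coeff_add]; push_cast; ring

lemma X_le {r : ℕ} (hr : 0 < r) {i : Fin 3 → ℕ} (hi : i ∈ tri r) (l : Fin 3 → ℝ) (hl : ∀ k, |l k| ≤ 2) :
    (∑ k, l k * i k) / r ≤ 2 := by
  have hrR : (0:ℝ) < r := by exact_mod_cast hr
  rw [div_le_iff₀ hrR]
  calc ∑ k, l k * i k ≤ ∑ k, 2 * (i k : ℝ) := by
        refine Finset.sum_le_sum fun k _ => ?_
        exact mul_le_mul_of_nonneg_right ((le_abs_self _).trans (hl k)) (Nat.cast_nonneg _)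
    _ = 2 * r := by
        rw [← Finset.mul_sum]; rw [mem_tri] at hi; rw [← hi]; push_cast; rfl

lemma vanish (x : ℝ) (hx0 : 0 < x) (hx1 : x < 1) (r : Fin m → ℕ) (hr : ∀ h, 0 < r h) (c : (Fin m → Fin 3 → ℕ) → ℤ)
    (Y Y' : Fin m → Fin 3 → ℤ) (l : Fin m → Fin 3 → ℝ) (L : Fin m → ℝ) (R C₀ ε μ : ℝ) (hR : 0 ≤ R) (hL : ∀ h, 0 < L h)
    (hLR : ∀ h, L h ≤ R) (hr1 : ∀ h, R ≤ r h * L h) (hr2 : ∀ h, r h * L h ≤ R + L h) (hC : 1 ≤ C₀)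
    (hl : ∀ h k, |l h k| ≤ 2)
    (hY : ∀ h k, k ≠ 0 → |(Y h k : ℝ)| ≤ Real.exp (l h k * L h) ∧ |(Y' h k : ℝ)| ≤ Real.exp (l h k * L h))
    (hYx : ∀ h, |∑ k, (Y h k : ℝ) * x ^ (k : ℕ)| ≤ 3 * Real.exp (l h 0 * L h))
    (hYx' : ∀ h, |∑ k, (Y' h k : ℝ) * x ^ (k : ℕ)| ≤ 3 * Real.exp (l h 0 * L h))
    (hchat : ∑ I ∈ box3 r, |chat x⁻¹ r c I| ≤ C₀ ^ (∑ h, r h))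
    (hbad : ∀ I ∈ box3 r, chat x⁻¹ r c I ≠ 0 → ∑ h, (∑ k, l h k * I h k) / r h ≤ -μ)
    (hfin : (∑ h, (r h : ℝ)) * Real.log (7 * C₀) + 2 * ∑ h, L h + 4 * R * ε < R * μ)
    (d : Fin m × Fin 3 →₀ ℕ) (hd : wt r (zpart d) ≤ ε) : coeff d (ev r c (yG Y Y')) = 0 := by
  classical
  set ρ : Fin m → ℝ := fun h => Real.exp (l h 0 * L h) with hρ
  let sc : Fin m × Fin 3 → ℝ := fun hk => if hk.2 = 0 then ρ hk.1 else 1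
  let u : Fin m → Fin 3 → MvPolynomial (Fin m × Fin 3) ℝ := fun h k =>
    if k = 0 then C (∑ k, (Y h k : ℝ) * x ^ (k : ℕ)) * X (h, 1) + C (∑ k, (Y' h k : ℝ) * x ^ (k : ℕ)) * X (h, 2) +
      C (ρ h) * X (h, 0)
    else C (x ^ (k : ℕ)) * (C (Y h k : ℝ) * X (h, 1) + C (Y' h k : ℝ) * X (h, 2))
  set Φ := eval₂Hom (Int.castRingHom (MvPolynomial (Fin m × Fin 3) ℝ)) (fun i => C (sc i) * X i) with hΦ
  have hΦk : ∀ h k, Φ (yG Y Y' h k) = sub3 x⁻¹ u h k := by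
    intro h k
    have e1 : Φ (yG Y Y' h k) = C (Y h k : ℝ) * X (h, 1) + C (Y' h k : ℝ) * X (h, 2) +
        if k = 0 then C (ρ h) * X (h, 0) else 0 := by
      rw [yG, map_add, map_add, map_mul, map_mul]
      simp only [hΦ, coe_eval₂Hom, eval₂_C, eval₂_X, sc]
      congr 1
      · simp
      · split_ifs <;> simp
    rw [e1]
    have hxk : ∀ n : ℕ, x⁻¹ ^ n * x ^ n = 1 := fun n => by
      rw [← mul_pow, inv_mul_cancel₀ hx0.ne', one_pow]
    by_cases hk : k = 0
    · subst hk
      simp only [sub3, if_true, u, one_ne_zero, if_false, Fin.reduceEq, Fin.sum_univ_three, map_add, map_mul, map_pow]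
      simp
      ring
    · simp only [sub3, hk, if_false, u, add_zero]
      rw [← mul_assoc, algebraMap_eq, ← C_mul, hxk, C_1, one_mul]
  have hev : Φ (ev r c (yG Y Y')) = evR r (chat x⁻¹ r c) u := by
    rw [map_ev, ← ev_sub3]
    congr 1
    funext h k
    exact hΦk h k
  have hl1u : ∀ h k, l1 (u h k) ≤ 7 * Real.exp (l h k * L h) := by
    intro h k
    have hCX : ∀ (a : ℝ) (i : Fin m × Fin 3), l1 (C a * X i : MvPolynomial (Fin m × Fin 3) ℝ) ≤ |a| := by
      intro a i
      refine (l1_mul _ _).trans ?_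
      rw [l1_C, l1_X, mul_one, Real.norm_eq_abs]
    by_cases hk : k = 0
    · subst hk
      simp only [u, if_true]
      have h1 := hCX (∑ k, (Y h k : ℝ) * x ^ (k : ℕ)) (h, 1)
      have h2 := hCX (∑ k, (Y' h k : ℝ) * x ^ (k : ℕ)) (h, 2)
      have h3 := hCX (ρ h) (h, 0)
      have h4 : |ρ h| = Real.exp (l h 0 * L h) := abs_of_pos (Real.exp_pos _)
      have h5 := hYx h
      have h6 := hYx' h
      refine (l1_add _ _).trans ?_
      have := l1_add (C (∑ k, (Y h k : ℝ) * x ^ (k : ℕ)) * X (h, 1) : MvPolynomial (Fin m × Fin 3) ℝ)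
        (C (∑ k, (Y' h k : ℝ) * x ^ (k : ℕ)) * X (h, 2))
      linarith
    · simp only [u, hk, if_false]
      refine (l1_mul _ _).trans ?_
      rw [l1_C, Real.norm_eq_abs, abs_of_pos (by positivity)]
      have h1 := hCX (Y h k : ℝ) (h, 1)
      have h2 := hCX (Y' h k : ℝ) (h, 2)
      have h3 := l1_add (C (Y h k : ℝ) * X (h, 1) : MvPolynomial (Fin m × Fin 3) ℝ) (C (Y' h k : ℝ) * X (h, 2))
      have h4 := hY h k hk
      have h5 : x ^ (k : ℕ) ≤ 1 := pow_le_one₀ hx0.le hx1.le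
      have h6 := l1_nonneg (C (Y h k : ℝ) * X (h, 1) + C (Y' h k : ℝ) * X (h, 2) : MvPolynomial (Fin m × Fin 3) ℝ)
      have h7 := Real.exp_pos (l h k * L h)
      calc _ ≤ 1 * l1 (C (Y h k : ℝ) * X (h, 1) + C (Y' h k : ℝ) * X (h, 2) : MvPolynomial (Fin m × Fin 3) ℝ) := by gcongr
        _ ≤ _ := by linarith [h4.1, h4.2]
  set S := ∑ h, r h with hS
  set Λ := ∑ h, L h with hΛ
  have hprod : ∀ I ∈ box3 r, chat x⁻¹ r c I ≠ 0 →
      ∏ h, ∏ k, l1 (u h k) ^ I h k ≤ 7 ^ S * Real.exp (-(R * μ) + 2 * Λ) := by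
    intro I hI hne
    have hb := hbad I hI hne
    have hIt := mem_box3.mp hI
    calc ∏ h, ∏ k, l1 (u h k) ^ I h k ≤ ∏ h, ∏ k, (7 * Real.exp (l h k * L h)) ^ I h k := by
          refine Finset.prod_le_prod (fun h _ => Finset.prod_nonneg fun k _ => pow_nonneg (l1_nonneg _) _) fun h _ => ?_
          refine Finset.prod_le_prod (fun k _ => pow_nonneg (l1_nonneg _) _) fun k _ => ?_
          exact pow_le_pow_left₀ (l1_nonneg _) (hl1u h k) _
      _ = ∏ h, (7 ^ r h * Real.exp (L h * ∑ k, l h k * I h k)) := by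
          refine Finset.prod_congr rfl fun h _ => ?_
          simp only [mul_pow]
          rw [Finset.prod_mul_distrib, Finset.prod_pow_eq_pow_sum, mem_tri.mp (hIt h)]
          simp only [← Real.exp_nat_mul]
          rw [← Real.exp_sum, Finset.mul_sum]
          congr 2
          exact Finset.sum_congr rfl fun k _ => by ring
      _ = 7 ^ S * Real.exp (∑ h, L h * ∑ k, l h k * I h k) := by
          rw [Finset.prod_mul_distrib, Finset.prod_pow_eq_pow_sum, ← Real.exp_sum]
      _ ≤ 7 ^ S * Real.exp (-(R * μ) + 2 * Λ) := by
          refine mul_le_mul_of_nonneg_left (Real.exp_le_exp.mpr ?_) (by positivity)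
          have h1 : ∀ h, L h * ∑ k, l h k * I h k ≤ R * ((∑ k, l h k * I h k) / r h) + 2 * L h := by
            intro h
            have hrR : (0:ℝ) < r h := by exact_mod_cast hr h
            have hX := X_le (hr h) (hIt h) (l h) (hl h)
            set Xh := (∑ k, l h k * I h k) / r h with hXh
            have : ∑ k, l h k * (I h k : ℝ) = r h * Xh := by rw [hXh]; field_simp
            rw [this]
            have a1 : 0 ≤ r h * L h - R := by linarith [hr1 h]
            have a2 : r h * L h - R ≤ L h := by linarith [hr2 h]
            have : L h * (r h * Xh) - R * Xh = (r h * L h - R) * Xh := by ring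
            nlinarith [hL h]
          calc _ ≤ ∑ h, (R * ((∑ k, l h k * I h k) / r h) + 2 * L h) := Finset.sum_le_sum fun h _ => h1 h
            _ = R * (∑ h, (∑ k, l h k * I h k) / r h) + 2 * Λ := by
                rw [Finset.sum_add_distrib, ← Finset.mul_sum, ← Finset.mul_sum]
            _ ≤ _ := by
                nlinarith
  have hl1 : l1 (Φ (ev r c (yG Y Y'))) ≤ C₀ ^ S * (7 ^ S * Real.exp (-(R * μ) + 2 * Λ)) := by
    rw [hev, evR]
    refine (l1_sum _ _).trans ?_
    calc _ ≤ ∑ I ∈ box3 r, |chat x⁻¹ r c I| * (7 ^ S * Real.exp (-(R * μ) + 2 * Λ)) := by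
          refine Finset.sum_le_sum fun I hI => ?_
          by_cases hne : chat x⁻¹ r c I = 0
          · rw [hne, map_zero, zero_mul, l1_zero, abs_zero, zero_mul]
          refine (l1_mul _ _).trans ?_
          rw [algebraMap_eq, l1_C, Real.norm_eq_abs]
          refine mul_le_mul_of_nonneg_left ?_ (abs_nonneg _)
          refine le_trans ?_ (hprod I hI hne)
          refine (l1_prod _ _).trans ?_
          refine Finset.prod_le_prod (fun _ _ => l1_nonneg _) fun h _ => ?_
          refine (l1_prod _ _).trans ?_
          exact Finset.prod_le_prod (fun _ _ => l1_nonneg _) fun k _ => l1_pow _ _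
      _ = (∑ I ∈ box3 r, |chat x⁻¹ r c I|) * (7 ^ S * Real.exp (-(R * μ) + 2 * Λ)) := by rw [Finset.sum_mul]
      _ ≤ _ := by gcongr
  have hcoef := (norm_coeff_le_l1 _ d).trans hl1
  rw [hΦ, coeff_scale] at hcoef
  have hscale : Real.exp (-(4 * R * ε)) ≤ ∏ i, sc i ^ d i := by
    rw [Fintype.prod_prod_type]
    simp only [Fin.prod_univ_three, sc, if_true, one_ne_zero, if_false, Fin.reduceEq, one_pow, mul_one, hρ]
    simp only [← Real.exp_nat_mul]
    rw [← Real.exp_sum]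
    apply Real.exp_le_exp.mpr
    have h1 : ∀ h, -(4 * R * ((zpart d h : ℝ) / r h)) ≤ (d (h, 0) : ℝ) * (l h 0 * L h) := by
      intro h
      have hz : (zpart d h : ℝ) = d (h, 0) := rfl
      rw [hz]
      have hrR : (0:ℝ) < r h := by exact_mod_cast hr h
      have hd0 : (0:ℝ) ≤ d (h, 0) := Nat.cast_nonneg _
      set y := (d (h, 0) : ℝ) / r h with hy
      have hdy : (d (h, 0) : ℝ) = y * r h := by rw [hy]; field_simp
      have hy0 : 0 ≤ y := by positivity
      rw [hdy]
      have h2 := abs_le.mp (hl h 0)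
      have h3 : r h * L h ≤ 2 * R := by linarith [hr2 h, hLR h]
      have h4 : 0 ≤ r h * L h := mul_nonneg hrR.le (hL h).le
      have h5 : 0 ≤ y * (r h * L h) := mul_nonneg hy0 h4
      have h6 : y * (r h * L h) ≤ y * (2 * R) := mul_le_mul_of_nonneg_left h3 hy0
      calc -(4 * R * y) ≤ -(2 * (y * (r h * L h))) := by linarith
        _ ≤ l h 0 * (y * (r h * L h)) := by nlinarith [h2.1]
        _ = _ := by ring
    have h7 : ∑ h, -(4 * R * ((zpart d h : ℝ) / r h)) = -(4 * R * wt r (zpart d)) := by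
      rw [Finset.sum_neg_distrib, ← Finset.mul_sum]; rfl
    have h8 := Finset.sum_le_sum fun h (_ : h ∈ Finset.univ) => h1 h
    rw [h7] at h8
    refine le_trans ?_ h8
    nlinarith
  by_contra hne
  have hge : (1:ℝ) ≤ |((coeff d (ev r c (yG Y Y')) : ℤ) : ℝ)| := by
    exact_mod_cast Int.one_le_abs hne
  rw [norm_mul, Real.norm_eq_abs, Real.norm_eq_abs] at hcoef
  have h9 : Real.exp (-(4 * R * ε)) ≤ |((coeff d (ev r c (yG Y Y')) : ℤ) : ℝ)| * |∏ i, sc i ^ d i| := by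
    have := hscale.trans (le_abs_self _)
    nlinarith [Real.exp_pos (-(4 * R * ε))]
  have h10 := h9.trans hcoef
  have h11 : C₀ ^ S * (7 ^ S * Real.exp (-(R * μ) + 2 * Λ)) =
      Real.exp ((∑ h, (r h : ℝ)) * Real.log (7 * C₀) + (-(R * μ) + 2 * Λ)) := by
    rw [Real.exp_add _ (-(R * μ) + 2 * Λ), ← mul_assoc, ← mul_pow]
    congr 1
    have : ∑ h, (r h : ℝ) = (S : ℝ) := by rw [hS]; push_cast; rfl
    rw [this, Real.exp_nat_mul, Real.exp_log (by positivity), mul_comm C₀]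
  rw [h11, Real.exp_le_exp] at h10
  linarith
end AB

namespace AB
open Finset MvPolynomial

/-- good approximation triples. -/
def Good (x : ℝ) (N0 : ℕ) (t : ℤ × ℤ × ℤ) : Prop :=
  (N0 : ℤ) ≤ t.1 ∧ 0 < t.1 ∧ IsCoprime t.2.1 t.1 ∧ |(t.1:ℝ) * x - t.2.1| ≤ 1 / t.1 ∧ |(t.1:ℝ) * x ^ 2 - t.2.2| ≤ 2 / t.1

lemma sparse (x : ℝ) (N0 : ℕ)
    (happ : ∀ N : ℕ, ∃ q p r : ℤ, (N:ℤ) ≤ q ∧ 0 < q ∧ IsCoprime p q ∧ |(q:ℝ) * x - p| ≤ 1 / q ∧ |(q:ℝ) * x ^ 2 - r| ≤ 2 / q)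
    (m : ℕ) (B F : ℝ) (hB : 0 < B) (hF : 1 ≤ F) :
    ∃ t : Fin m → ℤ × ℤ × ℤ, (∀ h, Good x N0 (t h)) ∧ (∀ h, B ≤ Real.log (t h).1) ∧
      ∀ i j, i < j → F * Real.log (t j).1 ≤ Real.log (t i).1 := by
  have hg : ∀ b : ℝ, ∃ t, Good x N0 t ∧ b ≤ Real.log t.1 := by
    intro b
    obtain ⟨N, hN⟩ := exists_nat_ge (Real.exp b)
    obtain ⟨q, p, r, h1, h2, h3, h4, h5⟩ := happ (N0 + N)
    refine ⟨(q, p, r), ⟨by push_cast at h1; simp only; omega, h2, h3, h4, h5⟩, ?_⟩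
    have : (N:ℝ) ≤ q := by
      have : (N:ℤ) ≤ q := by push_cast at h1; omega
      exact_mod_cast this
    rw [Real.le_log_iff_exp_le (by exact_mod_cast h2)]
    exact hN.trans this
  choose g hg1 hg2 using hg
  let t : ℕ → ℤ × ℤ × ℤ := fun n => Nat.rec (g B) (fun _ s => g (F * Real.log s.1)) n
  have ht0 : t 0 = g B := rfl
  have hts : ∀ n, t (n + 1) = g (F * Real.log (t n).1) := fun n => rfl
  have hgood : ∀ n, Good x N0 (t n) := by
    intro n
    cases n with
    | zero => rw [ht0]; exact hg1 _
    | succ n => rw [hts]; exact hg1 _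
  have hstep : ∀ n, F * Real.log (t n).1 ≤ Real.log (t (n + 1)).1 := by
    intro n; rw [hts]; exact hg2 _
  have hBl : ∀ n, B ≤ Real.log (t n).1 := by
    intro n
    induction n with
    | zero => rw [ht0]; exact hg2 _
    | succ n ih => have := hstep n; nlinarith
  have hmono : ∀ a b, a < b → F * Real.log (t a).1 ≤ Real.log (t b).1 := by
    intro a b hab
    induction b with
    | zero => omega
    | succ b ih =>
      rcases Nat.lt_succ_iff_lt_or_eq.mp hab with h | h
      · have h1 := ih h
        have h2 := hstep b
        have h3 := hBl b
        nlinarith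
      · rw [h]; exact hstep b
  refine ⟨fun h => t (m - 1 - h), fun h => hgood _, fun h => hBl _, fun i j hij => hmono _ _ ?_⟩
  have := j.2
  have : (i:ℕ) < j := hij
  omega

set_option maxHeartbeats 2000000 in
lemma main_contra (x : ℝ) (hx : IsAlgebraic ℚ x) (h0 : 0 < x) (h1 : x < 1)
    (hind : ∀ y : Fin 3 → ℤ, ∑ k, (y k : ℝ) * x ^ (k : ℕ) = 0 → y = 0)
    (happ : ∀ N : ℕ, ∃ q p r : ℤ, (N:ℤ) ≤ q ∧ 0 < q ∧ IsCoprime p q ∧ |(q:ℝ) * x - p| ≤ 1 / q ∧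
      |(q:ℝ) * x ^ 2 - r| ≤ 2 / q) : False := by
  obtain ⟨δ0, hδ0, N0, hblock⟩ := block x hx h0 h1 hind
  set δ := min δ0 1 with hδd
  have hδ : 0 < δ := lt_min hδ0 one_pos
  obtain ⟨m, C₀, hm, hC, haux⟩ := aux_poly x⁻¹ hx.inv δ hδ (min_le_right _ _)
  have hmR : (0:ℝ) < m := by exact_mod_cast hm
  set μ := m * δ / 6 with hμ
  have hμ0 : 0 < μ := by positivity
  obtain ⟨ω, hω, hroth⟩ := roth_lemma m (min 1 (μ / 16)) (lt_min one_pos (by positivity)) (min_le_left _ _)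
  set ε := min 1 (μ / 16) with hε
  have hεμ : ε ≤ μ / 16 := min_le_right _ _
  set K := Real.log (7 * C₀) with hK
  have hK1 : 1 ≤ K := by
    rw [hK, Real.le_log_iff_exp_le (by positivity)]
    have := Real.exp_one_lt_d9
    linarith
  set κ := min ω (μ / 4) with hκ
  have hκ0 : 0 < κ := lt_min hω (by positivity)
  set ω1 := min ω 1 with hω1
  have hω10 : 0 < ω1 := lt_min hω one_pos
  set B := 2 * m * K / κ + 1 with hB
  have hB0 : 0 < B := by positivity
  obtain ⟨t, htg, htB, htF⟩ := sparse x N0 happ m B (2 / ω1) hB0 (by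
    rw [le_div_iff₀ hω10]
    have : ω1 ≤ 1 := min_le_right _ _
    linarith)
  set L : Fin m → ℝ := fun h => Real.log (t h).1 with hL
  have hL0 : ∀ h, 0 < L h := fun h => hB0.trans_le (htB h)
  choose Y Y' l hY hY' hdet hl hls hYb hYx hYx' using fun h =>
    hblock (t h).1 (t h).2.1 (t h).2.2 (htg h).1 (htg h).2.2.2.1 (htg h).2.2.2.2
  set Λ := ∑ h, L h with hΛ
  have hΛ0 : 0 ≤ Λ := Finset.sum_nonneg fun h _ => (hL0 h).le
  have hLΛ : ∀ h, L h ≤ Λ := fun h => Finset.single_le_sum (fun h _ => (hL0 h).le) (Finset.mem_univ h)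
  set R := 8 * Λ / μ + Λ + 2 * m * K / κ + 1 with hR
  have hR1 : 8 * Λ / μ ≤ R := by have : 0 ≤ 2 * m * K / κ := by positivity
                                 linarith
  have hp1 : 0 ≤ 8 * Λ / μ := by positivity
  have hp2 : 0 ≤ 2 * m * K / κ := by positivity
  have hR0 : 0 < R := by linarith
  have hLR : ∀ h, L h ≤ R := fun h => by linarith [hLΛ h]
  set r : Fin m → ℕ := fun h => ⌈R / L h⌉₊ with hr
  have hr1 : ∀ h, R ≤ r h * L h := by
    intro h
    rw [← div_le_iff₀ (hL0 h)]
    exact Nat.le_ceil _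
  have hrle : ∀ h, (r h : ℝ) ≤ R / L h + 1 := fun h => (Nat.ceil_lt_add_one (div_nonneg hR0.le (hL0 h).le)).le
  have hr2 : ∀ h, r h * L h ≤ R + L h := by
    intro h
    have := mul_le_mul_of_nonneg_right (hrle h) (hL0 h).le
    rw [add_mul, div_mul_cancel₀ _ (hL0 h).ne', one_mul] at this
    exact this
  have hr0 : ∀ h, 0 < r h := fun h => Nat.ceil_pos.mpr (div_pos hR0 (hL0 h))
  -- sum of degrees
  have hSK : (∑ h, (r h : ℝ)) * K ≤ κ * R := by
    have h2 : ∀ h, (r h : ℝ) ≤ κ * R / (m * K) := by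
      intro h
      have a1 : 2 * m * K / κ ≤ L h := by linarith [htB h]
      have a2 : 2 * m * K / κ ≤ R := by linarith
      rw [div_le_iff₀ hκ0] at a1 a2
      have a3 : R / L h ≤ κ * R / (2 * (m * K)) := by
        rw [div_le_div_iff₀ (hL0 h) (by positivity)]
        nlinarith
      have a4 : 1 ≤ κ * R / (2 * (m * K)) := by
        rw [le_div_iff₀ (by positivity)]; linarith
      have a5 : κ * R / (m * K) = κ * R / (2 * (m * K)) + κ * R / (2 * (m * K)) := by
        field_simp; ring
      linarith [hrle h]
    calc (∑ h, (r h : ℝ)) * K ≤ (∑ h : Fin m, κ * R / (m * K)) * K := by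
          gcongr with h; exact h2 h
      _ = κ * R := by
          simp only [Finset.sum_const, Finset.card_univ, Fintype.card_fin, nsmul_eq_mul]
          field_simp
  have hS0 : 0 ≤ ∑ h, (r h : ℝ) := Finset.sum_nonneg fun _ _ => Nat.cast_nonneg _
  have hκω : κ * R ≤ ω * R := mul_le_mul_of_nonneg_right (min_le_left _ _) hR0.le
  have hκμ : κ * R ≤ μ / 4 * R := mul_le_mul_of_nonneg_right (min_le_right _ _) hR0.le
  have hls' : ∀ h, ∑ k, l h k ≤ -δ := fun h => (hls h).trans (neg_le_neg (min_le_left _ _))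
  obtain ⟨c, hc0, hcs, hchat, hbad⟩ := haux r hr0 l hl hls'
  have hfin : (∑ h, (r h : ℝ)) * Real.log (7 * C₀) + 2 * ∑ h, L h + 4 * R * ε < R * μ := by
    rw [← hK, ← hΛ]
    rw [div_le_iff₀ hμ0] at hR1
    have : 4 * R * ε ≤ 4 * R * (μ / 16) := mul_le_mul_of_nonneg_left hεμ (by positivity)
    have : 0 < R * μ := by positivity
    nlinarith
  have hvan := vanish x h0 h1 r hr0 c Y Y' l L R C₀ ε μ hR0.le hL0 hLR hr1 hr2 hC hl hYb hYx hYx' hchat hbad hfin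
  obtain ⟨P, hP0, hPd, hPl, hPv⟩ := nonvanish r c hc0 (fun h => (t h).2.1) (fun h => (t h).1) (fun h => (t h).2.2)
    (fun h => (htg h).2.1) Y Y' hY hY' hdet ε hvan
  obtain ⟨J, hJ, hJne⟩ := hroth r (fun h => -(t h).2.1) (fun h => (t h).1) R P hR0 hr0 (by
    intro i j hij
    have a1 := htF i j hij
    have a1 : 2 / ω1 * L j ≤ L i := a1
    have a2 : (r i : ℝ) ≤ 2 * R / L i := by
      have : 1 ≤ R / L i := by rw [le_div_iff₀ (hL0 i)]; linarith [hLR i]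
      have e : 2 * R / L i = R / L i + R / L i := by ring
      rw [e]; linarith [hrle i]
    have a3 : R / L j ≤ r j := Nat.le_ceil _
    have a4 : 2 * R / L i ≤ ω1 * (R / L j) := by
      rw [← mul_div_assoc, div_le_div_iff₀ (hL0 i) (hL0 j)]
      rw [div_mul_eq_mul_div, div_le_iff₀ hω10] at a1
      nlinarith
    have a5 : ω1 * (R / L j) ≤ ω * r j :=
      mul_le_mul (min_le_left _ _) a3 (div_nonneg hR0.le (hL0 j).le) hω.le
    linarith) (fun h => (htg h).2.1) (fun h => (htg h).2.2.1.neg_left) hr1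
    (by nlinarith) hP0 hPd (by
      have h2 := one_le_l1 P hP0
      have h3 := Real.log_le_log (by linarith) (hPl.trans hcs)
      rw [Real.log_pow] at h3
      push_cast at h3
      have h4 : Real.log C₀ ≤ K := Real.log_le_log (by linarith) (by linarith)
      have h5 : (∑ h, (r h : ℝ)) * Real.log C₀ ≤ (∑ h, (r h : ℝ)) * K := mul_le_mul_of_nonneg_left h4 hS0
      linarith)
  exact hJne (hPv J hJ)
end AB


/-- Adamczewski–Bugeaud combined with Euler–Lagrange: if the continued fraction
expansion of `x` begins in arbitrarily long palindromes and `x` is algebraic, then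
`x` is a quadratic irrational; if moreover the expansion is not eventually periodic,
`x` is transcendental. -/
theorem adamczewski_bugeaud (x : ℝ) (hirr : Irrational x)
    (a : ℕ → ℕ) (ha : ∀ n, 1 ≤ a n) (hcf : HasCF x a)
    (hpal : ∀ N : ℕ, ∃ m, N ≤ m ∧ PalindromicPrefix a m) :
    (IsAlgebraic ℚ x →
      ∃ A B C : ℚ, A ≠ 0 ∧ (A : ℝ) * x ^ 2 + B * x + C = 0) ∧
    ((¬ ∃ c p : ℕ, 0 < p ∧ ∀ n, c ≤ n → a (n + p) = a n) → Transcendental ℚ x) := by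
  have h1 : IsAlgebraic ℚ x → ∃ A B C : ℚ, A ≠ 0 ∧ (A : ℝ) * x ^ 2 + B * x + C = 0 := by
    intro hx
    by_contra hq
    obtain ⟨x0, x1⟩ := AB.cf_mem hirr ha hcf
    refine AB.main_contra x hx x0 x1 ?_ (AB.pal_approx hirr ha hcf hpal)
    intro y hy
    rw [Fin.sum_univ_three] at hy
    simp only [Fin.val_zero, Fin.val_one, Fin.val_two, pow_zero, pow_one, mul_one] at hy
    have h2 : y 2 = 0 := by
      by_contra h2
      refine hq ⟨y 2, y 1, y 0, by exact_mod_cast h2, ?_⟩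
      push_cast
      linarith
    rw [h2] at hy
    have h1 : y 1 = 0 := by
      by_contra h1
      have h1R : (y 1 : ℝ) ≠ 0 := by exact_mod_cast h1
      apply hirr
      refine ⟨-(y 0 : ℚ) / y 1, ?_⟩
      push_cast
      rw [div_eq_iff h1R]
      push_cast at hy
      linarith
    rw [h1] at hy
    have h0 : y 0 = 0 := by
      push_cast at hy
      have : (y 0 : ℝ) = 0 := by linarith
      exact_mod_cast this
    ext k
    fin_cases k
    · exact h0
    · exact h1
    · exact h2
  refine ⟨h1, fun hper halg => hper ?_⟩
  obtain ⟨A, B, C, hA, he⟩ := h1 halg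
  exact AB.lagrange hirr ha hcf A B C hA he
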